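/- Let μ be a Borel measure with finite total mass, g ∈ W^{s,p}_loc(ℝⁿ) ∩ L^{p−1}_{sp}(ℝⁿ), let u be a SOLA of the Dirichlet problem −L_Φ u = μ in Ω, u = g on ℝⁿ∖Ω, and let Ω′ be an open set compactly contained in Ω. If lim_{t→0} sup_{x ∈ Ω′} W^μ_{s,p}(x,t) = 0, then u is continuous in Ω′. -/

import Mathlib

noncomputable section

open MeasureTheory Metric Set Filter Topology
open scoped ENNReal NNReal

/-- Euclidean space `ℝⁿ`. -/
abbrev Rn (n : ℕ) : Type := EuclideanSpace ℝ (Fin n)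

/-- `q_* = max {1, p-1}`. -/
def qStar (p : ℝ) : ℝ := max 1 (p - 1)

/-- `q̄ = min {n(p-1)/(n-s), p}`. -/
def qBar (n : ℕ) (s p : ℝ) : ℝ := min ((n : ℝ) * (p - 1) / ((n : ℝ) - s)) p

/-- Gagliardo seminorm raised to the power `p`, as an `ℝ≥0∞`-valued double integral. -/
def gagliardo (n : ℕ) (s p : ℝ) (O : Set (Rn n)) (v : Rn n → ℝ) : ℝ≥0∞ :=
  ∫⁻ x in O, ∫⁻ y in O, ENNReal.ofReal (|v x - v y| ^ p / ‖x - y‖ ^ ((n : ℝ) + s * p))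

/-- `v ∈ W^{s,p}(O)`. -/
def memWsp (n : ℕ) (s p : ℝ) (O : Set (Rn n)) (v : Rn n → ℝ) : Prop :=
  AEMeasurable v (volume.restrict O) ∧
    (∫⁻ x in O, ENNReal.ofReal (|v x| ^ p)) < ⊤ ∧ gagliardo n s p O v < ⊤

/-- `Tail(v; x₀, r)`. -/
def tailFn (n : ℕ) (s p : ℝ) (v : Rn n → ℝ) (x₀ : Rn n) (r : ℝ) : ℝ≥0∞ :=
  (ENNReal.ofReal (r ^ (s * p)) *
      ∫⁻ x in (ball x₀ r)ᶜ,
        ENNReal.ofReal (|v x| ^ (p - 1) / ‖x - x₀‖ ^ ((n : ℝ) + s * p))) ^ (1 / (p - 1))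

/-- `v ∈ L^{p-1}_{sp}(ℝⁿ)`. -/
def memTailSpace (n : ℕ) (s p : ℝ) (v : Rn n → ℝ) : Prop :=
  AEMeasurable v (volume : Measure (Rn n)) ∧
    (∀ R : ℝ, (∫⁻ x in ball (0 : Rn n) R, ENNReal.ofReal (|v x| ^ (p - 1))) < ⊤) ∧
    ∀ z : Rn n, ∀ r : ℝ, 0 < r → tailFn n s p v z r < ⊤

/-- `φ ∈ C_0^∞(O)`. -/
def IsTestFun (n : ℕ) (O : Set (Rn n)) (φ : Rn n → ℝ) : Prop :=
  ContDiff ℝ (⊤ : ℕ∞) φ ∧ HasCompactSupport φ ∧ tsupport φ ⊆ O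

/-- The nonlocal form `⟨-L_Φ u, φ⟩`. -/
def nonlocalForm (n : ℕ) (Φ : ℝ → ℝ) (K : Rn n → Rn n → ℝ) (u φ : Rn n → ℝ) : ℝ :=
  ∫ x : Rn n, ∫ y : Rn n, Φ (u x - u y) * (φ x - φ y) * K x y

/-- Ellipticity/coercivity bounds on the kernel `K`. -/
def KernelBounds (n : ℕ) (Λ s p : ℝ) (K : Rn n → Rn n → ℝ) : Prop :=
  Measurable (Function.uncurry K) ∧
    ∀ x y : Rn n, x ≠ y →
      1 / (Λ * ‖x - y‖ ^ ((n : ℝ) + s * p)) ≤ K x y ∧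
        K x y ≤ Λ / ‖x - y‖ ^ ((n : ℝ) + s * p)

/-- Structure conditions on `Φ`. -/
def PhiBounds (Λ p : ℝ) (Φ : ℝ → ℝ) : Prop :=
  Continuous Φ ∧ Φ 0 = 0 ∧
    ∀ t : ℝ, |t| ^ p / Λ ≤ Φ t * t ∧ Φ t * t ≤ Λ * |t| ^ p

/-- `∫ φ dμ` for a signed measure `μ`. -/
def sintegral (n : ℕ) (μ : MeasureTheory.SignedMeasure (Rn n)) (φ : Rn n → ℝ) : ℝ :=
  (∫ x, φ x ∂μ.toJordanDecomposition.posPart) -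
    ∫ x, φ x ∂μ.toJordanDecomposition.negPart

/-- Weak (energy) solution of `-L_Φ u = f` in `Ω`, `u = g` on `ℝⁿ ∖ Ω`. -/
def WeakSol (n : ℕ) (Φ : ℝ → ℝ) (K : Rn n → Rn n → ℝ) (s p : ℝ)
    (Ω : Set (Rn n)) (f g u : Rn n → ℝ) : Prop :=
  memWsp n s p univ u ∧ (∀ᵐ x : Rn n, x ∉ Ω → u x = g x) ∧
    ∀ φ : Rn n → ℝ, IsTestFun n Ω φ → nonlocalForm n Φ K u φ = ∫ x : Rn n, φ x * f x

/-- Weak subsolution of the homogeneous equation `-L_Φ w = 0` in `Ω`. -/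
def WeakSubSol (n : ℕ) (Φ : ℝ → ℝ) (K : Rn n → Rn n → ℝ) (s p : ℝ)
    (Ω : Set (Rn n)) (w : Rn n → ℝ) : Prop :=
  memWsp n s p univ w ∧
    ∀ φ : Rn n → ℝ, IsTestFun n Ω φ → (∀ x, 0 ≤ φ x) → nonlocalForm n Φ K w φ ≤ 0

/-- The approximation properties required of a SOLA. -/
def SOLAApprox (n : ℕ) (Φ : ℝ → ℝ) (K : Rn n → Rn n → ℝ) (s p : ℝ)
    (Ω : Set (Rn n)) (μ : MeasureTheory.SignedMeasure (Rn n)) (g u : Rn n → ℝ)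
    (uj μj gj : ℕ → Rn n → ℝ) : Prop :=
  (∀ j, ContDiff ℝ (⊤ : ℕ∞) (μj j) ∧ HasCompactSupport (μj j)) ∧
  (∀ j, ContDiff ℝ (⊤ : ℕ∞) (gj j) ∧ HasCompactSupport (gj j)) ∧
  (∀ j, WeakSol n Φ K s p Ω (μj j) (gj j) (uj j)) ∧
  (∀ᵐ x : Rn n, Tendsto (fun j => uj j x) atTop (𝓝 (u x))) ∧
  (∀ q : ℝ, qStar p ≤ q → q < qBar n s p → ∀ z : Rn n, ∀ r : ℝ, 0 < r →
    Tendsto (fun j => ∫⁻ x in ball z r, ENNReal.ofReal (|uj j x - u x| ^ q)) atTop (𝓝 0)) ∧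
  (∀ φ : Rn n → ℝ, Continuous φ → HasCompactSupport φ → tsupport φ ⊆ Ω →
    Tendsto (fun j => ∫ x : Rn n, φ x * μj j x) atTop (𝓝 (sintegral n μ φ))) ∧
  (∀ z : Rn n, ∀ r : ℝ, 0 < r →
    Filter.limsup (fun j => ∫⁻ x in ball z r, ENNReal.ofReal |μj j x|) atTop
      ≤ μ.totalVariation (closedBall z r)) ∧
  (∀ z : Rn n, ∀ r : ℝ, 0 < r →
    Tendsto (fun j =>
        (∫⁻ x in ball z r, ENNReal.ofReal (|gj j x - g x| ^ p)) +
          gagliardo n s p (ball z r) (fun x => gj j x - g x)) atTop (𝓝 0) ∧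
      Tendsto (fun j => tailFn n s p (fun x => gj j x - g x) z r) atTop (𝓝 0))

/-- SOLA of the Dirichlet problem `-L_Φ u = μ` in `Ω`, `u = g` on `ℝⁿ ∖ Ω`. -/
def IsSOLA (n : ℕ) (Φ : ℝ → ℝ) (K : Rn n → Rn n → ℝ) (s p : ℝ)
    (Ω : Set (Rn n)) (μ : MeasureTheory.SignedMeasure (Rn n)) (g u : Rn n → ℝ) : Prop :=
  (∀ h q : ℝ, 0 < h → h < s → qStar p ≤ q → q < qBar n s p → memWsp n h q Ω u) ∧
  (∀ φ : Rn n → ℝ, IsTestFun n Ω φ → nonlocalForm n Φ K u φ = sintegral n μ φ) ∧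
  (∀ᵐ x : Rn n, x ∉ Ω → u x = g x) ∧
  ∃ uj μj gj : ℕ → Rn n → ℝ, SOLAApprox n Φ K s p Ω μ g u uj μj gj

/-- Truncated Wolff potential `W^ν_{s,p}(x₀, r)`. -/
def wolff (n : ℕ) (s p : ℝ) (ν : Measure (Rn n)) (x₀ : Rn n) (r : ℝ) : ℝ≥0∞ :=
  ∫⁻ ρ in Ioc (0 : ℝ) r,
    (ν (ball x₀ ρ) / ENNReal.ofReal (ρ ^ ((n : ℝ) - s * p))) ^ (1 / (p - 1)) /
      ENNReal.ofReal ρ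

/-- Integral average of `u` over `B_r(x₀)`. -/
def ballAvg (n : ℕ) (u : Rn n → ℝ) (x₀ : Rn n) (r : ℝ) : ℝ :=
  ⨍ x in ball x₀ r, u x

/-- Local excess `A(f; x₀, r)`. -/
def locExcess (n : ℕ) (p : ℝ) (f : Rn n → ℝ) (x₀ : Rn n) (r : ℝ) : ℝ≥0∞ :=
  ((volume (ball x₀ r))⁻¹ *
      ∫⁻ x in ball x₀ r, ENNReal.ofReal (|f x - ballAvg n f x₀ r| ^ qStar p)) ^ (1 / qStar p)

/-- Global excess `E(f; x₀, r)`. -/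
def excess (n : ℕ) (s p : ℝ) (f : Rn n → ℝ) (x₀ : Rn n) (r : ℝ) : ℝ≥0∞ :=
  locExcess n p f x₀ r + tailFn n s p (fun x => f x - ballAvg n f x₀ r) x₀ r

/-- `g ∈ W^{s,p}_loc(ℝⁿ) ∩ L^{p-1}_{sp}(ℝⁿ)`. -/
def BoundaryDatum (n : ℕ) (s p : ℝ) (g : Rn n → ℝ) : Prop :=
  (∀ z : Rn n, ∀ r : ℝ, 0 < r → memWsp n s p (ball z r) g) ∧ memTailSpace n s p g

/-- Symmetric measurable kernel with ellipticity bounds. -/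
def SymKernel (n : ℕ) (Λ s p : ℝ) (Kt : Rn n → Rn n → ℝ) : Prop :=
  KernelBounds n Λ s p Kt ∧ ∀ x y : Rn n, Kt x y = Kt y x

/-- Weak solution of the kernel-`Kt` fractional `p`-Laplace equation with datum `f` in `O`. -/
def WeakSolP (n : ℕ) (Kt : Rn n → Rn n → ℝ) (s p : ℝ) (O : Set (Rn n))
    (f u : Rn n → ℝ) : Prop :=
  memWsp n s p univ u ∧
    ∀ φ : Rn n → ℝ, IsTestFun n O φ →
      (∫ x : Rn n, ∫ y : Rn n,
          |u x - u y| ^ (p - 2) * (u x - u y) * (φ x - φ y) * Kt x y) =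
        ∫ x : Rn n, φ x * f x

/-! ### Truncation -/

/-- Bounded increasing truncation `1 - (1 + t)^{-β}`. -/
def trunc (β t : ℝ) : ℝ := 1 - (1 + t) ^ (-β)

lemma trunc_zero (β : ℝ) : trunc β 0 = 0 := by simp [trunc]

lemma trunc_le_one {β t : ℝ} (ht : 0 ≤ t) : trunc β t ≤ 1 := by
  have : 0 ≤ (1 + t) ^ (-β) := by positivity
  unfold trunc; linarith

lemma trunc_mono {β t t' : ℝ} (hβ : 0 < β) (ht : 0 ≤ t) (htt : t ≤ t') :
    trunc β t ≤ trunc β t' := by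
  have : (1 + t') ^ (-β) ≤ (1 + t) ^ (-β) :=
    Real.rpow_le_rpow_of_nonpos (by linarith) (by linarith) (by linarith)
  unfold trunc; linarith

lemma trunc_nonneg {β t : ℝ} (hβ : 0 < β) (ht : 0 ≤ t) : 0 ≤ trunc β t := by
  simpa [trunc_zero] using trunc_mono hβ le_rfl ht

lemma trunc_pos {β t : ℝ} (hβ : 0 < β) (ht : 0 < t) : 0 < trunc β t := by
  have : (1 + t) ^ (-β) < 1 := Real.rpow_lt_one_of_one_lt_of_neg (by linarith) (by linarith)
  unfold trunc; linarith

lemma trunc_sub_le {β t t' : ℝ} (hβ : 0 < β) (hβ1 : β ≤ 1) (ht : 0 ≤ t) (htt : t ≤ t') :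
    trunc β t' - trunc β t ≤ (t' - t) / (1 + t') := by
  have h1 : 0 < 1 + t := by linarith
  have h2 : 0 < 1 + t' := by linarith
  set ρ := (1 + t) / (1 + t') with hρ
  have hρ0 : 0 < ρ := by positivity
  have hρ1 : ρ ≤ 1 := by rw [hρ, div_le_one h2]; linarith
  have h3 : ρ ≤ ρ ^ β := by
    simpa using Real.rpow_le_rpow_of_exponent_ge hρ0 hρ1 hβ1
  have h4 : (1 + t') ^ (-β) = (1 + t) ^ (-β) * ρ ^ β := by
    rw [hρ, Real.div_rpow h1.le h2.le, Real.rpow_neg h1.le, Real.rpow_neg h2.le]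
    have : (1 + t) ^ β ≠ 0 := by positivity
    field_simp
  have h5 : (1 + t) ^ (-β) ≤ 1 := Real.rpow_le_one_of_one_le_of_nonpos (by linarith) (by linarith)
  have h6 : 0 ≤ (1 + t) ^ (-β) := by positivity
  have h7 : ρ ^ β ≤ 1 := Real.rpow_le_one hρ0.le hρ1 hβ.le
  have h8 : (t' - t) / (1 + t') = 1 - ρ := by rw [hρ]; field_simp; ring
  rw [h8]; unfold trunc; rw [h4]
  nlinarith

lemma abs_trunc_sub_le {β t t' : ℝ} (hβ : 0 < β) (hβ1 : β ≤ 1) (ht : 0 ≤ t) (ht' : 0 ≤ t') :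
    |trunc β t - trunc β t'| ≤ |t - t'| := by
  wlog h : t' ≤ t generalizing t t'
  · rw [abs_sub_comm, abs_sub_comm t]; exact this ht' ht (le_of_not_ge h)
  rw [abs_of_nonneg (sub_nonneg.2 (trunc_mono hβ ht' h)), abs_of_nonneg (by linarith)]
  refine (trunc_sub_le hβ hβ1 ht' h).trans (div_le_self (by linarith) (by linarith))

lemma trunc_half_gap {β t : ℝ} (hβ : 0 < β) (ht : 1 ≤ t) :
    ((4 / 3) ^ β - 1) * 2 ^ (-β) * t ^ (-β) ≤ trunc β t - trunc β (t / 2) := by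
  have h1 : (1 + t / 2) ^ (-β) ≥ (4 / 3) ^ β * (1 + t) ^ (-β) := by
    have e : (4 / 3 : ℝ) ^ β * (1 + t) ^ (-β) = ((3 / 4) * (1 + t)) ^ (-β) := by
      rw [Real.mul_rpow (by norm_num) (by linarith), Real.rpow_neg (by norm_num : (0:ℝ) ≤ 3 / 4),
        ← Real.inv_rpow (by norm_num)]
      norm_num
    rw [e]
    exact Real.rpow_le_rpow_of_nonpos (by linarith) (by linarith) (by linarith)
  have h2 : (2 : ℝ) ^ (-β) * t ^ (-β) ≤ (1 + t) ^ (-β) := by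
    rw [← Real.mul_rpow (by norm_num) (by linarith)]
    exact Real.rpow_le_rpow_of_nonpos (by linarith) (by linarith) (by linarith)
  have h3 : (1 : ℝ) ≤ (4 / 3) ^ β := Real.one_le_rpow (by norm_num) hβ.le
  unfold trunc
  nlinarith

lemma trunc_sub_mul_le {β γ l t : ℝ} (hβ : 0 < β) (hβ1 : β ≤ 1) (hγ : 0 < γ) (hγ1 : γ ≤ 1)
    (hl : 0 ≤ l) (hl1 : l ≤ 1) (ht : 0 ≤ t) :
    trunc β t - trunc β (l * t) ≤ (1 - l) * t ^ γ := by
  refine (trunc_sub_le hβ hβ1 (by positivity) (by nlinarith)).trans ?_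
  have h1 : t / (1 + t) ≤ t ^ γ := by
    rcases le_total t 1 with h | h
    · refine (div_le_self ht (by linarith)).trans ?_
      rcases ht.eq_or_lt with rfl | h0
      · positivity
      · simpa using Real.rpow_le_rpow_of_exponent_ge h0 h hγ1
    · refine le_trans ?_ (Real.one_le_rpow h hγ.le)
      rw [div_le_one (by linarith)]; linarith
  have h2 : (t - l * t) / (1 + t) = (1 - l) * (t / (1 + t)) := by ring
  rw [h2]
  exact mul_le_mul_of_nonneg_left h1 (by linarith)

/-! ### Pointwise inequalities -/

/-- If the increments of `w` and of the cut-off truncation have opposite signs, the product is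
controlled by the increment of the cut-off. -/
lemma opposite_sign_bound {β γ p a b wx wy : ℝ} (hβ : 0 < β) (hβ1 : β ≤ 1)
    (hγ : 0 < γ) (hγ1 : γ ≤ 1) (hp : 1 < p) (ha : 0 ≤ a) (hb : 0 ≤ b) :
    (max (wx - wy) 0) ^ (p - 1) *
        max (trunc β (b ^ (p / γ) * max wy 0) - trunc β (a ^ (p / γ) * max wx 0)) 0 ≤
      (2 ^ p + (2 ^ (p / γ) * (p / γ)) ^ p) * (max wx 0) ^ (p - 1 + γ) * |b - a| ^ p := by
  set m := p / γ with hm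
  have hm1 : 1 ≤ m := by rw [hm, le_div_iff₀ hγ]; linarith
  have hmγ : m * γ = p := by rw [hm]; field_simp
  set C := 2 ^ p + (2 ^ m * m) ^ p with hC
  have hCpos : 0 ≤ C := by positivity
  have hrhs : 0 ≤ C * (max wx 0) ^ (p - 1 + γ) * |b - a| ^ p := by positivity
  rcases le_or_gt wx wy with hw | hw
  · rw [max_eq_right (by linarith : wx - wy ≤ 0), Real.zero_rpow (by linarith), zero_mul]
    exact hrhs
  rcases le_or_gt (trunc β (b ^ m * max wy 0)) (trunc β (a ^ m * max wx 0)) with hφ | hφ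
  · rw [max_eq_right (sub_nonpos.2 hφ), mul_zero]; exact hrhs
  have h0a : 0 ≤ a ^ m * max wx 0 := by positivity
  have hlt : a ^ m * max wx 0 < b ^ m * max wy 0 := by
    by_contra h
    exact absurd (trunc_mono hβ (by positivity) (not_lt.1 h)) (not_le.2 hφ)
  have hwy : 0 < wy := by
    by_contra h
    rw [max_eq_right (not_lt.1 h), mul_zero] at hlt
    linarith
  have hwx : 0 < wx := hwy.trans hw
  rw [max_eq_left hwx.le] at *
  rw [max_eq_left hwy.le] at *
  have hb0 : 0 < b := by
    rcases hb.eq_or_lt with h | h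
    · rw [← h, Real.zero_rpow (by linarith), zero_mul] at hlt; linarith
    · exact h
  have hab : a < b := by
    by_contra h
    have : b ^ m ≤ a ^ m := Real.rpow_le_rpow hb (not_lt.1 h) (by linarith)
    have h0 : 0 ≤ b ^ m := by positivity
    nlinarith
  rw [max_eq_left (by linarith : 0 ≤ wx - wy), max_eq_left (sub_nonneg.2 hφ.le),
    abs_of_pos (by linarith : 0 < b - a)]
  set l := a / b with hl
  have hl0 : 0 ≤ l := by positivity
  have hl1 : l < 1 := by rw [hl, div_lt_one hb0]; exact hab
  have hlm : a ^ m = l ^ m * b ^ m := by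
    rw [hl, Real.div_rpow ha hb]; field_simp
  have hlm1 : l ^ m ≤ 1 := Real.rpow_le_one hl0 hl1.le (by linarith)
  have hbern : 1 - l ^ m ≤ m * (1 - l) := by
    have := one_add_mul_self_le_rpow_one_add (s := l - 1) (by linarith) hm1
    rw [show 1 + (l - 1) = l by ring] at this
    linarith
  have hpow : (b ^ m * wy) ^ γ = b ^ p * wy ^ γ := by
    rw [Real.mul_rpow (by positivity) hwy.le, ← Real.rpow_mul hb, hmγ]
  have hT : trunc β (b ^ m * wy) - trunc β (a ^ m * wx) ≤ (1 - l ^ m) * (b ^ p * wy ^ γ) := by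
    rw [← hpow]
    refine le_trans ?_ (trunc_sub_mul_le hβ hβ1 hγ hγ1 (by positivity) hlm1 (by positivity))
    have : trunc β (l ^ m * (b ^ m * wy)) ≤ trunc β (a ^ m * wx) := by
      refine trunc_mono hβ (by positivity) ?_
      rw [← mul_assoc, ← hlm]
      exact mul_le_mul_of_nonneg_left hw.le (by positivity)
    linarith
  have hq : wx ^ (p - 1 + γ) = wx ^ (p - 1) * wx ^ γ := Real.rpow_add hwx _ _
  have hyγ : wy ^ γ ≤ wx ^ γ := Real.rpow_le_rpow hwy.le hw.le hγ.le
  rcases le_or_gt l (1 / 2) with hlh | hlh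
  · have hb2 : b ≤ 2 * (b - a) := by
      rw [hl, div_le_iff₀ hb0] at hlh; linarith
    have h1 : b ^ p ≤ 2 ^ p * (b - a) ^ p := by
      rw [← Real.mul_rpow (by norm_num) (by linarith)]
      exact Real.rpow_le_rpow hb hb2 (by linarith)
    have h2 : (wx - wy) ^ (p - 1) ≤ wx ^ (p - 1) :=
      Real.rpow_le_rpow (by linarith) (by linarith) (by linarith)
    have h3 : trunc β (b ^ m * wy) - trunc β (a ^ m * wx) ≤ (2 ^ p * (b - a) ^ p) * wx ^ γ := by
      refine hT.trans ?_
      calc (1 - l ^ m) * (b ^ p * wy ^ γ) ≤ 1 * (b ^ p * wy ^ γ) := by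
            have : 0 ≤ l ^ m := by positivity
            gcongr; linarith
        _ ≤ (2 ^ p * (b - a) ^ p) * wx ^ γ := by rw [one_mul]; gcongr
    calc _ ≤ wx ^ (p - 1) * ((2 ^ p * (b - a) ^ p) * wx ^ γ) := by
          refine mul_le_mul h2 h3 (by linarith) (by positivity)
      _ = 2 ^ p * wx ^ (p - 1 + γ) * (b - a) ^ p := by rw [hq]; ring
      _ ≤ C * wx ^ (p - 1 + γ) * (b - a) ^ p := by
          have h0 : (0:ℝ) ≤ (2 ^ m * m) ^ p := by positivity
          have h1 : (0:ℝ) ≤ b - a := by linarith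
          gcongr; rw [hC]; linarith
  · have hl00 : 0 < l := by linarith
    have ha0 : 0 < a := by rw [hl] at hl00; exact (div_pos_iff_of_pos_right hb0).1 hl00
    have h2m : 1 ≤ 2 ^ m * l ^ m := by
      rw [← Real.mul_rpow (by norm_num) hl0]
      exact Real.one_le_rpow (by linarith) (by linarith)
    have e3 : 1 - l ^ m ≤ 2 ^ m * m * (1 - l) := by
      rw [mul_assoc]
      refine hbern.trans (le_mul_of_one_le_left (mul_nonneg (by linarith) (by linarith)) ?_)
      exact Real.one_le_rpow (by norm_num) (by linarith)
    have h1 : wx - wy ≤ 2 ^ m * m * (1 - l) * wx := by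
      have e1 : l ^ m * wx < wy := by
        have : l ^ m * b ^ m * wx < b ^ m * wy := by rw [← hlm]; exact hlt
        have hbm : 0 < b ^ m := by positivity
        nlinarith
      have e2 : wx - wy ≤ (1 - l ^ m) * wx := by linarith
      refine e2.trans ?_
      exact mul_le_mul_of_nonneg_right e3 hwx.le
    have hlpos : 0 ≤ 1 - l := by linarith
    have h2 : (wx - wy) ^ (p - 1) ≤ (2 ^ m * m * (1 - l) * wx) ^ (p - 1) :=
      Real.rpow_le_rpow (by linarith) h1 (by linarith)
    have h3 : trunc β (b ^ m * wy) - trunc β (a ^ m * wx) ≤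
        (2 ^ m * m * (1 - l)) * (b ^ p * wx ^ γ) := by
      refine hT.trans ?_
      calc (1 - l ^ m) * (b ^ p * wy ^ γ) ≤ (2 ^ m * m * (1 - l)) * (b ^ p * wy ^ γ) := by gcongr
        _ ≤ _ := by gcongr
    have hA : 0 < 2 ^ m * m * (1 - l) := by
      have : 0 < 1 - l := by linarith
      positivity
    have hba : b - a = (1 - l) * b := by rw [hl]; field_simp
    calc _ ≤ (2 ^ m * m * (1 - l) * wx) ^ (p - 1) * ((2 ^ m * m * (1 - l)) * (b ^ p * wx ^ γ)) := by
          refine mul_le_mul h2 h3 (by linarith) (by positivity)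
      _ = (2 ^ m * m * (1 - l)) ^ p * b ^ p * wx ^ (p - 1 + γ) := by
          rw [Real.mul_rpow hA.le hwx.le, hq]
          have : (2 ^ m * m * (1 - l)) ^ p =
              (2 ^ m * m * (1 - l)) ^ (p - 1) * (2 ^ m * m * (1 - l)) := by
            rw [← Real.rpow_add_one hA.ne']; congr 1; ring
          rw [this]; ring
      _ = (2 ^ m * m) ^ p * wx ^ (p - 1 + γ) * (b - a) ^ p := by
          rw [hba, Real.mul_rpow (by positivity) hlpos, Real.mul_rpow hlpos hb]; ring
      _ ≤ C * wx ^ (p - 1 + γ) * (b - a) ^ p := by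
          have h0 : (0:ℝ) ≤ 2 ^ p := by positivity
          have h1 : (0:ℝ) ≤ b - a := by linarith
          gcongr; rw [hC]; linarith

lemma opposite_sign_bound_far {β p X Y wx wy : ℝ} (hβ : 0 < β)
    (hp : 1 < p) (hX : 0 ≤ X) (hY : 0 ≤ Y) :
    (max (wx - wy) 0) ^ (p - 1) *
        max (trunc β (Y * max wy 0) - trunc β (X * max wx 0)) 0 ≤ (max wx 0) ^ (p - 1) := by
  have hX' : 0 ≤ trunc β (X * max wx 0) := trunc_nonneg hβ (by positivity)
  rcases le_or_gt wy 0 with h | h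
  · rw [max_eq_right h, mul_zero, trunc_zero, max_eq_right (sub_nonpos.2 hX'), mul_zero]
    positivity
  · have h1 : trunc β (Y * max wy 0) ≤ 1 := trunc_le_one (by positivity)
    calc _ ≤ (max wx 0) ^ (p - 1) * 1 := by
          have e : max (wx - wy) 0 ≤ max wx 0 := max_le_max (by linarith) le_rfl
          refine mul_le_mul (Real.rpow_le_rpow (by positivity) e (by linarith))
            (max_le (by linarith) zero_le_one) (by positivity) (by positivity)
      _ = _ := mul_one _

lemma PhiBounds.le_of_pos {Λ p : ℝ} {Φ : ℝ → ℝ} (hΦ : PhiBounds Λ p Φ)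
    {t : ℝ} (ht : 0 < t) : t ^ (p - 1) / Λ ≤ Φ t ∧ Φ t ≤ Λ * t ^ (p - 1) := by
  have h := hΦ.2.2 t
  rw [abs_of_pos ht] at h
  have e : t ^ p = t ^ (p - 1) * t := by
    rw [← Real.rpow_add_one ht.ne']; congr 1; ring
  rw [e] at h
  constructor
  · refine le_of_mul_le_mul_right ?_ ht
    calc _ = t ^ (p - 1) * t / Λ := by ring
      _ ≤ _ := h.1
  · refine le_of_mul_le_mul_right ?_ ht
    calc _ ≤ _ := h.2
      _ = _ := by ring

lemma PhiBounds.neg {Λ p : ℝ} {Φ : ℝ → ℝ} (hΦ : PhiBounds Λ p Φ) :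
    PhiBounds Λ p (fun t => -Φ (-t)) := by
  refine ⟨(hΦ.1.comp continuous_neg).neg, by simp [hΦ.2.1], fun t => ?_⟩
  have := hΦ.2.2 (-t)
  rw [abs_neg] at this
  constructor <;> linarith [this.1, this.2]

lemma PhiBounds.abs_le {Λ p : ℝ} {Φ : ℝ → ℝ} (hΦ : PhiBounds Λ p Φ) (hΛ : 1 ≤ Λ) (hp : 1 < p)
    (t : ℝ) : |Φ t| ≤ Λ * |t| ^ (p - 1) := by
  have key : ∀ {Ψ : ℝ → ℝ}, PhiBounds Λ p Ψ → ∀ t, 0 < t → |Ψ t| ≤ Λ * |t| ^ (p - 1) := by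
    intro Ψ hΨ t ht
    have h := hΨ.le_of_pos ht
    have : 0 ≤ t ^ (p - 1) / Λ := by positivity
    rw [abs_of_nonneg (by linarith), abs_of_pos ht]; exact h.2
  rcases lt_trichotomy t 0 with h | h | h
  · simpa using key hΦ.neg (-t) (by linarith)
  · subst h; simp [hΦ.2.1]; rw [Real.zero_rpow (by linarith)]; simp
  · exact key hΦ t h

lemma form_pointwise {Λ p k X a b : ℝ} {Φ : ℝ → ℝ} (hΦ : PhiBounds Λ p Φ) (hΛ : 1 ≤ Λ)
    (hp : 1 < p) (hX : 0 < X) (hk : 1 / (Λ * X) ≤ k) (hk' : k ≤ Λ / X) :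
    (Λ ^ 2)⁻¹ * ((max a 0) ^ (p - 1) * max b 0 * X⁻¹) ≤
      Φ a * b * k + Λ ^ 2 * ((max a 0) ^ (p - 1) * max (-b) 0 * X⁻¹) +
        Λ ^ 2 * ((max (-a) 0) ^ (p - 1) * max b 0 * X⁻¹) := by
  have hΛ0 : 0 < Λ := by linarith
  have hk0 : 0 < k := lt_of_lt_of_le (by positivity) hk
  have z : (0 : ℝ) ^ (p - 1) = 0 := Real.zero_rpow (by linarith)
  have key : ∀ {Ψ : ℝ → ℝ}, PhiBounds Λ p Ψ → ∀ {a}, 0 < a → ∀ b,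
      (Λ ^ 2)⁻¹ * (a ^ (p - 1) * max b 0 * X⁻¹) ≤
      Ψ a * b * k + Λ ^ 2 * (a ^ (p - 1) * max (-b) 0 * X⁻¹) := by
    intro Ψ hΨ a ha b
    obtain ⟨h1, h2⟩ := hΨ.le_of_pos ha
    have hP : 0 ≤ a ^ (p - 1) := by positivity
    rcases le_total 0 b with hb | hb
    · rw [max_eq_left hb, max_eq_right (by linarith : -b ≤ 0)]
      have : (Λ ^ 2)⁻¹ * (a ^ (p - 1) * b * X⁻¹) = (a ^ (p - 1) / Λ) * b * (1 / (Λ * X)) := by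
        field_simp
      rw [this, mul_zero, zero_mul, mul_zero, add_zero]
      have h0 : 0 ≤ Ψ a := le_trans (by positivity) h1
      gcongr
    · rw [max_eq_right hb, max_eq_left (by linarith : 0 ≤ -b)]
      have h0 : 0 ≤ Ψ a := le_trans (by positivity) h1
      have : Ψ a * (-b) * k ≤ (Λ * a ^ (p - 1)) * (-b) * (Λ / X) := by
        have : 0 ≤ -b := by linarith
        gcongr
      have e : (Λ * a ^ (p - 1)) * (-b) * (Λ / X) = Λ ^ 2 * (a ^ (p - 1) * (-b) * X⁻¹) := by
        field_simp
      rw [e] at this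
      simp only [mul_zero, zero_mul]
      linarith
  rcases lt_trichotomy a 0 with h | h | h
  · have := key hΦ.neg (neg_pos.2 h) (-b)
    rw [neg_neg] at this
    rw [max_eq_right h.le, max_eq_left (by linarith : 0 ≤ -a), z]
    simp only [zero_mul, mul_zero, add_zero]
    have h3 : 0 ≤ (Λ ^ 2)⁻¹ * ((-a) ^ (p - 1) * max (-b) 0 * X⁻¹) := by
      have : 0 < -a := by linarith
      positivity
    simp only [neg_neg] at this
    linarith
  · subst h; simp [hΦ.2.1, z]
  · have := key hΦ h b
    rw [max_eq_left h.le, max_eq_right (by linarith : -a ≤ 0), z]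
    simp only [zero_mul, mul_zero, add_zero]
    exact this

/-! ### Power kernels on `ℝⁿ` -/

lemma lintegral_comp_smul {n : ℕ} (F : Rn n → ℝ≥0∞) (hF : Measurable F) {ρ : ℝ} (hρ : 0 < ρ) :
    ∫⁻ z, F z = ENNReal.ofReal (ρ ^ n) * ∫⁻ z, F (ρ • z) := by
  have h := Measure.map_addHaar_smul (volume : Measure (Rn n)) hρ.ne'
  have h2 : ∫⁻ z, F (ρ • z) = ∫⁻ z, F z ∂(Measure.map (ρ • ·) volume) :=
    (lintegral_map hF (measurable_const_smul ρ)).symm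
  rw [h2, h, lintegral_smul_measure, smul_eq_mul, ← mul_assoc, finrank_euclideanSpace_fin,
    ← ENNReal.ofReal_mul (by positivity),
    abs_of_pos (by positivity), mul_inv_cancel₀ (by positivity),
    ENNReal.ofReal_one, one_mul]

lemma exists_lintegral_ball_norm_rpow_le (n : ℕ) (hn : 0 < n) {τ : ℝ} (hτ : 0 < τ) :
    ∃ C : ℝ≥0, ∀ (x : Rn n) (ρ : ℝ), 0 < ρ →
      ∫⁻ y in ball x ρ, ENNReal.ofReal (‖x - y‖ ^ (τ - n)) ≤ C * ENNReal.ofReal (ρ ^ τ) := by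
  have hnt : Nonempty (Fin n) := ⟨⟨0, hn⟩⟩
  have hint : IntegrableOn (fun z : Rn n => ‖z‖ ^ (τ - n)) (ball 0 1) := by
    rw [integrableOn_fun_norm_addHaar (volume : Measure (Rn n)) (f := fun t => t ^ (τ - n))]
    have : IntegrableOn (fun t : ℝ => t ^ (τ - 1)) (Ioo 0 1) := by
      have := (intervalIntegral.intervalIntegrable_rpow' (a := 0) (b := 1)
        (by linarith : -1 < τ - 1))
      rw [intervalIntegrable_iff_integrableOn_Ioo_of_le zero_le_one] at this
      exact this
    refine this.congr_fun (fun t ht => ?_) measurableSet_Ioo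
    simp only [finrank_euclideanSpace_fin, smul_eq_mul]
    rw [← Real.rpow_natCast, ← Real.rpow_add ht.1, Nat.cast_sub hn]
    congr 1; push_cast; ring
  set I := ∫⁻ z in ball (0 : Rn n) 1, ENNReal.ofReal (‖z‖ ^ (τ - n)) with hI
  have hIfin : I ≠ ⊤ := by
    have := hint.lintegral_lt_top
    exact this.ne
  refine ⟨I.toNNReal, fun x ρ hρ => le_of_eq ?_⟩
  rw [ENNReal.coe_toNNReal hIfin]
  set F : Rn n → ℝ≥0∞ := (ball (0 : Rn n) ρ).indicator fun z => ENNReal.ofReal (‖z‖ ^ (τ - n))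
  have hF : Measurable F := by
    refine Measurable.indicator ?_ measurableSet_ball
    fun_prop
  have h1 : ∫⁻ y in ball x ρ, ENNReal.ofReal (‖x - y‖ ^ (τ - n)) = ∫⁻ z, F z := by
    rw [← lintegral_sub_left_eq_self F x, ← lintegral_indicator measurableSet_ball]
    refine lintegral_congr fun y => ?_
    simp only [F, indicator, mem_ball, dist_eq_norm, sub_zero, norm_sub_rev y x]
  rw [h1, lintegral_comp_smul F hF hρ, hI, ← lintegral_indicator measurableSet_ball,
    mul_comm (lintegral _ _)]
  have h2 : ∀ z : Rn n, F (ρ • z) = ENNReal.ofReal (ρ ^ (τ - n)) *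
      (ball (0 : Rn n) 1).indicator (fun z => ENNReal.ofReal (‖z‖ ^ (τ - n))) z := by
    intro z
    simp only [F, indicator, mem_ball, dist_eq_norm, sub_zero, norm_smul, Real.norm_eq_abs,
      abs_of_pos hρ]
    simp only [show ρ * ‖z‖ < ρ ↔ ‖z‖ < 1 by constructor <;> intro h <;> nlinarith]
    split_ifs
    · rw [Real.mul_rpow hρ.le (norm_nonneg _), ENNReal.ofReal_mul (by positivity)]
    · simp
  simp_rw [h2]
  rw [lintegral_const_mul' _ _ ENNReal.ofReal_ne_top, ← mul_assoc,
    ← ENNReal.ofReal_mul (by positivity), ← Real.rpow_natCast, ← Real.rpow_add hρ]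
  congr 3; ring

lemma exists_lintegral_compl_ball_norm_rpow_le (n : ℕ) (hn : 0 < n) {τ : ℝ} (hτ : 0 < τ) :
    ∃ C : ℝ≥0, ∀ (x : Rn n) (ρ : ℝ), 0 < ρ →
      ∫⁻ y in (ball x ρ)ᶜ, ENNReal.ofReal (‖x - y‖ ^ (-((n : ℝ) + τ))) ≤
        C * ENNReal.ofReal (ρ ^ (-τ)) := by
  have hnt : Nonempty (Fin n) := ⟨⟨0, hn⟩⟩
  have hint : IntegrableOn (fun z : Rn n => ‖z‖ ^ (-((n : ℝ) + τ))) (ball 0 1)ᶜ := by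
    have e : ((ball 0 1)ᶜ : Set (Rn n)).indicator (fun z : Rn n => ‖z‖ ^ (-((n : ℝ) + τ))) =
        fun z => (Ici (1 : ℝ)).indicator (fun t => t ^ (-((n : ℝ) + τ))) ‖z‖ := by
      ext z; simp [indicator]
    rw [← integrable_indicator_iff measurableSet_ball.compl, e,
      integrable_fun_norm_addHaar (volume : Measure (Rn n))
      (f := (Ici (1 : ℝ)).indicator (fun t => t ^ (-((n : ℝ) + τ))))]
    have h := integrableOn_Ioi_rpow_of_lt (a := -1 - τ) (by linarith) (zero_lt_one)
    rw [← integrableOn_Ici_iff_integrableOn_Ioi, ← integrable_indicator_iff measurableSet_Ici] at h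
    refine h.integrableOn.congr_fun (fun t ht => ?_) measurableSet_Ioi
    simp only [finrank_euclideanSpace_fin, smul_eq_mul, indicator]
    split_ifs
    · rw [← Real.rpow_natCast, ← Real.rpow_add ht, Nat.cast_sub hn]
      congr 1; push_cast; ring
    · simp
  set I := ∫⁻ z in (ball (0 : Rn n) 1)ᶜ, ENNReal.ofReal (‖z‖ ^ (-((n : ℝ) + τ))) with hI
  have hIfin : I ≠ ⊤ := by
    have := hint.lintegral_lt_top
    exact this.ne
  refine ⟨I.toNNReal, fun x ρ hρ => le_of_eq ?_⟩
  rw [ENNReal.coe_toNNReal hIfin]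
  set F : Rn n → ℝ≥0∞ := (ball (0 : Rn n) ρ)ᶜ.indicator
    fun z => ENNReal.ofReal (‖z‖ ^ (-((n : ℝ) + τ)))
  have hF : Measurable F := by
    refine Measurable.indicator ?_ measurableSet_ball.compl
    fun_prop
  have h1 : ∫⁻ y in (ball x ρ)ᶜ, ENNReal.ofReal (‖x - y‖ ^ (-((n : ℝ) + τ))) = ∫⁻ z, F z := by
    rw [← lintegral_sub_left_eq_self F x, ← lintegral_indicator measurableSet_ball.compl]
    refine lintegral_congr fun y => ?_
    simp only [F, indicator, mem_compl_iff, mem_ball, dist_eq_norm, sub_zero, norm_sub_rev y x]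
  rw [h1, lintegral_comp_smul F hF hρ, hI, ← lintegral_indicator measurableSet_ball.compl,
    mul_comm (lintegral _ _)]
  have h2 : ∀ z : Rn n, F (ρ • z) = ENNReal.ofReal (ρ ^ (-((n : ℝ) + τ))) *
      (ball (0 : Rn n) 1)ᶜ.indicator (fun z => ENNReal.ofReal (‖z‖ ^ (-((n : ℝ) + τ)))) z := by
    intro z
    simp only [F, indicator, mem_compl_iff, mem_ball, dist_eq_norm, sub_zero, norm_smul,
      Real.norm_eq_abs, abs_of_pos hρ]
    simp only [show ρ * ‖z‖ < ρ ↔ ‖z‖ < 1 by constructor <;> intro h <;> nlinarith]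
    split_ifs
    · simp
    · rw [Real.mul_rpow hρ.le (norm_nonneg _), ENNReal.ofReal_mul (by positivity)]
  simp_rw [h2]
  rw [lintegral_const_mul' _ _ ENNReal.ofReal_ne_top, ← mul_assoc,
    ← ENNReal.ofReal_mul (by positivity), ← Real.rpow_natCast, ← Real.rpow_add hρ]
  congr 3; ring

lemma exists_volume_ball (n : ℕ) (hn : 0 < n) :
    ∃ ω : ℝ, 0 < ω ∧ ∀ (x : Rn n) (r : ℝ), 0 < r →
      volume (ball x r) = ENNReal.ofReal (ω * r ^ n) := by
  have hnt : Nonempty (Fin n) := ⟨⟨0, hn⟩⟩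
  refine ⟨√Real.pi ^ n / Real.Gamma ((n : ℝ) / 2 + 1), ?_, fun x r hr => ?_⟩
  · have := Real.Gamma_pos_of_pos (s := (n : ℝ) / 2 + 1) (by positivity)
    positivity
  · rw [EuclideanSpace.volume_ball, ← ENNReal.ofReal_pow hr.le,
    ← ENNReal.ofReal_mul (by positivity)]
    simp [mul_comm]

lemma eventually_lintegral_mul_translate_le {E X : Type*} [TopologicalSpace E] [Zero E]
    [TopologicalSpace X] [R1Space X] [MeasurableSpace X] [BorelSpace X]
    {μ : Measure X} [μ.InnerRegularCompactLTTop] [IsLocallyFiniteMeasure μ]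
    (T : E → C(X, X)) (hT : Continuous T) (hT0 : ∀ x, T 0 x = x)
    (hTm : ∀ z, MeasurePreserving (T z) μ μ) {p q : ℝ≥0∞} [p.HolderConjugate q] (hp : p ≠ ⊤)
    {H W : X → ℝ} (hH : MemLp H p μ) (hW : MemLp W q μ) {ε : ℝ≥0∞} (hε : 0 < ε) :
    ∀ᶠ z in 𝓝 (0 : E), ∫⁻ x, ‖W x * (H (T z x) - H x)‖ₑ ∂μ ≤ ε := by
  have hp1 : Fact (1 ≤ p) := ⟨ENNReal.HolderConjugate.one_le p q⟩
  have key : Tendsto (fun z => eLpNorm (fun x => H (T z x) - H x) p μ) (𝓝 (0 : E)) (𝓝 0) := by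
    have h1 := Filter.Tendsto.compMeasurePreservingLp (μ := μ) (ν := μ) (p := p)
      (tendsto_const_nhds (x := hH.toLp H) (f := 𝓝 (0 : E)))
      (hT.tendsto 0) hTm (hTm 0) hp
    have h2 := (tendsto_iff_edist_tendsto_0.1 h1)
    refine h2.congr fun z => ?_
    rw [Lp.edist_def]
    refine eLpNorm_congr_ae ?_
    rw [Lp.toLp_compMeasurePreserving hH, Lp.toLp_compMeasurePreserving hH]
    filter_upwards [(hH.comp_measurePreserving (hTm z)).coeFn_toLp,
      (hH.comp_measurePreserving (hTm 0)).coeFn_toLp] with x h1 h2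
    simp only [Pi.sub_apply, h1, h2, Function.comp, hT0]
  have k2 : Tendsto (fun z => eLpNorm W q μ * eLpNorm (fun x => H (T z x) - H x) p μ)
      (𝓝 (0 : E)) (𝓝 0) := by
    simpa using ENNReal.Tendsto.const_mul key (Or.inr hW.2.ne)
  filter_upwards [k2.eventually (eventually_le_nhds hε)] with z hz
  refine le_trans ?_ hz
  rw [← eLpNorm_one_eq_lintegral_enorm]
  have hs : q.HolderTriple p 1 := ENNReal.HolderTriple.symm
  have hd : AEStronglyMeasurable (fun x => H (T z x) - H x) μ :=
    (hH.comp_measurePreserving (hTm z)).1.sub hH.1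
  have := eLpNorm_smul_le_mul_eLpNorm (p := q) (q := p) (r := 1) hd hW.1
  exact this


lemma lintegral_mollify_sub_le {E X : Type*} [MeasurableSpace E]
    [MeasurableSpace X] {ν : Measure E} [SFinite ν]
    {μ : Measure X} [SFinite μ] (T : E → X → X) (hT : Measurable (Function.uncurry T))
    {H W : X → ℝ} (hH : Measurable H) (hW : Measurable W)
    (hbd : ∀ x, ∃ C, ∀ z, |H (T z x)| ≤ C) {b : E → ℝ} (hb : ∀ z, 0 ≤ b z) (hbi : Integrable b ν)
    (hbm : Measurable b)
    (hb1 : ∫ z, b z ∂ν = 1) {ε : ℝ≥0∞}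
    (h : ∀ z, b z ≠ 0 → ∫⁻ x, ‖W x * (H (T z x) - H x)‖ₑ ∂μ ≤ ε) :
    ∫⁻ x, ‖W x * (∫ z, b z * H (T z x) ∂ν) - W x * H x‖ₑ ∂μ ≤ ε := by
  have e1 : ∀ x, ‖W x * (∫ z, b z * H (T z x) ∂ν) - W x * H x‖ₑ ≤
      ∫⁻ z, ‖b z‖ₑ * ‖W x * (H (T z x) - H x)‖ₑ ∂ν := by
    intro x
    obtain ⟨C, hC⟩ := hbd x
    have hi : Integrable (fun z => b z * H (T z x)) ν := by
      refine hbi.mul_bdd (c := C) ?_ (Eventually.of_forall fun z => ?_)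
      · exact (hH.comp (hT.comp (measurable_id.prodMk measurable_const))).aestronglyMeasurable
      · rw [Real.norm_eq_abs]; exact hC z
    have e : W x * (∫ z, b z * H (T z x) ∂ν) - W x * H x =
        ∫ z, b z * (W x * (H (T z x) - H x)) ∂ν := by
      have : ∀ z, b z * (W x * (H (T z x) - H x)) =
          W x * (b z * H (T z x)) - b z * (W x * H x) := fun z => by ring
      simp_rw [this]
      rw [integral_sub (hi.const_mul _) (hbi.mul_const _), integral_const_mul, integral_mul_const,
        hb1, one_mul]
    rw [e]
    refine (enorm_integral_le_lintegral_enorm _).trans_eq ?_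
    simp_rw [enorm_mul]
  have hm : Measurable (Function.uncurry fun x z => ‖b z‖ₑ * ‖W x * (H (T z x) - H x)‖ₑ) := by
    have : Measurable fun q : X × E => T q.2 q.1 := hT.comp measurable_swap
    unfold Function.uncurry
    fun_prop
  calc _ ≤ ∫⁻ x, ∫⁻ z, ‖b z‖ₑ * ‖W x * (H (T z x) - H x)‖ₑ ∂ν ∂μ := lintegral_mono e1
    _ = ∫⁻ z, ∫⁻ x, ‖b z‖ₑ * ‖W x * (H (T z x) - H x)‖ₑ ∂μ ∂ν :=
        lintegral_lintegral_swap hm.aemeasurable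
    _ ≤ ∫⁻ z, ‖b z‖ₑ * ε ∂ν := by
        refine lintegral_mono fun z => ?_
        rw [lintegral_const_mul']
        · by_cases hz : b z = 0
          · simp [hz]
          · gcongr; exact h z hz
        · simp
    _ = ε := by
        rw [lintegral_mul_const _ (by fun_prop)]
        have : ∫⁻ z, ‖b z‖ₑ ∂ν = 1 := by
          have := ofReal_integral_eq_lintegral_ofReal hbi (Eventually.of_forall hb)
          rw [hb1, ENNReal.ofReal_one] at this
          rw [this]
          exact lintegral_congr fun z => (Real.enorm_of_nonneg (hb z))
        rw [this, one_mul]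

lemma memLp_gagliardo {n : ℕ} {s p : ℝ} (hp : 1 < p) {φ : Rn n → ℝ} (hφ : Measurable φ)
    (hφg : gagliardo n s p univ φ < ⊤) :
    MemLp (fun z : Rn n × Rn n => (φ z.1 - φ z.2) * ‖z.1 - z.2‖ ^ (-((n + s * p) / p)))
      (ENNReal.ofReal p) (volume.prod volume) := by
  refine ⟨(by fun_prop : Measurable _).aestronglyMeasurable, ?_⟩
  rw [eLpNorm_lt_top_iff_lintegral_rpow_enorm_lt_top (by simp; linarith) ENNReal.ofReal_ne_top,
    ENNReal.toReal_ofReal (by linarith), lintegral_prod _ (by fun_prop)]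
  refine lt_of_le_of_lt (le_of_eq ?_) hφg
  simp only [gagliardo, Measure.restrict_univ]
  refine lintegral_congr fun x => lintegral_congr fun y => ?_
  rw [← ofReal_norm, ENNReal.ofReal_rpow_of_nonneg (norm_nonneg _) (by linarith), norm_mul,
    Real.mul_rpow (norm_nonneg _) (norm_nonneg _), Real.norm_eq_abs, Real.norm_eq_abs,
    abs_of_nonneg (Real.rpow_nonneg (norm_nonneg _) _), ← Real.rpow_mul (norm_nonneg _),
    div_eq_mul_inv _ (‖x - y‖ ^ _), ← Real.rpow_neg (norm_nonneg _)]
  congr 3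
  field_simp

lemma memLp_form_factor {n : ℕ} {s p Λ : ℝ} {Φ : ℝ → ℝ} {K : Rn n → Rn n → ℝ} {w : Rn n → ℝ}
    (hp : 1 < p) (hΛ : 1 ≤ Λ) (hK : KernelBounds n Λ s p K) (hΦ : PhiBounds Λ p Φ)
    (hw : Measurable w) (hwg : gagliardo n s p univ w < ⊤) :
    MemLp (fun z : Rn n × Rn n => Φ (w z.1 - w z.2) * K z.1 z.2 * ‖z.1 - z.2‖ ^ ((n + s * p) / p))
      (ENNReal.ofReal (p / (p - 1))) (volume.prod volume) := by
  have hp1 : 0 < p - 1 := by linarith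
  have hq : 0 < p / (p - 1) := by positivity
  have hKm : Measurable fun z : Rn n × Rn n => K z.1 z.2 := hK.1
  have hΦm : Measurable Φ := hΦ.1.measurable
  refine ⟨(by fun_prop : Measurable _).aestronglyMeasurable, ?_⟩
  rw [eLpNorm_lt_top_iff_lintegral_rpow_enorm_lt_top (by simp; positivity) ENNReal.ofReal_ne_top,
    ENNReal.toReal_ofReal hq.le, lintegral_prod _ (by fun_prop)]
  have hle : ∀ x y : Rn n,
      ‖Φ (w x - w y) * K x y * ‖x - y‖ ^ ((n + s * p) / p)‖ₑ ^ (p / (p - 1)) ≤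
      ENNReal.ofReal ((Λ ^ 2) ^ (p / (p - 1))) *
        ENNReal.ofReal (|w x - w y| ^ p / ‖x - y‖ ^ ((n : ℝ) + s * p)) := by
    intro x y
    rcases eq_or_ne x y with rfl | hxy
    · simp [hΦ.2.1, ENNReal.zero_rpow_of_pos hq]
    have hr : 0 < ‖x - y‖ := norm_pos_iff.2 (sub_ne_zero.2 hxy)
    rw [← ofReal_norm, ENNReal.ofReal_rpow_of_nonneg (norm_nonneg _) hq.le,
      ← ENNReal.ofReal_mul (by positivity)]
    refine ENNReal.ofReal_le_ofReal ?_
    have hk := hK.2 x y hxy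
    have hk0 : 0 ≤ K x y := le_trans (by positivity) hk.1
    have e : ‖Φ (w x - w y) * K x y * ‖x - y‖ ^ ((n + s * p) / p)‖ ≤
        Λ ^ 2 * |w x - w y| ^ (p - 1) * ‖x - y‖ ^ (-((n + s * p) * (p - 1) / p)) := by
      rw [Real.norm_eq_abs, abs_mul, abs_mul, abs_of_nonneg hk0,
        abs_of_nonneg (Real.rpow_nonneg hr.le _)]
      calc _ ≤ Λ * |w x - w y| ^ (p - 1) * (Λ / ‖x - y‖ ^ ((n : ℝ) + s * p)) *
            ‖x - y‖ ^ ((n + s * p) / p) := by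
            gcongr
            · exact hΦ.abs_le hΛ hp _
            · exact hk.2
        _ = Λ ^ 2 * |w x - w y| ^ (p - 1) *
            (‖x - y‖ ^ (-((n : ℝ) + s * p)) * ‖x - y‖ ^ ((n + s * p) / p)) := by
            rw [Real.rpow_neg hr.le]; ring
        _ = _ := by
            rw [← Real.rpow_add hr]
            congr 2
            field_simp
            ring
    calc _ ≤ (Λ ^ 2 * |w x - w y| ^ (p - 1) * ‖x - y‖ ^ (-((n + s * p) * (p - 1) / p))) ^
            (p / (p - 1)) := by gcongr
      _ = _ := by
        rw [Real.mul_rpow (by positivity) (by positivity), Real.mul_rpow (by positivity)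
          (by positivity), ← Real.rpow_mul (abs_nonneg _), ← Real.rpow_mul hr.le, mul_assoc]
        have e1 : (p - 1) * (p / (p - 1)) = p := by field_simp
        have e2 : -((n + s * p) * (p - 1) / p) * (p / (p - 1)) = -(n + s * p) := by field_simp
        rw [e1, e2, Real.rpow_neg hr.le]
        rfl
  refine lt_of_le_of_lt (lintegral_mono fun x => lintegral_mono fun y => hle x y) ?_
  simp_rw [lintegral_const_mul' _ _ ENNReal.ofReal_ne_top]
  refine ENNReal.mul_lt_top ENNReal.ofReal_lt_top ?_
  simpa [gagliardo] using hwg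

lemma exists_smooth_mollifier {n : ℕ} {δ : ℝ} (hδ : 0 < δ) :
    ∃ b : Rn n → ℝ, ContDiff ℝ (⊤ : ℕ∞) b ∧ HasCompactSupport b ∧ (∀ z, 0 ≤ b z) ∧
      ∫ z, b z = 1 ∧ ∀ z, b z ≠ 0 → z ∈ ball 0 δ := by
  let f : ContDiffBump (0 : Rn n) := ⟨δ / 2, δ, by positivity, by linarith⟩
  refine ⟨f.normed volume, f.contDiff_normed, f.hasCompactSupport_normed, f.nonneg_normed,
    f.integral_normed, fun z hz => ?_⟩
  have : z ∈ Function.support (f.normed volume) := hz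
  rwa [f.support_normed_eq] at this

lemma isTestFun_mollify {n : ℕ} {Ω S : Set (Rn n)} {b φ : Rn n → ℝ} {δ : ℝ}
    (hb : ContDiff ℝ (⊤ : ℕ∞) b) (hbc : HasCompactSupport b) (hbs : ∀ z, b z ≠ 0 → z ∈ ball 0 δ)
    (hφ : LocallyIntegrable φ) (hS : IsCompact S) (hSΩ : cthickening δ S ⊆ Ω)
    (hφS : ∀ x, x ∉ S → φ x = 0) :
    IsTestFun n Ω (fun x => ∫ z, b z * φ (x - z)) := by
  have hsupp : Function.support (fun x => ∫ z, b z * φ (x - z)) ⊆ cthickening δ S := by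
    intro x hx
    by_contra hxS
    refine hx (integral_eq_zero_of_ae (Eventually.of_forall fun z => ?_))
    by_contra hz
    have hz1 : b z ≠ 0 := left_ne_zero_of_mul hz
    have hz2 : φ (x - z) ≠ 0 := right_ne_zero_of_mul hz
    have hxz : x - z ∈ S := by by_contra h; exact hz2 (hφS _ h)
    refine hxS (thickening_subset_cthickening _ _ (mem_thickening_iff.2 ⟨x - z, hxz, ?_⟩))
    simpa [dist_eq_norm] using hbs z hz1
  refine ⟨?_, HasCompactSupport.of_support_subset_isCompact hS.cthickening hsupp,
    (closure_minimal hsupp isClosed_cthickening).trans hSΩ⟩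
  exact hbc.contDiff_convolution_left (ContinuousLinearMap.lsmul ℝ ℝ) hb hφ

lemma weak_form_extend {n : ℕ} {s p Λ : ℝ} {Φ : ℝ → ℝ} {K : Rn n → Rn n → ℝ} {Ω S : Set (Rn n)}
    {f w φ : Rn n → ℝ} (hp : 1 < p) (hΛ : 1 ≤ Λ) (hK : KernelBounds n Λ s p K)
    (hΦ : PhiBounds Λ p Φ) (hΩ : IsOpen Ω) (hf : Continuous f) (hfc : HasCompactSupport f)
    (hw : Measurable w) (hwg : gagliardo n s p univ w < ⊤)
    (hweak : ∀ φ, IsTestFun n Ω φ → nonlocalForm n Φ K w φ = ∫ x, φ x * f x)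
    (hφ : Measurable φ) (hφ0 : ∀ x, 0 ≤ φ x) (hφ1 : ∀ x, φ x ≤ 1) (hS : IsCompact S)
    (hSΩ : S ⊆ Ω) (hφS : ∀ x, x ∉ S → φ x = 0) (hφg : gagliardo n s p univ φ < ⊤) :
    Integrable (fun z : Rn n × Rn n => Φ (w z.1 - w z.2) * (φ z.1 - φ z.2) * K z.1 z.2)
      (volume.prod volume) ∧
    ∫ z : Rn n × Rn n, Φ (w z.1 - w z.2) * (φ z.1 - φ z.2) * K z.1 z.2 ∂(volume.prod volume) =
      ∫ x, φ x * f x := by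
  have hp1 : 0 < p - 1 := by linarith
  have hKm : Measurable fun z : Rn n × Rn n => K z.1 z.2 := hK.1
  have hΦm : Measurable Φ := hΦ.1.measurable
  set H : Rn n × Rn n → ℝ := fun z => (φ z.1 - φ z.2) * ‖z.1 - z.2‖ ^ (-((n + s * p) / p)) with hH
  set W : Rn n × Rn n → ℝ :=
    fun z => Φ (w z.1 - w z.2) * K z.1 z.2 * ‖z.1 - z.2‖ ^ ((n + s * p) / p) with hW
  have hHL : MemLp H (ENNReal.ofReal p) (volume.prod volume) := memLp_gagliardo hp hφ hφg
  have hWL : MemLp W (ENNReal.ofReal (p / (p - 1))) (volume.prod volume) :=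
    memLp_form_factor hp hΛ hK hΦ hw hwg
  have hHm : Measurable H := by fun_prop
  have hWm : Measurable W := by fun_prop
  have hconj : (ENNReal.ofReal p).HolderConjugate (ENNReal.ofReal (p / (p - 1))) :=
    (Real.HolderConjugate.conjExponent hp).ennrealOfReal
  have hWH : ∀ (ψ : Rn n → ℝ) (z : Rn n × Rn n), Φ (w z.1 - w z.2) * (ψ z.1 - ψ z.2) * K z.1 z.2 =
      W z * ((ψ z.1 - ψ z.2) * ‖z.1 - z.2‖ ^ (-((n + s * p) / p))) := by
    intro ψ z
    rcases eq_or_ne z.1 z.2 with h | h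
    · simp [h]
    · have hr : 0 < ‖z.1 - z.2‖ := norm_pos_iff.2 (sub_ne_zero.2 h)
      have : ‖z.1 - z.2‖ ^ ((n + s * p) / p) * ‖z.1 - z.2‖ ^ (-((n + s * p) / p)) = 1 := by
        rw [← Real.rpow_add hr]; simp
      simp only [hW]
      linear_combination (-(Φ (w z.1 - w z.2) * (ψ z.1 - ψ z.2) * K z.1 z.2)) * this
  have hint : Integrable (fun z => W z * H z) (volume.prod volume) :=
      hHL.integrable_mul hWL |>.congr
    (Eventually.of_forall fun z => by simp [mul_comm])
  have hφL : MemLp φ (ENNReal.ofReal p) := by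
    have e : φ = S.indicator φ := by
      ext x; by_cases h : x ∈ S <;> simp [h, hφS]
    rw [e, memLp_indicator_iff_restrict hS.measurableSet]
    have : IsFiniteMeasure (volume.restrict S) := ⟨by simpa using hS.measure_lt_top⟩
    exact MemLp.of_bound hφ.aestronglyMeasurable 1 (Eventually.of_forall fun x => by
      rw [Real.norm_eq_abs, abs_of_nonneg (hφ0 x)]; exact hφ1 x)
  have hfL : MemLp f (ENNReal.ofReal (p / (p - 1))) := hf.memLp_of_hasCompactSupport hfc
  have hφloc : LocallyIntegrable φ :=
    hφL.locallyIntegrable (by simpa using ENNReal.ofReal_le_ofReal hp.le)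
  have hint2 : Integrable (fun x => f x * φ x) := (hfL.integrable_mul hφL)
  have hff : ∀ z, Φ (w z.1 - w z.2) * (φ z.1 - φ z.2) * K z.1 z.2 = W z * H z := hWH φ
  simp_rw [hff]
  refine ⟨hint, ?_⟩
  have hTc : Continuous fun q : Rn n × (Rn n × Rn n) => (q.2.1 - q.1, q.2.2 - q.1) := by fun_prop
  have hTc' : Continuous fun q : Rn n × Rn n => q.2 - q.1 := by fun_prop
  let T : C(Rn n, C(Rn n × Rn n, Rn n × Rn n)) := ContinuousMap.curry ⟨_, hTc⟩
  let T' : C(Rn n, C(Rn n, Rn n)) := ContinuousMap.curry ⟨_, hTc'⟩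
  have hTm' : ∀ z, MeasurePreserving (T' z) volume volume := fun z =>
    measurePreserving_sub_right volume z
  have hTm : ∀ z, MeasurePreserving (T z) (volume.prod volume) (volume.prod volume) := fun z =>
    (hTm' z).prod (hTm' z)
  refine eq_of_forall_dist_le fun ε hε => ?_
  have hε' : 0 < ENNReal.ofReal (ε / 2) := by simpa using hε
  obtain ⟨δ₀, hδ₀, hSδ⟩ := hS.exists_cthickening_subset_open hΩ hSΩ
  have ev1 := eventually_lintegral_mul_translate_le (μ := (volume : Measure (Rn n)).prod volume)
    T T.continuous (fun x => by simp [T]) hTm ENNReal.ofReal_ne_top hHL hWL hε'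
  have ev2 := eventually_lintegral_mul_translate_le (μ := (volume : Measure (Rn n)))
    T' T'.continuous (fun x => by simp [T']) hTm' ENNReal.ofReal_ne_top hφL hfL hε'
  obtain ⟨δ₁, hδ₁, hball⟩ := Metric.eventually_nhds_iff_ball.1 (ev1.and ev2)
  obtain ⟨b, hbs, hbc, hb0, hb1, hbb⟩ := exists_smooth_mollifier (n := n) (lt_min hδ₀ hδ₁)
  have hbi : Integrable b := hbs.continuous.integrable_of_hasCompactSupport hbc
  have htest : IsTestFun n Ω (fun x => ∫ z, b z * φ (x - z)) :=
    isTestFun_mollify hbs hbc (fun z hz => ball_subset_ball (min_le_left _ δ₁) (hbb z hz))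
      hφloc hS hSδ hφS
  have hφb : ∀ x, |φ x| ≤ 1 := fun x => by rw [abs_of_nonneg (hφ0 x)]; exact hφ1 x
  have L1 := lintegral_mollify_sub_le (ν := (volume : Measure (Rn n)))
    (μ := (volume : Measure (Rn n)).prod volume) (fun z => T z) hTc.measurable hHm hWm
    (fun x => ⟨2 * ‖x.1 - x.2‖ ^ (-((n + s * p) / p)), fun z => by
      simp only [hH, T, ContinuousMap.curry_apply, ContinuousMap.coe_mk, sub_sub_sub_cancel_right]
      rw [abs_mul, abs_of_nonneg (Real.rpow_nonneg (norm_nonneg _) _)]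
      gcongr
      refine (abs_sub _ _).trans ?_
      linarith [hφb (x.1 - z), hφb (x.2 - z)]⟩) hb0 hbi hbs.continuous.measurable hb1
      (fun z hz => (hball z (ball_subset_ball (min_le_right _ _) (hbb z hz))).1)
  have L2 := lintegral_mollify_sub_le (ν := (volume : Measure (Rn n)))
    (μ := (volume : Measure (Rn n))) (fun z => T' z) hTc'.measurable hφ hf.measurable
    (fun x => ⟨1, fun z => hφb _⟩) hb0 hbi hbs.continuous.measurable hb1
      (fun z hz => (hball z (ball_subset_ball (min_le_right _ _) (hbb z hz))).2)
  set ψ : Rn n → ℝ := fun x => ∫ z, b z * φ (x - z) with hψ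
  have hbφ : ∀ x, Integrable (fun z => b z * φ (x - z)) := fun x => by
    refine hbi.mul_bdd (c := 1) ?_ (Eventually.of_forall fun z => hφb _)
    exact (hφ.comp (measurable_const.sub measurable_id)).aestronglyMeasurable
  have hψm : Measurable ψ := htest.1.continuous.measurable
  have eH : ∀ z : Rn n × Rn n, ∫ ζ, b ζ * H (T ζ z) =
      (ψ z.1 - ψ z.2) * ‖z.1 - z.2‖ ^ (-((n + s * p) / p)) := by
    intro z
    rw [hψ, ← integral_sub (hbφ _) (hbφ _), ← integral_mul_const]
    refine integral_congr_ae (Eventually.of_forall fun ζ => ?_)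
    simp only [hH, T, ContinuousMap.curry_apply, ContinuousMap.coe_mk, sub_sub_sub_cancel_right]
    ring
  simp_rw [eH, ← hWH ψ] at L1
  have eφ : ∀ x, ∫ ζ, b ζ * φ (T' ζ x) = ψ x := fun x => rfl
  simp_rw [eφ] at L2
  have hψm1 : AEStronglyMeasurable (fun z : Rn n × Rn n =>
      Φ (w z.1 - w z.2) * (ψ z.1 - ψ z.2) * K z.1 z.2 - W z * H z) (volume.prod volume) :=
    (by fun_prop : Measurable _).aestronglyMeasurable
  have hd1 : Integrable (fun z : Rn n × Rn n =>
      Φ (w z.1 - w z.2) * (ψ z.1 - ψ z.2) * K z.1 z.2 - W z * H z) (volume.prod volume) :=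
    ⟨hψm1, L1.trans_lt ENNReal.ofReal_lt_top⟩
  have hd2 : Integrable (fun x => f x * ψ x - f x * φ x) :=
    ⟨(by fun_prop : Measurable _).aestronglyMeasurable, L2.trans_lt ENNReal.ofReal_lt_top⟩
  have hi1 : Integrable (fun z : Rn n × Rn n =>
      Φ (w z.1 - w z.2) * (ψ z.1 - ψ z.2) * K z.1 z.2) (volume.prod volume) :=
    (hd1.add hint).congr (Eventually.of_forall fun z => by simp)
  have hi2 : Integrable (fun x => f x * ψ x) :=
    (hd2.add hint2).congr (Eventually.of_forall fun z => by simp)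
  have E := hweak ψ htest
  rw [nonlocalForm, integral_integral hi1] at E
  have M1 : |(∫ z : Rn n × Rn n, Φ (w z.1 - w z.2) * (ψ z.1 - ψ z.2) * K z.1 z.2
      ∂(volume.prod volume)) - ∫ z, W z * H z ∂(volume.prod volume)| ≤ ε / 2 := by
    rw [← integral_sub hi1 hint, ← Real.norm_eq_abs]
    have := (enorm_integral_le_lintegral_enorm _).trans L1
    rwa [← ofReal_norm, ENNReal.ofReal_le_ofReal_iff (by positivity)] at this
  have M2 : |(∫ x, f x * ψ x) - ∫ x, f x * φ x| ≤ ε / 2 := by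
    rw [← integral_sub hi2 hint2, ← Real.norm_eq_abs]
    have := (enorm_integral_le_lintegral_enorm _).trans L2
    rwa [← ofReal_norm, ENNReal.ofReal_le_ofReal_iff (by positivity)] at this
  have c1 : ∫ x, ψ x * f x = ∫ x, f x * ψ x := by simp_rw [mul_comm]
  have c2 : ∫ x, φ x * f x = ∫ x, f x * φ x := by simp_rw [mul_comm]
  rw [Real.dist_eq, c2]
  rw [c1] at E
  change ∫ z : Rn n × Rn n, _ ∂(volume.prod volume) = _ at E
  rw [E] at M1
  rw [abs_le] at *
  constructor <;> linarith [M1.1, M1.2, M2.1, M2.2]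

def cutoff {n : ℕ} (x₀ : Rn n) (r : ℝ) (x : Rn n) : ℝ := max 0 (min 1 (3 - 4 * ‖x - x₀‖ / r))

lemma cutoff_nonneg {n : ℕ} (x₀ : Rn n) (r : ℝ) (x : Rn n) : 0 ≤ cutoff x₀ r x := le_max_left _ _

lemma cutoff_le_one {n : ℕ} (x₀ : Rn n) (r : ℝ) (x : Rn n) : cutoff x₀ r x ≤ 1 :=
  max_le zero_le_one (min_le_left _ _)

@[fun_prop]
lemma continuous_cutoff {n : ℕ} (x₀ : Rn n) (r : ℝ) : Continuous (cutoff x₀ r) := by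
  unfold cutoff; fun_prop

lemma cutoff_eq_one {n : ℕ} {x₀ : Rn n} {r : ℝ} (hr : 0 < r) {x : Rn n} (hx : x ∈ ball x₀ (r / 2)) :
    cutoff x₀ r x = 1 := by
  have h : ‖x - x₀‖ < r / 2 := by simpa [dist_eq_norm] using hx
  have : 4 * ‖x - x₀‖ / r ≤ 2 := by rw [div_le_iff₀ hr]; linarith
  rw [cutoff, min_eq_left (by linarith), max_eq_right zero_le_one]

lemma cutoff_eq_zero {n : ℕ} {x₀ : Rn n} {r : ℝ} (hr : 0 < r) {x : Rn n}
    (hx : x ∉ closedBall x₀ (3 * r / 4)) : cutoff x₀ r x = 0 := by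
  have h : 3 * r / 4 < ‖x - x₀‖ := by simpa [dist_eq_norm] using hx
  have : 3 ≤ 4 * ‖x - x₀‖ / r := by rw [le_div_iff₀ hr]; linarith
  rw [cutoff, max_eq_left ((min_le_right _ _).trans (by linarith))]

lemma abs_cutoff_sub_le {n : ℕ} (x₀ : Rn n) {r : ℝ} (hr : 0 < r) (x y : Rn n) :
    |cutoff x₀ r x - cutoff x₀ r y| ≤ 4 / r * ‖x - y‖ := by
  have h1 := abs_max_sub_max_le_abs (min 1 (3 - 4 * ‖x - x₀‖ / r)) (min 1 (3 - 4 * ‖y - x₀‖ / r)) 0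
  have h2 := abs_min_sub_min_le_max 1 (3 - 4 * ‖x - x₀‖ / r) 1 (3 - 4 * ‖y - x₀‖ / r)
  have h3 : |(3 - 4 * ‖x - x₀‖ / r) - (3 - 4 * ‖y - x₀‖ / r)| ≤ 4 / r * ‖x - y‖ := by
    have e : (3 - 4 * ‖x - x₀‖ / r) - (3 - 4 * ‖y - x₀‖ / r) =
        -(4 / r * (‖x - x₀‖ - ‖y - x₀‖)) := by ring
    rw [e, abs_neg, abs_mul, abs_of_pos (by positivity : 0 < 4 / r)]
    gcongr
    simpa using abs_norm_sub_norm_le (x - x₀) (y - x₀)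
  simp only [cutoff, max_comm (0 : ℝ)]
  refine h1.trans (h2.trans (max_le ?_ h3))
  simp; positivity

lemma abs_rpow_sub_rpow_le {m a b : ℝ} (hm : 1 ≤ m) (ha : 0 ≤ a) (ha1 : a ≤ 1) (hb : 0 ≤ b)
    (hb1 : b ≤ 1) : |a ^ m - b ^ m| ≤ m * |a - b| := by
  wlog hab : b ≤ a generalizing a b
  · rw [abs_sub_comm, abs_sub_comm a]; exact this hb hb1 ha ha1 (le_of_not_ge hab)
  have h1 : b ^ m ≤ a ^ m := Real.rpow_le_rpow hb hab (by linarith)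
  rw [abs_of_nonneg (by linarith), abs_of_nonneg (by linarith)]
  rcases ha.eq_or_lt with rfl | ha0
  · have : b = 0 := le_antisymm hab hb
    simp [this]
  have h2 := one_add_mul_self_le_rpow_one_add (s := b / a - 1) (by
    have : 0 ≤ b / a := by positivity
    linarith) hm
  rw [add_sub_cancel, Real.div_rpow hb ha] at h2
  have h3 : a ^ m ≤ a := by
    simpa using Real.rpow_le_rpow_of_exponent_ge ha0 ha1 hm
  have h4 : 0 < a ^ m := by positivity
  rw [le_div_iff₀ h4] at h2
  have h5 : a ^ m - b ^ m ≤ a ^ m * (m * (1 - b / a)) := by nlinarith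
  have h6 : 0 ≤ m * (1 - b / a) := by
    have : b / a ≤ 1 := by rw [div_le_one ha0]; exact hab
    have : 0 ≤ 1 - b / a := by linarith
    positivity
  calc _ ≤ a ^ m * (m * (1 - b / a)) := h5
    _ ≤ a * (m * (1 - b / a)) := by gcongr
    _ = m * (a - b) := by field_simp

lemma exists_lintegral_lipschitz_le (n : ℕ) (hn : 0 < n) {s p : ℝ} (hs : 0 < s) (hs1 : s < 1)
    (hp : 1 < p) : ∃ C : ℝ≥0, ∀ (η : Rn n → ℝ) (L ρ : ℝ) (x : Rn n), 0 < ρ → 0 ≤ L →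
      (∀ y, |η x - η y| ≤ 1) → (∀ y, |η x - η y| ≤ L * ‖x - y‖) →
      ∫⁻ y, ENNReal.ofReal (|η x - η y| ^ p * (‖x - y‖ ^ ((n : ℝ) + s * p))⁻¹) ≤
        C * ENNReal.ofReal (L ^ p * ρ ^ (p - s * p) + ρ ^ (-(s * p))) := by
  have hsp : 0 < s * p := by positivity
  have hτ : 0 < p - s * p := by nlinarith
  obtain ⟨C₁, h₁⟩ := exists_lintegral_ball_norm_rpow_le n hn hτ
  obtain ⟨C₂, h₂⟩ := exists_lintegral_compl_ball_norm_rpow_le n hn hsp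
  refine ⟨max C₁ C₂, fun η L ρ x hρ hL hη1 hηL => ?_⟩
  rw [← lintegral_add_compl _ (measurableSet_ball (x := x) (ε := ρ)),
    ENNReal.ofReal_add (by positivity) (by positivity), mul_add]
  gcongr ?_ + ?_
  · calc _ ≤ ∫⁻ y in ball x ρ, ENNReal.ofReal (L ^ p) *
          ENNReal.ofReal (‖x - y‖ ^ (p - s * p - n)) := by
          refine lintegral_mono fun y => ?_
          rw [← ENNReal.ofReal_mul (by positivity)]
          refine ENNReal.ofReal_le_ofReal ?_
          rcases eq_or_ne x y with rfl | hxy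
          · simp [Real.zero_rpow (by linarith : p ≠ 0)]
            positivity
          have hr : 0 < ‖x - y‖ := norm_pos_iff.2 (sub_ne_zero.2 hxy)
          calc _ ≤ (L * ‖x - y‖) ^ p * (‖x - y‖ ^ ((n : ℝ) + s * p))⁻¹ := by
                gcongr; exact hηL y
            _ = L ^ p * (‖x - y‖ ^ p * ‖x - y‖ ^ (-((n : ℝ) + s * p))) := by
                rw [Real.mul_rpow hL hr.le, Real.rpow_neg hr.le]; ring
            _ = _ := by
                rw [← Real.rpow_add hr]; congr 2; ring
      _ = ENNReal.ofReal (L ^ p) * ∫⁻ y in ball x ρ, ENNReal.ofReal (‖x - y‖ ^ (p - s * p - n)) :=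
          lintegral_const_mul' _ _ ENNReal.ofReal_ne_top
      _ ≤ ENNReal.ofReal (L ^ p) * (C₁ * ENNReal.ofReal (ρ ^ (p - s * p))) := by
          gcongr; exact h₁ x ρ hρ
      _ = C₁ * ENNReal.ofReal (L ^ p * ρ ^ (p - s * p)) := by
          rw [ENNReal.ofReal_mul (by positivity)]; ring
      _ ≤ _ := by gcongr; exact le_max_left _ _
  · calc _ ≤ ∫⁻ y in (ball x ρ)ᶜ, ENNReal.ofReal (‖x - y‖ ^ (-((n : ℝ) + s * p))) := by
          refine lintegral_mono fun y => ENNReal.ofReal_le_ofReal ?_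
          rw [Real.rpow_neg (norm_nonneg _)]
          refine mul_le_of_le_one_left (by positivity) ?_
          exact Real.rpow_le_one (abs_nonneg _) (hη1 y) (by linarith)
      _ ≤ C₂ * ENNReal.ofReal (ρ ^ (-(s * p))) := h₂ x ρ hρ
      _ ≤ _ := by gcongr; exact le_max_right _ _

lemma lintegral_le_ofReal_integral_add {α : Type*} [MeasurableSpace α] {μ : Measure α}
    {F G B : α → ℝ} (hF : Integrable F μ) (hG : Measurable G) (hB : Measurable B)
    (hG0 : ∀ x, 0 ≤ G x) (hB0 : ∀ x, 0 ≤ B x) (h : ∀ x, G x ≤ F x + B x) :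
    ∫⁻ x, ENNReal.ofReal (G x) ∂μ ≤
      ENNReal.ofReal (∫ x, F x ∂μ) + ∫⁻ x, ENNReal.ofReal (B x) ∂μ := by
  by_cases hBt : ∫⁻ x, ENNReal.ofReal (B x) ∂μ = ⊤
  · simp [hBt]
  have hBi : Integrable B μ := by
    refine ⟨hB.aestronglyMeasurable, ?_⟩
    rw [hasFiniteIntegral_iff_ofReal (Eventually.of_forall hB0)]
    exact lt_top_iff_ne_top.2 hBt
  have hGi : Integrable G μ := (hF.add hBi).mono' hG.aestronglyMeasurable
    (Eventually.of_forall fun x => by rw [Real.norm_eq_abs, abs_of_nonneg (hG0 x)]; exact h x)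
  rw [← ofReal_integral_eq_lintegral_ofReal hGi (Eventually.of_forall hG0),
    ← ofReal_integral_eq_lintegral_ofReal hBi (Eventually.of_forall hB0)]
  refine (ENNReal.ofReal_le_ofReal ?_).trans ENNReal.ofReal_add_le
  rw [← integral_add hF hBi]
  exact integral_mono hGi (hF.add hBi) h

/-- The energy of the positive part of `w` on a ball. -/
def posEnergy (n : ℕ) (s p β : ℝ) (x₀ : Rn n) (ρ : ℝ) (w : Rn n → ℝ) : ℝ≥0∞ :=
  ∫⁻ x in ball x₀ ρ, ∫⁻ y in ball x₀ ρ,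
    ENNReal.ofReal ((max (w x - w y) 0) ^ (p - 1) *
      max (trunc β (max (w x) 0) - trunc β (max (w y) 0)) 0 * (‖x - y‖ ^ ((n : ℝ) + s * p))⁻¹)

/-- The `L^q` mass of the positive part of `w` on a ball. -/
def posMass (n : ℕ) (q : ℝ) (x₀ : Rn n) (r : ℝ) (w : Rn n → ℝ) : ℝ≥0∞ :=
  ∫⁻ x in ball x₀ r, ENNReal.ofReal ((max (w x) 0) ^ q)

/-- The tail integral of the positive part of `w` outside a ball. -/
def posTail (n : ℕ) (s p : ℝ) (x₀ : Rn n) (r : ℝ) (w : Rn n → ℝ) : ℝ≥0∞ :=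
  ∫⁻ x in (ball x₀ r)ᶜ, ENNReal.ofReal ((max (w x) 0) ^ (p - 1) *
    (‖x - x₀‖ ^ ((n : ℝ) + s * p))⁻¹)

lemma measurable_trunc (β : ℝ) : Measurable (trunc β) := by
  unfold trunc; fun_prop

lemma gagliardo_trunc_lt_top {n : ℕ} (hn : 0 < n) {s p β m : ℝ} (hs : 0 < s) (hs1 : s < 1)
    (hp : 1 < p) (hβ : 0 < β) (hβ1 : β ≤ 1) (hm : 1 ≤ m) {w : Rn n → ℝ} (hw : Measurable w)
    (hwg : gagliardo n s p univ w < ⊤) {x₀ : Rn n} {r : ℝ} (hr : 0 < r)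
    (hwL : ∫⁻ x in ball x₀ r, ENNReal.ofReal (|w x| ^ p) < ⊤) :
    gagliardo n s p univ (fun x => trunc β (cutoff x₀ r x ^ m * max (w x) 0)) < ⊤ := by
  obtain ⟨C, hC⟩ := exists_lintegral_lipschitz_le n hn hs hs1 hp
  set η : Rn n → ℝ := fun x => cutoff x₀ r x ^ m with hη
  have hη0 : ∀ x, 0 ≤ η x := fun x => Real.rpow_nonneg (cutoff_nonneg _ _ _) _
  have hη1 : ∀ x, η x ≤ 1 := fun x =>
    Real.rpow_le_one (cutoff_nonneg _ _ _) (cutoff_le_one _ _ _) (by linarith)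
  have hηs : ∀ x, x ∉ ball x₀ r → η x = 0 := fun x hx => by
    rw [hη]
    simp only
    rw [cutoff_eq_zero hr fun h => hx (closedBall_subset_ball (by linarith) h),
      Real.zero_rpow (by linarith)]
  have hηd : ∀ x y, |η x - η y| ≤ 1 := fun x y => by
    rw [abs_le]; constructor <;> linarith [hη0 x, hη0 y, hη1 x, hη1 y]
  have hηL : ∀ x y, |η x - η y| ≤ m * (4 / r) * ‖x - y‖ := fun x y => by
    refine (abs_rpow_sub_rpow_le hm (cutoff_nonneg _ _ _) (cutoff_le_one _ _ _)
      (cutoff_nonneg _ _ _) (cutoff_le_one _ _ _)).trans ?_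
    rw [mul_assoc]; gcongr; exact abs_cutoff_sub_le x₀ hr x y
  have hηm : Measurable η := by
    have := (continuous_cutoff x₀ r).measurable
    fun_prop
  set V : Rn n → ℝ := (ball x₀ r).indicator (fun x => |w x|) with hV
  have hVm : Measurable V := (by fun_prop : Measurable fun x => |w x|).indicator measurableSet_ball
  have hV0 : ∀ x, 0 ≤ V x := fun x => indicator_nonneg (fun _ _ => abs_nonneg _) _
  set Q : Rn n → Rn n → ℝ≥0∞ := fun x y =>
    ENNReal.ofReal (|η x - η y| ^ p * (‖x - y‖ ^ ((n : ℝ) + s * p))⁻¹) with hQ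
  have hQm : Measurable fun z : Rn n × Rn n => Q z.1 z.2 := by simp only [hQ]; fun_prop
  have hQs : ∀ x y, Q x y = Q y x := fun x y => by
    simp only [hQ]; rw [abs_sub_comm, norm_sub_rev]
  have pw : ∀ x y, |trunc β (η x * max (w x) 0) - trunc β (η y * max (w y) 0)| ≤
      |w x - w y| + V x * |η x - η y| + V y * |η x - η y| := by
    intro x y
    refine (abs_trunc_sub_le hβ hβ1 (mul_nonneg (hη0 x) (le_max_right _ _))
      (mul_nonneg (hη0 y) (le_max_right _ _))).trans ?_
    have key : ∀ x y, y ∈ ball x₀ r → |η x * max (w x) 0 - η y * max (w y) 0| ≤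
        |w x - w y| + V y * |η x - η y| := by
      intro x y hy
      have e : η x * max (w x) 0 - η y * max (w y) 0 =
          η x * (max (w x) 0 - max (w y) 0) + max (w y) 0 * (η x - η y) := by ring
      rw [e]
      refine (abs_add_le _ _).trans (add_le_add ?_ ?_)
      · rw [abs_mul, abs_of_nonneg (hη0 x)]
        exact (mul_le_of_le_one_left (abs_nonneg _) (hη1 x)).trans
          (abs_max_sub_max_le_abs _ _ _)
      · rw [abs_mul, hV, indicator_of_mem hy, abs_of_nonneg (le_max_right _ _)]
        gcongr
        exact max_le (le_abs_self _) (abs_nonneg _)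
    by_cases hy : y ∈ ball x₀ r
    · have := key x y hy
      have := mul_nonneg (hV0 x) (abs_nonneg (η x - η y))
      linarith
    by_cases hx : x ∈ ball x₀ r
    · have h1 := key y x hx
      rw [abs_sub_comm, abs_sub_comm (w y), abs_sub_comm (η y)] at h1
      have := mul_nonneg (hV0 y) (abs_nonneg (η x - η y))
      linarith
    · rw [hηs x hx, hηs y hy]; simp
  have pw2 : ∀ x y,
      ENNReal.ofReal (|trunc β (η x * max (w x) 0) - trunc β (η y * max (w y) 0)| ^ p /
      ‖x - y‖ ^ ((n : ℝ) + s * p)) ≤ ENNReal.ofReal (3 ^ p) *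
        (ENNReal.ofReal (|w x - w y| ^ p / ‖x - y‖ ^ ((n : ℝ) + s * p)) +
        ENNReal.ofReal (V x ^ p) * Q x y + ENNReal.ofReal (V y ^ p) * Q x y) := by
    intro x y
    have hVx := hV0 x
    have hVy := hV0 y
    simp only [hQ]
    rw [← ENNReal.ofReal_mul (by positivity), ← ENNReal.ofReal_mul (by positivity),
      ← ENNReal.ofReal_add (by positivity) (by positivity),
      ← ENNReal.ofReal_add (by positivity) (by positivity), ← ENNReal.ofReal_mul (by positivity)]
    refine ENNReal.ofReal_le_ofReal ?_
    have h3 : ∀ a b c : ℝ, 0 ≤ a → 0 ≤ b → 0 ≤ c →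
        (a + b + c) ^ p ≤ 3 ^ p * (a ^ p + b ^ p + c ^ p) := by
      intro a b c ha hb hc
      have h1 : a + b + c ≤ 3 * max a (max b c) := by
        have := le_max_left a (max b c)
        have := (le_max_left b c).trans (le_max_right a (max b c))
        have := (le_max_right b c).trans (le_max_right a (max b c))
        linarith
      calc _ ≤ (3 * max a (max b c)) ^ p := by gcongr
        _ = 3 ^ p * (max a (max b c)) ^ p :=
            Real.mul_rpow (by positivity) (le_max_of_le_left ha)
        _ ≤ _ := by
            gcongr
            have := Real.rpow_nonneg ha p
            have := Real.rpow_nonneg hb p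
            have := Real.rpow_nonneg hc p
            rcases max_choice a (max b c) with h | h <;> rw [h]
            · linarith
            · rcases max_choice b c with h | h <;> rw [h] <;> linarith
    calc _ ≤ (|w x - w y| + V x * |η x - η y| + V y * |η x - η y|) ^ p /
          ‖x - y‖ ^ ((n : ℝ) + s * p) := by gcongr; exact pw x y
      _ ≤ (3 ^ p * (|w x - w y| ^ p + (V x * |η x - η y|) ^ p + (V y * |η x - η y|) ^ p)) /
          ‖x - y‖ ^ ((n : ℝ) + s * p) := by
          gcongr; exact h3 _ _ _ (by positivity) (by positivity) (by positivity)
      _ = _ := by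
          rw [Real.mul_rpow hVx (abs_nonneg _), Real.mul_rpow hVy (abs_nonneg _)]; ring
  have hVQ : ∫⁻ x, ∫⁻ y, ENNReal.ofReal (V x ^ p) * Q x y < ⊤ := by
    set D := (C : ℝ≥0∞) * ENNReal.ofReal ((m * (4 / r)) ^ p * 1 ^ (p - s * p) + 1 ^ (-(s * p)))
      with hD
    calc _ ≤ ∫⁻ x, ENNReal.ofReal (V x ^ p) * D := by
          refine lintegral_mono fun x => ?_
          rw [lintegral_const_mul' _ _ ENNReal.ofReal_ne_top]
          gcongr
          exact hC η _ 1 x one_pos (by positivity) (hηd x) (hηL x)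
      _ = (∫⁻ x, ENNReal.ofReal (V x ^ p)) * D := lintegral_mul_const _ (by fun_prop)
      _ = (∫⁻ x in ball x₀ r, ENNReal.ofReal (|w x| ^ p)) * D := by
          rw [← lintegral_indicator measurableSet_ball]
          congr 2
          ext x
          by_cases hx : x ∈ ball x₀ r
          · simp only [hV, indicator_of_mem hx]
          · simp [hV, indicator_of_notMem hx, Real.zero_rpow (by linarith : p ≠ 0)]
      _ < ⊤ := ENNReal.mul_lt_top hwL
          (ENNReal.mul_lt_top ENNReal.coe_lt_top ENNReal.ofReal_lt_top)
  have hVQ' : ∫⁻ x, ∫⁻ y, ENNReal.ofReal (V y ^ p) * Q x y < ⊤ := by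
    rw [lintegral_lintegral_swap (Measurable.aemeasurable (by
      change Measurable fun z : Rn n × Rn n => ENNReal.ofReal (V z.2 ^ p) * Q z.1 z.2
      fun_prop))]
    simp_rw [fun x y => hQs y x]
    exact hVQ
  have hwg' : ∫⁻ x, ∫⁻ y, ENNReal.ofReal (|w x - w y| ^ p / ‖x - y‖ ^ ((n : ℝ) + s * p)) < ⊤ := by
    simpa only [gagliardo, Measure.restrict_univ] using hwg
  have hQm1 : ∀ x, Measurable fun y => Q x y := by
    intro x; simp only [hQ]; fun_prop
  simp only [gagliardo, Measure.restrict_univ]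
  refine lt_of_le_of_lt (lintegral_mono fun x => lintegral_mono fun y => pw2 x y) ?_
  have e1 : ∀ x, ∫⁻ y, ENNReal.ofReal (3 ^ p) *
        (ENNReal.ofReal (|w x - w y| ^ p / ‖x - y‖ ^ ((n : ℝ) + s * p)) +
        ENNReal.ofReal (V x ^ p) * Q x y + ENNReal.ofReal (V y ^ p) * Q x y) =
      ENNReal.ofReal (3 ^ p) * (
        (∫⁻ y, ENNReal.ofReal (|w x - w y| ^ p / ‖x - y‖ ^ ((n : ℝ) + s * p))) +
        (∫⁻ y, ENNReal.ofReal (V x ^ p) * Q x y) + ∫⁻ y, ENNReal.ofReal (V y ^ p) * Q x y) := by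
    intro x
    have := hQm1 x
    rw [lintegral_const_mul' _ _ ENNReal.ofReal_ne_top, lintegral_add_left (by fun_prop),
      lintegral_add_left (by fun_prop)]
  simp_rw [e1]
  rw [lintegral_const_mul' _ _ ENNReal.ofReal_ne_top, lintegral_add_left (by fun_prop),
      lintegral_add_left (by fun_prop)]
  exact ENNReal.mul_lt_top ENNReal.ofReal_lt_top
    (ENNReal.add_lt_top.2 ⟨ENNReal.add_lt_top.2 ⟨hwg', hVQ⟩, hVQ'⟩)

lemma exists_bad_near_le (n : ℕ) (hn : 0 < n) {s p β γ : ℝ} (hs : 0 < s) (hs1 : s < 1)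
    (hp : 1 < p) (hβ : 0 < β) (hβ1 : β ≤ 1) (hγ : 0 < γ) (hγ1 : γ ≤ 1) :
    ∃ C : ℝ≥0, ∀ (w : Rn n → ℝ) (x₀ : Rn n) (r : ℝ) (x : Rn n), 0 < r →
      ∫⁻ y, ENNReal.ofReal ((max (w x - w y) 0) ^ (p - 1) *
        max (-(trunc β (cutoff x₀ r x ^ (p / γ) * max (w x) 0) -
          trunc β (cutoff x₀ r y ^ (p / γ) * max (w y) 0))) 0 *
          (‖x - y‖ ^ ((n : ℝ) + s * p))⁻¹) ≤
      C * (ENNReal.ofReal (r ^ (-(s * p))) * ENNReal.ofReal ((max (w x) 0) ^ (p - 1 + γ))) := by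
  obtain ⟨C, hC⟩ := exists_lintegral_lipschitz_le n hn hs hs1 hp
  set A := 2 ^ p + (2 ^ (p / γ) * (p / γ)) ^ p with hA
  have hA0 : 0 ≤ A := by positivity
  refine ⟨A.toNNReal * C * (4 ^ p + 1 : ℝ).toNNReal, fun w x₀ r x hr => ?_⟩
  set Z := (max (w x) 0) ^ (p - 1 + γ) with hZ
  have hZ0 : 0 ≤ Z := Real.rpow_nonneg (le_max_right _ _) _
  have h1 := hC (cutoff x₀ r) (4 / r) r x hr (by positivity) (fun y => by
    rw [abs_le]
    constructor <;> linarith [cutoff_nonneg x₀ r x, cutoff_nonneg x₀ r y,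
      cutoff_le_one x₀ r x, cutoff_le_one x₀ r y]) (abs_cutoff_sub_le x₀ hr x)
  have e : (4 / r) ^ p * r ^ (p - s * p) + r ^ (-(s * p)) = (4 ^ p + 1) * r ^ (-(s * p)) := by
    rw [Real.div_rpow (by norm_num) hr.le, sub_eq_add_neg, Real.rpow_add hr]
    have := (Real.rpow_pos_of_pos hr p).ne'
    field_simp
  rw [e] at h1
  calc _ ≤ ∫⁻ y, ENNReal.ofReal (A * Z) * ENNReal.ofReal (|cutoff x₀ r x - cutoff x₀ r y| ^ p *
        (‖x - y‖ ^ ((n : ℝ) + s * p))⁻¹) := by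
        refine lintegral_mono fun y => ?_
        rw [← ENNReal.ofReal_mul (by positivity)]
        refine ENNReal.ofReal_le_ofReal ?_
        rw [← mul_assoc, neg_sub, abs_sub_comm]
        refine mul_le_mul_of_nonneg_right ?_ (by positivity)
        exact opposite_sign_bound hβ hβ1 hγ hγ1 hp (cutoff_nonneg _ _ _) (cutoff_nonneg _ _ _)
    _ = ENNReal.ofReal (A * Z) * ∫⁻ y, ENNReal.ofReal (|cutoff x₀ r x - cutoff x₀ r y| ^ p *
        (‖x - y‖ ^ ((n : ℝ) + s * p))⁻¹) := lintegral_const_mul' _ _ ENNReal.ofReal_ne_top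
    _ ≤ ENNReal.ofReal (A * Z) * (C * ENNReal.ofReal ((4 ^ p + 1) * r ^ (-(s * p)))) := by gcongr
    _ = _ := by
        rw [ENNReal.ofReal_mul hA0, ENNReal.ofReal_mul (by positivity)]
        push_cast
        rw [ENNReal.ofReal, ENNReal.ofReal, ENNReal.ofReal]
        ring

lemma exists_bad_far_le (n : ℕ) (hn : 0 < n) {s p β m : ℝ} (hs : 0 < s)
    (hp : 1 < p) (hβ : 0 < β) (hm : 1 ≤ m) :
    ∃ C : ℝ≥0, ∀ (w : Rn n → ℝ) (x₀ : Rn n) (r : ℝ) (x : Rn n), 0 < r → x ∉ ball x₀ r →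
      ∫⁻ y, ENNReal.ofReal ((max (w x - w y) 0) ^ (p - 1) *
        max (-(trunc β (cutoff x₀ r x ^ m * max (w x) 0) -
          trunc β (cutoff x₀ r y ^ m * max (w y) 0))) 0 *
          (‖x - y‖ ^ ((n : ℝ) + s * p))⁻¹) ≤
      C * (ENNReal.ofReal (r ^ n) * ENNReal.ofReal ((max (w x) 0) ^ (p - 1) *
        (‖x - x₀‖ ^ ((n : ℝ) + s * p))⁻¹)) := by
  obtain ⟨ω, hω, hvol⟩ := exists_volume_ball n hn
  set A : ℝ := 4 ^ ((n : ℝ) + s * p) with hA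
  have hA0 : 0 ≤ A := by positivity
  refine ⟨A.toNNReal * ω.toNNReal, fun w x₀ r x hr hx => ?_⟩
  have hxr : r ≤ ‖x - x₀‖ := by simpa [dist_eq_norm] using hx
  have hx0 : 0 < ‖x - x₀‖ := hr.trans_le hxr
  have hxc : cutoff x₀ r x = 0 := cutoff_eq_zero hr fun h =>
    hx (closedBall_subset_ball (by linarith) h)
  set Z := (max (w x) 0) ^ (p - 1) * (‖x - x₀‖ ^ ((n : ℝ) + s * p))⁻¹ with hZ
  have hw0 : 0 ≤ (max (w x) 0) ^ (p - 1) := Real.rpow_nonneg (le_max_right _ _) _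
  have hZ0 : 0 ≤ Z := by positivity
  calc _ ≤ ∫⁻ y, (ball x₀ r).indicator (fun _ => ENNReal.ofReal (A * Z)) y := by
        refine lintegral_mono fun y => ?_
        by_cases hy : y ∈ closedBall x₀ (3 * r / 4)
        · rw [indicator_of_mem (closedBall_subset_ball (by linarith) hy)]
          refine ENNReal.ofReal_le_ofReal ?_
          have hy' : ‖y - x₀‖ ≤ 3 * r / 4 := by simpa [dist_eq_norm] using hy
          have hxy : ‖x - x₀‖ / 4 ≤ ‖x - y‖ := by
            have := norm_sub_le_norm_sub_add_norm_sub x y x₀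
            linarith
          have h1 := opposite_sign_bound_far (β := β) (p := p) (X := cutoff x₀ r x ^ m)
            (Y := cutoff x₀ r y ^ m) (wx := w x) (wy := w y) hβ hp
            (Real.rpow_nonneg (cutoff_nonneg _ _ _) _) (Real.rpow_nonneg (cutoff_nonneg _ _ _) _)
          rw [neg_sub]
          calc _ ≤ (max (w x) 0) ^ (p - 1) * (‖x - y‖ ^ ((n : ℝ) + s * p))⁻¹ := by gcongr
            _ ≤ (max (w x) 0) ^ (p - 1) * ((‖x - x₀‖ / 4) ^ ((n : ℝ) + s * p))⁻¹ := by
                gcongr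
            _ = A * Z := by
                rw [Real.div_rpow hx0.le (by norm_num), inv_div, hZ, hA]; ring
        · rw [cutoff_eq_zero hr hy, hxc, Real.zero_rpow (by linarith), zero_mul, zero_mul, sub_self]
          simp
    _ = ENNReal.ofReal (A * Z) * ENNReal.ofReal (ω * r ^ n) := by
        rw [lintegral_indicator measurableSet_ball, setLIntegral_const, hvol x₀ r hr]
    _ = _ := by
        rw [ENNReal.ofReal_mul hA0, ENNReal.ofReal_mul hω.le]
        push_cast
        simp only [ENNReal.ofReal]
        ring

lemma exists_caccioppoli (n : ℕ) (hn : 0 < n) {s p Λ β γ : ℝ} (hs : 0 < s) (hs1 : s < 1)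
    (hp : 1 < p) (hΛ : 1 ≤ Λ) (hβ : 0 < β) (hβ1 : β ≤ 1) (hγ : 0 < γ) (hγ1 : γ ≤ 1) :
    ∃ C : ℝ≥0, ∀ (Φ : ℝ → ℝ) (K : Rn n → Rn n → ℝ) (Ω : Set (Rn n)) (f w : Rn n → ℝ),
      PhiBounds Λ p Φ → KernelBounds n Λ s p K → IsOpen Ω → Continuous f → HasCompactSupport f →
      Measurable w → gagliardo n s p univ w < ⊤ →
      (∀ x r, ∫⁻ x in ball x r, ENNReal.ofReal (|w x| ^ p) < ⊤) →
      (∀ φ, IsTestFun n Ω φ → nonlocalForm n Φ K w φ = ∫ x, φ x * f x) →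
      ∀ (x₀ : Rn n) (r : ℝ), 0 < r → closedBall x₀ r ⊆ Ω →
      posEnergy n s p β x₀ (r / 2) w ≤
        C * (ENNReal.ofReal (r ^ (-(s * p))) * posMass n (p - 1 + γ) x₀ r w +
          ENNReal.ofReal (r ^ n) * posTail n s p x₀ r w +
          ∫⁻ x in ball x₀ r, ENNReal.ofReal |f x|) := by
  have hm : 1 ≤ p / γ := by rw [le_div_iff₀ hγ]; linarith
  obtain ⟨C₁, h₁⟩ := exists_bad_near_le n hn hs hs1 hp hβ hβ1 hγ hγ1
  obtain ⟨C₂, h₂⟩ := exists_bad_far_le n hn hs hp hβ hm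
  have hΛ0 : 0 < Λ := by linarith
  refine ⟨(Λ ^ 2).toNNReal * (1 + 2 * (Λ ^ 2).toNNReal * (C₁ + C₂)),
    fun Φ K Ω f w hΦ hK hΩ hf hfc hw hwg hwL hweak x₀ r hr hball => ?_⟩
  set φ : Rn n → ℝ := fun x => trunc β (cutoff x₀ r x ^ (p / γ) * max (w x) 0) with hφ
  have harg : ∀ x, 0 ≤ cutoff x₀ r x ^ (p / γ) * max (w x) 0 := fun x =>
    mul_nonneg (Real.rpow_nonneg (cutoff_nonneg _ _ _) _) (le_max_right _ _)
  have hφm : Measurable φ := by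
    have := (continuous_cutoff x₀ r).measurable
    exact (measurable_trunc β).comp (by fun_prop)
  have hφS : ∀ x, x ∉ closedBall x₀ (3 * r / 4) → φ x = 0 := fun x hx => by
    simp only [hφ]
    rw [cutoff_eq_zero hr hx, Real.zero_rpow (by linarith), zero_mul, trunc_zero]
  have hφ0 : ∀ x, 0 ≤ φ x := fun x => trunc_nonneg hβ (harg x)
  have hφ1 : ∀ x, φ x ≤ 1 := fun x => trunc_le_one (harg x)
  have hSΩ : closedBall x₀ (3 * r / 4) ⊆ Ω :=
    (closedBall_subset_closedBall (by linarith)).trans hball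
  obtain ⟨hFi, hFe⟩ := weak_form_extend hp hΛ hK hΦ hΩ hf hfc hw hwg hweak hφm hφ0 hφ1
    (isCompact_closedBall _ _) hSΩ hφS
    (gagliardo_trunc_lt_top hn hs hs1 hp hβ hβ1 hm hw hwg hr (hwL x₀ r))
  set G : Rn n → Rn n → ℝ := fun x y => (max (w x - w y) 0) ^ (p - 1) * max (φ x - φ y) 0 *
    (‖x - y‖ ^ ((n : ℝ) + s * p))⁻¹ with hG
  set B : Rn n → Rn n → ℝ := fun x y => (max (w x - w y) 0) ^ (p - 1) * max (-(φ x - φ y)) 0 *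
    (‖x - y‖ ^ ((n : ℝ) + s * p))⁻¹ with hB
  have hGm : Measurable fun z : Rn n × Rn n => G z.1 z.2 := by simp only [hG]; fun_prop
  have hBm : Measurable fun z : Rn n × Rn n => B z.1 z.2 := by simp only [hB]; fun_prop
  have hBm' : Measurable fun z : Rn n × Rn n => B z.2 z.1 := by simp only [hB]; fun_prop
  have hG0 : ∀ x y, 0 ≤ G x y := fun x y => mul_nonneg (mul_nonneg
    (Real.rpow_nonneg (le_max_right _ _) _) (le_max_right _ _)) (by positivity)
  have hB0 : ∀ x y, 0 ≤ B x y := fun x y => mul_nonneg (mul_nonneg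
    (Real.rpow_nonneg (le_max_right _ _) _) (le_max_right _ _)) (by positivity)
  have hpw : ∀ z : Rn n × Rn n, (Λ ^ 2)⁻¹ * G z.1 z.2 ≤
      Φ (w z.1 - w z.2) * (φ z.1 - φ z.2) * K z.1 z.2 +
        Λ ^ 2 * (B z.1 z.2 + B z.2 z.1) := by
    intro z
    rcases eq_or_ne z.1 z.2 with h | h
    · simp [hG, hB, h, hΦ.2.1]
    · have hr : 0 < ‖z.1 - z.2‖ := norm_pos_iff.2 (sub_ne_zero.2 h)
      have := form_pointwise (a := w z.1 - w z.2) (b := φ z.1 - φ z.2) hΦ hΛ hp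
        (Real.rpow_pos_of_pos hr ((n : ℝ) + s * p)) (hK.2 _ _ h).1 (hK.2 _ _ h).2
      simp only [hG, hB]
      rw [neg_sub (φ z.2), norm_sub_rev z.2 z.1]
      rw [neg_sub (w z.1)] at this
      linarith
  have hmain : ∫⁻ z : Rn n × Rn n, ENNReal.ofReal ((Λ ^ 2)⁻¹ * G z.1 z.2) ∂(volume.prod volume) ≤
      ENNReal.ofReal (∫ z : Rn n × Rn n, Φ (w z.1 - w z.2) * (φ z.1 - φ z.2) * K z.1 z.2
        ∂(volume.prod volume)) +
      ∫⁻ z : Rn n × Rn n, ENNReal.ofReal (Λ ^ 2 * (B z.1 z.2 + B z.2 z.1))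
        ∂(volume.prod volume) := lintegral_le_ofReal_integral_add hFi (hGm.const_mul _)
    ((hBm.add hBm').const_mul (Λ ^ 2)) (fun z => mul_nonneg (by positivity) (hG0 _ _))
    (fun z => mul_nonneg (by positivity) (add_nonneg (hB0 _ _) (hB0 _ _))) hpw
  rw [hFe] at hmain
  have hE : posEnergy n s p β x₀ (r / 2) w ≤
      ∫⁻ z : Rn n × Rn n, ENNReal.ofReal (G z.1 z.2) ∂(volume.prod volume) := by
    rw [lintegral_prod _ (by fun_prop)]
    refine le_trans ?_ (setLIntegral_le_lintegral (ball x₀ (r / 2)) _)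
    refine setLIntegral_mono' measurableSet_ball fun x hx => ?_
    refine le_trans ?_ (setLIntegral_le_lintegral (ball x₀ (r / 2)) _)
    refine setLIntegral_mono' measurableSet_ball fun y hy => ?_
    simp only [hG, hφ]
    rw [cutoff_eq_one hr hx, cutoff_eq_one hr hy, Real.one_rpow, one_mul, one_mul]
  have hf1 : ENNReal.ofReal (∫ x, φ x * f x) ≤ ∫⁻ x in ball x₀ r, ENNReal.ofReal |f x| := by
    refine (ENNReal.ofReal_le_ofReal (le_abs_self _)).trans ?_
    rw [← Real.norm_eq_abs, ofReal_norm]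
    refine (enorm_integral_le_lintegral_enorm _).trans ?_
    rw [← lintegral_indicator measurableSet_ball]
    refine lintegral_mono fun x => ?_
    by_cases hx : x ∈ ball x₀ r
    · rw [indicator_of_mem hx, ← ofReal_norm]
      refine ENNReal.ofReal_le_ofReal ?_
      rw [norm_mul, Real.norm_eq_abs, Real.norm_eq_abs, abs_of_nonneg (hφ0 x)]
      exact mul_le_of_le_one_left (abs_nonneg _) (hφ1 x)
    · rw [hφS x fun h => hx (closedBall_subset_ball (by linarith) h)]; simp
  have hBad : ∫⁻ z : Rn n × Rn n, ENNReal.ofReal (B z.1 z.2) ∂(volume.prod volume) ≤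
      (C₁ + C₂) * (ENNReal.ofReal (r ^ (-(s * p))) * posMass n (p - 1 + γ) x₀ r w +
          ENNReal.ofReal (r ^ n) * posTail n s p x₀ r w) := by
    rw [lintegral_prod _ (by fun_prop),
      ← lintegral_add_compl _ (measurableSet_ball (x := x₀) (ε := r))]
    rw [mul_add]
    gcongr ?_ + ?_
    · calc _ ≤ ∫⁻ x in ball x₀ r, C₁ * (ENNReal.ofReal (r ^ (-(s * p))) *
            ENNReal.ofReal ((max (w x) 0) ^ (p - 1 + γ))) :=
            lintegral_mono fun x => h₁ w x₀ r x hr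
        _ = C₁ * (ENNReal.ofReal (r ^ (-(s * p))) * posMass n (p - 1 + γ) x₀ r w) := by
            rw [lintegral_const_mul' _ _ ENNReal.coe_ne_top,
              lintegral_const_mul' _ _ ENNReal.ofReal_ne_top, posMass]
        _ ≤ _ := by gcongr; exact le_self_add
    · calc _ ≤ ∫⁻ x in (ball x₀ r)ᶜ, C₂ * (ENNReal.ofReal (r ^ n) *
            ENNReal.ofReal ((max (w x) 0) ^ (p - 1) * (‖x - x₀‖ ^ ((n : ℝ) + s * p))⁻¹)) :=
            setLIntegral_mono' measurableSet_ball.compl fun x hx => h₂ w x₀ r x hr hx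
        _ = C₂ * (ENNReal.ofReal (r ^ n) * posTail n s p x₀ r w) := by
            rw [lintegral_const_mul' _ _ ENNReal.coe_ne_top,
              lintegral_const_mul' _ _ ENNReal.ofReal_ne_top, posTail]
        _ ≤ _ := by gcongr; exact le_add_self
  have hBad' : ∫⁻ z : Rn n × Rn n, ENNReal.ofReal (B z.2 z.1) ∂(volume.prod volume) =
      ∫⁻ z : Rn n × Rn n, ENNReal.ofReal (B z.1 z.2) ∂(volume.prod volume) :=
    lintegral_prod_swap (fun z : Rn n × Rn n => ENNReal.ofReal (B z.1 z.2))
  simp_rw [ENNReal.ofReal_mul (by positivity : 0 ≤ (Λ ^ 2)⁻¹),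
    ENNReal.ofReal_mul (by positivity : 0 ≤ (Λ ^ 2)),
    fun z : Rn n × Rn n => ENNReal.ofReal_add (hB0 z.1 z.2) (hB0 z.2 z.1)] at hmain
  rw [lintegral_const_mul' _ _ ENNReal.ofReal_ne_top,
    lintegral_const_mul' _ _ ENNReal.ofReal_ne_top,
    lintegral_add_left (by fun_prop), hBad', ← two_mul] at hmain
  set I := ∫⁻ z : Rn n × Rn n, ENNReal.ofReal (G z.1 z.2) ∂(volume.prod volume)
  set J := ∫⁻ z : Rn n × Rn n, ENNReal.ofReal (B z.1 z.2) ∂(volume.prod volume)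
  set X := ENNReal.ofReal (r ^ (-(s * p))) * posMass n (p - 1 + γ) x₀ r w +
          ENNReal.ofReal (r ^ n) * posTail n s p x₀ r w
  set Y := ∫⁻ x in ball x₀ r, ENNReal.ofReal |f x|
  have hI : I = ENNReal.ofReal (Λ ^ 2) * (ENNReal.ofReal (Λ ^ 2)⁻¹ * I) := by
    rw [← mul_assoc, ← ENNReal.ofReal_mul (by positivity), mul_inv_cancel₀ (by positivity),
      ENNReal.ofReal_one, one_mul]
  calc _ ≤ I := hE
    _ = ENNReal.ofReal (Λ ^ 2) * (ENNReal.ofReal (Λ ^ 2)⁻¹ * I) := hI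
    _ ≤ ENNReal.ofReal (Λ ^ 2) * (Y + ENNReal.ofReal (Λ ^ 2) * (2 * ((C₁ + C₂) * X))) := by
        gcongr
        refine hmain.trans ?_
        gcongr
    _ ≤ ENNReal.ofReal (Λ ^ 2) * ((Y + X) +
          ENNReal.ofReal (Λ ^ 2) * (2 * ((C₁ + C₂) * (X + Y)))) := by
        gcongr
        · exact le_self_add
        · exact le_self_add
    _ = _ := by
        push_cast
        simp only [ENNReal.ofReal]
        ring

lemma add_rpow_le_two_rpow_mul {a b t : ℝ} (ha : 0 ≤ a) (hb : 0 ≤ b) (ht : 0 ≤ t) :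
    (a + b) ^ t ≤ 2 ^ t * (a ^ t + b ^ t) := by
  have h1 : a + b ≤ 2 * max a b := by
    have := le_max_left a b
    have := le_max_right a b
    linarith
  calc _ ≤ (2 * max a b) ^ t := by gcongr
    _ = 2 ^ t * (max a b) ^ t := Real.mul_rpow (by positivity) (le_max_of_le_left ha)
    _ ≤ _ := by
        gcongr
        have := Real.rpow_nonneg ha t
        have := Real.rpow_nonneg hb t
        rcases max_choice a b with h | h <;> rw [h] <;> linarith

lemma PhiBounds.rescale {Λ p d : ℝ} {Φ : ℝ → ℝ} (hΦ : PhiBounds Λ p Φ) (hd : 0 < d) :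
    PhiBounds Λ p (fun t => Φ (d * t) / d ^ (p - 1)) := by
  have hdp : d ^ p = d ^ (p - 1) * d := by
    rw [← Real.rpow_add_one hd.ne']; congr 1; ring
  refine ⟨(hΦ.1.comp (continuous_const.mul continuous_id)).div_const _, by simp [hΦ.2.1],
    fun t => ?_⟩
  have h := hΦ.2.2 (d * t)
  have hd1 : 0 < d ^ (p - 1) := by positivity
  rw [abs_mul, abs_of_pos hd, Real.mul_rpow hd.le (abs_nonneg t), hdp] at h
  have e : Φ (d * t) / d ^ (p - 1) * t = (Φ (d * t) * (d * t)) / (d ^ (p - 1) * d) := by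
    field_simp
  rw [e, le_div_iff₀ (by positivity), div_le_iff₀ (by positivity)]
  constructor
  · calc _ = d ^ (p - 1) * d * |t| ^ p / Λ := by ring
      _ ≤ _ := h.1
  · calc _ ≤ _ := h.2
      _ = _ := by ring

lemma nonlocalForm_rescale {n : ℕ} {p a d : ℝ} {Φ : ℝ → ℝ} {K : Rn n → Rn n → ℝ}
    (hd : 0 < d) (v φ : Rn n → ℝ) :
    nonlocalForm n (fun t => Φ (d * t) / d ^ (p - 1)) K (fun x => (v x - a) / d) φ =
      nonlocalForm n Φ K v φ / d ^ (p - 1) := by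
  simp only [nonlocalForm]
  rw [← integral_div]
  refine integral_congr_ae (Eventually.of_forall fun x => ?_)
  simp only
  rw [← integral_div]
  refine integral_congr_ae (Eventually.of_forall fun y => ?_)
  have : d * ((v x - a) / d - (v y - a) / d) = v x - v y := by field_simp; ring
  simp only [this]
  ring

lemma gagliardo_rescale_lt_top {n : ℕ} {s p a d : ℝ} (hd : 0 < d) {v : Rn n → ℝ}
    (hv : gagliardo n s p univ v < ⊤) :
    gagliardo n s p univ (fun x => (v x - a) / d) < ⊤ := by
  have e : ∀ x y : Rn n, ENNReal.ofReal (|(v x - a) / d - (v y - a) / d| ^ p /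
      ‖x - y‖ ^ ((n : ℝ) + s * p)) = ENNReal.ofReal (d ^ p)⁻¹ *
      ENNReal.ofReal (|v x - v y| ^ p / ‖x - y‖ ^ ((n : ℝ) + s * p)) := by
    intro x y
    rw [← ENNReal.ofReal_mul (by positivity)]
    have : (v x - a) / d - (v y - a) / d = (v x - v y) / d := by ring
    rw [this, abs_div, abs_of_pos hd, Real.div_rpow (abs_nonneg _) hd.le]
    congr 1
    ring
  simp only [gagliardo, e, lintegral_const_mul' _ _ ENNReal.ofReal_ne_top]
  exact ENNReal.mul_lt_top ENNReal.ofReal_lt_top hv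

lemma lintegral_rescale_lt_top {n : ℕ} {p a d : ℝ} (hp : 0 < p) (hd : 0 < d) {v : Rn n → ℝ}
    (hvm : Measurable v)
    {x : Rn n} {r : ℝ} (hv : ∫⁻ x in ball x r, ENNReal.ofReal (|v x| ^ p) < ⊤) :
    ∫⁻ x in ball x r, ENNReal.ofReal (|(v x - a) / d| ^ p) < ⊤ := by
  have e : ∀ x, ENNReal.ofReal (|(v x - a) / d| ^ p) ≤ ENNReal.ofReal (2 ^ p / d ^ p) *
      (ENNReal.ofReal (|v x| ^ p) + ENNReal.ofReal (|a| ^ p)) := by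
    intro x
    rw [← ENNReal.ofReal_add (by positivity) (by positivity), ← ENNReal.ofReal_mul (by positivity)]
    refine ENNReal.ofReal_le_ofReal ?_
    rw [abs_div, abs_of_pos hd, Real.div_rpow (abs_nonneg _) hd.le]
    calc _ ≤ (|v x| + |a|) ^ p / d ^ p := by gcongr; exact abs_sub _ _
      _ ≤ (2 ^ p * (|v x| ^ p + |a| ^ p)) / d ^ p := by
          gcongr; exact add_rpow_le_two_rpow_mul (abs_nonneg _) (abs_nonneg _) hp.le
      _ = _ := by ring
  refine lt_of_le_of_lt (lintegral_mono e) ?_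
  rw [lintegral_const_mul' _ _ ENNReal.ofReal_ne_top, lintegral_add_left (by fun_prop),
    setLIntegral_const]
  exact ENNReal.mul_lt_top ENNReal.ofReal_lt_top (ENNReal.add_lt_top.2 ⟨hv,
    ENNReal.mul_lt_top ENNReal.ofReal_lt_top measure_ball_lt_top⟩)

/-- The energy inequality on all superlevel sets, with measure datum `ν`. -/
def LevelIneq (n : ℕ) (s p β q : ℝ) (C : ℝ≥0) (ν : Measure (Rn n)) (Ω : Set (Rn n))
    (u : Rn n → ℝ) : Prop :=
  ∀ (x₀ : Rn n) (r a d : ℝ), 0 < r → 0 < d → closedBall x₀ r ⊆ Ω →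
    posEnergy n s p β x₀ (r / 2) (fun x => (u x - a) / d) ≤
      C * (ENNReal.ofReal (r ^ (-(s * p))) * posMass n q x₀ r (fun x => (u x - a) / d) +
        ENNReal.ofReal (r ^ n) * posTail n s p x₀ r (fun x => (u x - a) / d) +
        ENNReal.ofReal (d ^ (p - 1))⁻¹ * ν (closedBall x₀ r))

lemma lintegral_posPart_rpow_le {α : Type*} [MeasurableSpace α] {μ : Measure α} {t a d : ℝ}
    (ht : 0 ≤ t) (hd : 0 < d) {v v' : α → ℝ} (hv : Measurable v) {k : α → ℝ}
    (hk : Measurable k) (hk0 : ∀ x, 0 ≤ k x) :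
    ∫⁻ x, ENNReal.ofReal ((max ((v' x - a) / d) 0) ^ t * k x) ∂μ ≤
      ENNReal.ofReal (2 ^ t) * ∫⁻ x, ENNReal.ofReal ((max ((v x - a) / d) 0) ^ t * k x) ∂μ +
      ENNReal.ofReal (2 ^ t / d ^ t) * ∫⁻ x, ENNReal.ofReal (|v' x - v x| ^ t * k x) ∂μ := by
  rw [← lintegral_const_mul' _ _ ENNReal.ofReal_ne_top,
    ← lintegral_const_mul' _ _ ENNReal.ofReal_ne_top, ← lintegral_add_left (by fun_prop)]
  refine lintegral_mono fun x => ?_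
  have := hk0 x
  have h0 : 0 ≤ max ((v x - a) / d) 0 := le_max_right _ _
  have h1 : 0 ≤ max ((v' x - a) / d) 0 := le_max_right _ _
  rw [← ENNReal.ofReal_mul (by positivity), ← ENNReal.ofReal_mul (by positivity),
    ← ENNReal.ofReal_add (by positivity) (by positivity)]
  refine ENNReal.ofReal_le_ofReal ?_
  have h2 : max ((v' x - a) / d) 0 ≤ max ((v x - a) / d) 0 + |v' x - v x| / d := by
    refine max_le ?_ (by positivity)
    have e : (v' x - a) / d = (v x - a) / d + (v' x - v x) / d := by ring
    rw [e]
    gcongr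
    · exact le_max_left _ _
    · exact le_abs_self _
  calc _ ≤ (max ((v x - a) / d) 0 + |v' x - v x| / d) ^ t * k x := by gcongr
    _ ≤ (2 ^ t * ((max ((v x - a) / d) 0) ^ t + (|v' x - v x| / d) ^ t)) * k x := by
        gcongr; exact add_rpow_le_two_rpow_mul h0 (by positivity) ht
    _ = _ := by rw [Real.div_rpow (abs_nonneg _) hd.le]; ring

lemma continuousOn_trunc_max (β : ℝ) : Continuous fun t : ℝ => trunc β (max t 0) := by
  unfold trunc
  refine continuous_const.sub (Continuous.rpow_const (by fun_prop) fun t => Or.inl ?_)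
  have : 0 ≤ max t 0 := le_max_right _ _
  positivity

lemma posEnergy_le_liminf {n : ℕ} {s p β : ℝ} (hp : 1 < p) {w : Rn n → ℝ} {v : ℕ → Rn n → ℝ}
    (hv : ∀ j, Measurable (v j)) (h : ∀ᵐ x, Tendsto (fun j => v j x) atTop (𝓝 (w x)))
    (x₀ : Rn n) (ρ : ℝ) :
    posEnergy n s p β x₀ ρ w ≤ liminf (fun j => posEnergy n s p β x₀ ρ (v j)) atTop := by
  have htm := measurable_trunc β
  unfold posEnergy
  refine le_trans ?_ (lintegral_liminf_le fun j => ?_)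
  · refine lintegral_mono_ae ((ae_restrict_of_ae h).mono fun x hx => ?_)
    refine le_trans ?_ (lintegral_liminf_le fun j => ?_)
    · refine lintegral_mono_ae ((ae_restrict_of_ae h).mono fun y hy => ?_)
      refine le_of_eq (Tendsto.liminf_eq ?_).symm
      refine (ENNReal.continuous_ofReal.tendsto _).comp ?_
      refine Tendsto.mul (Tendsto.mul ?_ ?_) tendsto_const_nhds
      · exact (((hx.sub hy).max tendsto_const_nhds)).rpow_const (Or.inr (by linarith))
      · exact ((((continuousOn_trunc_max β).tendsto _).comp hx).sub
          (((continuousOn_trunc_max β).tendsto _).comp hy)).max tendsto_const_nhds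
    · have := hv j
      fun_prop
  · have := hv j
    exact Measurable.lintegral_prod_right' (f := fun z : Rn n × Rn n => ENNReal.ofReal
      ((max (v j z.1 - v j z.2) 0) ^ (p - 1) *
      max (trunc β (max (v j z.1) 0) - trunc β (max (v j z.2) 0)) 0 *
        (‖z.1 - z.2‖ ^ ((n : ℝ) + s * p))⁻¹)) (by fun_prop)

lemma exists_levelIneq (n : ℕ) (hn : 0 < n) {s p Λ β γ : ℝ} (hs : 0 < s) (hs1 : s < 1)
    (hp : 1 < p) (hΛ : 1 ≤ Λ) (hβ : 0 < β) (hβ1 : β ≤ 1) (hγ : 0 < γ) (hγ1 : γ ≤ 1) :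
    ∃ C : ℝ≥0, ∀ (Φ : ℝ → ℝ) (K : Rn n → Rn n → ℝ) (Ω : Set (Rn n)) (ν : Measure (Rn n))
      (u : Rn n → ℝ) (f v : ℕ → Rn n → ℝ),
      PhiBounds Λ p Φ → KernelBounds n Λ s p K → IsOpen Ω → IsFiniteMeasure ν → Measurable u →
      (∀ j, Continuous (f j)) → (∀ j, HasCompactSupport (f j)) →
      (∀ j, Measurable (v j)) → (∀ j, gagliardo n s p univ (v j) < ⊤) →
      (∀ j x r, ∫⁻ x in ball x r, ENNReal.ofReal (|v j x| ^ p) < ⊤) →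
      (∀ j φ, IsTestFun n Ω φ → nonlocalForm n Φ K (v j) φ = ∫ x, φ x * f j x) →
      (∀ᵐ x, Tendsto (fun j => v j x) atTop (𝓝 (u x))) →
      (∀ z r, 0 < r → Tendsto (fun j => ∫⁻ x in ball z r,
        ENNReal.ofReal (|v j x - u x| ^ (p - 1 + γ))) atTop (𝓝 0)) →
      (∀ z r, 0 < r → Tendsto (fun j => ∫⁻ x in (ball z r)ᶜ,
        ENNReal.ofReal (|v j x - u x| ^ (p - 1) * (‖x - z‖ ^ ((n : ℝ) + s * p))⁻¹))
          atTop (𝓝 0)) →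
      (∀ z r, 0 < r → limsup (fun j => ∫⁻ x in ball z r, ENNReal.ofReal |f j x|) atTop ≤
        ν (closedBall z r)) →
      LevelIneq n s p β (p - 1 + γ) C ν Ω u := by
  obtain ⟨C, hC⟩ := exists_caccioppoli n hn hs hs1 hp hΛ hβ hβ1 hγ hγ1
  set q := p - 1 + γ with hq
  refine ⟨C * (2 ^ q + 2 ^ (p - 1) + 1 : ℝ).toNNReal,
    fun Φ K Ω ν u f v hΦ hK hΩ hν hu hfc hfs hv hvg hvL hweak
    hae hLq htail hμ x₀ r a d hr hd hball => ?_⟩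
  have hp1 : 0 < p - 1 := by linarith
  have hc : ∀ j, posEnergy n s p β x₀ (r / 2) (fun x => (v j x - a) / d) ≤
      C * (ENNReal.ofReal (r ^ (-(s * p))) * posMass n q x₀ r (fun x => (v j x - a) / d) +
        ENNReal.ofReal (r ^ n) * posTail n s p x₀ r (fun x => (v j x - a) / d) +
        ENNReal.ofReal (d ^ (p - 1))⁻¹ * ∫⁻ x in ball x₀ r, ENNReal.ofReal |f j x|) := by
    intro j
    have h := hC (fun t => Φ (d * t) / d ^ (p - 1)) K Ω (fun x => f j x / d ^ (p - 1))
      (fun x => (v j x - a) / d) (hΦ.rescale hd) hK hΩ ((hfc j).div_const _)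
      ((hfs j).comp_left (g := fun t => t / d ^ (p - 1)) (zero_div _))
      (by have := hv j; fun_prop) (gagliardo_rescale_lt_top hd (hvg j))
      (fun x r => lintegral_rescale_lt_top (by linarith) hd (hv j) (hvL j x r))
      (fun φ hφ => by
        rw [nonlocalForm_rescale hd, hweak j φ hφ, ← integral_div]
        simp_rw [mul_div_assoc]) x₀ r hr hball
    refine h.trans_eq ?_
    congr 2
    rw [← lintegral_const_mul' _ _ ENNReal.ofReal_ne_top]
    refine lintegral_congr fun x => ?_
    rw [← ENNReal.ofReal_mul (by positivity), abs_div,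
      abs_of_pos (a := d ^ (p - 1)) (by positivity)]
    congr 1
    ring
  set M := posMass n q x₀ r (fun x => (u x - a) / d) with hM
  set T := posTail n s p x₀ r (fun x => (u x - a) / d) with hT
  set e₁ : ℕ → ℝ≥0∞ := fun j => ∫⁻ x in ball x₀ r, ENNReal.ofReal (|v j x - u x| ^ q) with he₁
  set e₂ : ℕ → ℝ≥0∞ := fun j => ∫⁻ x in (ball x₀ r)ᶜ,
    ENNReal.ofReal (|v j x - u x| ^ (p - 1) * (‖x - x₀‖ ^ ((n : ℝ) + s * p))⁻¹) with he₂
  have hm : ∀ j, posMass n q x₀ r (fun x => (v j x - a) / d) ≤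
      ENNReal.ofReal (2 ^ q) * M + ENNReal.ofReal (2 ^ q / d ^ q) * e₁ j := by
    intro j
    simpa [posMass, hM, he₁] using lintegral_posPart_rpow_le (μ := volume.restrict (ball x₀ r))
      (t := q) (a := a) (by linarith) hd (v' := v j) hu (k := fun _ => 1) measurable_const
        (fun _ => zero_le_one)
  have ht : ∀ j, posTail n s p x₀ r (fun x => (v j x - a) / d) ≤
      ENNReal.ofReal (2 ^ (p - 1)) * T + ENNReal.ofReal (2 ^ (p - 1) / d ^ (p - 1)) * e₂ j :=
    fun j => lintegral_posPart_rpow_le hp1.le hd hu (by fun_prop) (fun x => by positivity)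
  have hE : ∀ j, posEnergy n s p β x₀ (r / 2) (fun x => (v j x - a) / d) ≤
      C * (ENNReal.ofReal (r ^ (-(s * p))) * (ENNReal.ofReal (2 ^ q) * M +
        ENNReal.ofReal (2 ^ q / d ^ q) * e₁ j) +
        ENNReal.ofReal (r ^ n) * (ENNReal.ofReal (2 ^ (p - 1)) * T +
          ENNReal.ofReal (2 ^ (p - 1) / d ^ (p - 1)) * e₂ j) +
        ENNReal.ofReal (d ^ (p - 1))⁻¹ * ∫⁻ x in ball x₀ r, ENNReal.ofReal |f j x|) := by
    intro j
    refine (hc j).trans ?_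
    gcongr
    · exact hm j
    · exact ht j
  have hlim : ∀ ε : ℝ≥0, 0 < ε → posEnergy n s p β x₀ (r / 2) (fun x => (u x - a) / d) ≤
      C * (ENNReal.ofReal (r ^ (-(s * p))) * (ENNReal.ofReal (2 ^ q) * M) +
        ENNReal.ofReal (r ^ n) * (ENNReal.ofReal (2 ^ (p - 1)) * T) +
        ENNReal.ofReal (d ^ (p - 1))⁻¹ * (ν (closedBall x₀ r) + ε)) := by
    intro ε hε
    have hev : ∀ᶠ j in atTop, ∫⁻ x in ball x₀ r, ENNReal.ofReal |f j x| <
        ν (closedBall x₀ r) + ε := by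
      refine eventually_lt_of_limsup_lt ((hμ x₀ r hr).trans_lt ?_)
      exact ENNReal.lt_add_right (measure_ne_top _ _) (by simpa using hε.ne')
    have hT : Tendsto (fun j => C * (ENNReal.ofReal (r ^ (-(s * p))) * (ENNReal.ofReal (2 ^ q) * M +
        ENNReal.ofReal (2 ^ q / d ^ q) * e₁ j) +
        ENNReal.ofReal (r ^ n) * (ENNReal.ofReal (2 ^ (p - 1)) * T +
          ENNReal.ofReal (2 ^ (p - 1) / d ^ (p - 1)) * e₂ j) +
        ENNReal.ofReal (d ^ (p - 1))⁻¹ * (ν (closedBall x₀ r) + ε))) atTop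
        (𝓝 (C * (ENNReal.ofReal (r ^ (-(s * p))) * (ENNReal.ofReal (2 ^ q) * M +
        ENNReal.ofReal (2 ^ q / d ^ q) * 0) +
        ENNReal.ofReal (r ^ n) * (ENNReal.ofReal (2 ^ (p - 1)) * T +
          ENNReal.ofReal (2 ^ (p - 1) / d ^ (p - 1)) * 0) +
        ENNReal.ofReal (d ^ (p - 1))⁻¹ * (ν (closedBall x₀ r) + ε)))) := by
      have cm : ∀ {c x : ℝ≥0∞} {g : ℕ → ℝ≥0∞}, c ≠ ⊤ → Tendsto g atTop (𝓝 x) →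
          Tendsto (fun j => c * g j) atTop (𝓝 (c * x)) :=
        fun hc hg => ENNReal.Tendsto.const_mul hg (Or.inr hc)
      refine cm ENNReal.coe_ne_top (((cm ENNReal.ofReal_ne_top (tendsto_const_nhds.add
        (cm ENNReal.ofReal_ne_top (hLq x₀ r hr)))).add (cm ENNReal.ofReal_ne_top
        (tendsto_const_nhds.add (cm ENNReal.ofReal_ne_top (htail x₀ r hr))))).add
        tendsto_const_nhds)
    simp only [mul_zero, add_zero] at hT
    refine (posEnergy_le_liminf hp (v := fun j x => (v j x - a) / d)
      (fun j => by have := hv j; fun_prop) ?_ x₀ _).trans ?_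
    · filter_upwards [hae] with x hx using (hx.sub_const a).div_const d
    · rw [← hT.liminf_eq]
      refine liminf_le_liminf ?_
      filter_upwards [hev] with j hj
      refine (hE j).trans ?_
      gcongr
  have hfin : posEnergy n s p β x₀ (r / 2) (fun x => (u x - a) / d) ≤
      C * (ENNReal.ofReal (r ^ (-(s * p))) * (ENNReal.ofReal (2 ^ q) * M) +
        ENNReal.ofReal (r ^ n) * (ENNReal.ofReal (2 ^ (p - 1)) * T) +
        ENNReal.ofReal (d ^ (p - 1))⁻¹ * ν (closedBall x₀ r)) := by
    have hT : Tendsto (fun ε : ℝ≥0 => C * (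
        ENNReal.ofReal (r ^ (-(s * p))) * (ENNReal.ofReal (2 ^ q) * M) +
        ENNReal.ofReal (r ^ n) * (ENNReal.ofReal (2 ^ (p - 1)) * T) +
        ENNReal.ofReal (d ^ (p - 1))⁻¹ * (ν (closedBall x₀ r) + ε))) (𝓝[>] 0)
        (𝓝 (C * (ENNReal.ofReal (r ^ (-(s * p))) * (ENNReal.ofReal (2 ^ q) * M) +
        ENNReal.ofReal (r ^ n) * (ENNReal.ofReal (2 ^ (p - 1)) * T) +
        ENNReal.ofReal (d ^ (p - 1))⁻¹ * (ν (closedBall x₀ r) + (0 : ℝ≥0))))) := by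
      refine Tendsto.mono_left ?_ nhdsWithin_le_nhds
      refine ENNReal.Tendsto.const_mul (tendsto_const_nhds.add (ENNReal.Tendsto.const_mul
        (tendsto_const_nhds.add ?_) (Or.inr ENNReal.ofReal_ne_top))) (Or.inr ENNReal.coe_ne_top)
      exact ENNReal.continuous_coe.tendsto 0
    simp only [ENNReal.coe_zero, add_zero] at hT
    exact ge_of_tendsto hT (eventually_mem_nhdsWithin.mono fun ε hε => hlim ε hε)
  refine hfin.trans ?_
  set D := (((2 : ℝ) ^ q + 2 ^ (p - 1) + 1).toNNReal : ℝ≥0∞) with hD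
  have h2q : (0 : ℝ) ≤ 2 ^ q := by positivity
  have h2p : (0 : ℝ) ≤ 2 ^ (p - 1) := by positivity
  have d1 : ENNReal.ofReal (2 ^ q) ≤ D := ENNReal.ofReal_le_ofReal (by linarith)
  have d2 : ENNReal.ofReal (2 ^ (p - 1)) ≤ D := ENNReal.ofReal_le_ofReal (by linarith)
  have d3 : 1 ≤ D := by
    rw [← ENNReal.ofReal_one]; exact ENNReal.ofReal_le_ofReal (by linarith)
  calc _ ≤ C * (ENNReal.ofReal (r ^ (-(s * p))) * (D * M) +
        ENNReal.ofReal (r ^ n) * (D * T) +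
        ENNReal.ofReal (d ^ (p - 1))⁻¹ * (D * ν (closedBall x₀ r))) := by
        gcongr
        exact le_mul_of_one_le_left zero_le d3
    _ = _ := by
        rw [ENNReal.coe_mul]; ring

lemma mul_volume_le_posEnergy_inner {n : ℕ} {s p β ρ b : ℝ} {x₀ x : Rn n} {w : Rn n → ℝ}
    {S : Set (Rn n)} (hS : MeasurableSet S) (hSB : S ⊆ ball x₀ ρ)
    (h : ∀ y ∈ S, b ≤ (max (w x - w y) 0) ^ (p - 1) *
      max (trunc β (max (w x) 0) - trunc β (max (w y) 0)) 0 * (‖x - y‖ ^ ((n : ℝ) + s * p))⁻¹) :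
    ENNReal.ofReal b * volume S ≤ ∫⁻ y in ball x₀ ρ, ENNReal.ofReal ((max (w x - w y) 0) ^ (p - 1) *
      max (trunc β (max (w x) 0) - trunc β (max (w y) 0)) 0 *
        (‖x - y‖ ^ ((n : ℝ) + s * p))⁻¹) := by
  rw [← setLIntegral_const]
  exact (setLIntegral_mono' hS fun y hy => ENNReal.ofReal_le_ofReal (h y hy)).trans
    (lintegral_mono_set hSB)

lemma volume_superlevel_le {n : ℕ} {q t : ℝ} (hq : 0 < q) (ht : 0 < t) {w : Rn n → ℝ}
    (hw : Measurable w) (x₀ : Rn n) (r : ℝ) :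
    ENNReal.ofReal (t ^ q) * volume {y ∈ ball x₀ r | t < w y} ≤ posMass n q x₀ r w := by
  have hm : MeasurableSet {y ∈ ball x₀ r | t < w y} :=
    measurableSet_ball.inter (measurableSet_lt measurable_const hw)
  rw [posMass, ← setLIntegral_const]
  refine (setLIntegral_mono' hm fun y hy => ENNReal.ofReal_le_ofReal ?_).trans
    (lintegral_mono_set fun y hy => hy.1)
  exact Real.rpow_le_rpow ht.le (hy.2.le.trans (le_max_left _ _)) hq.le

/-- Higher integrability gained from the energy on the set where `w ≥ 1`. -/
lemma exists_superlevel_mass_le (n : ℕ) (hn : 0 < n) {s p β q : ℝ} (hs : 0 < s) (hp : 1 < p)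
    (hβ : 0 < β) (hq : 0 < q) (hβq : q ≤ p - 1 - β + q * (s * p / n)) :
    ∃ κ₀ C : ℝ, 0 < κ₀ ∧ 0 < C ∧ ∀ κ r, 0 < κ → κ ≤ κ₀ → 0 < r → ∀ (w : Rn n → ℝ) (x₀ : Rn n),
      Measurable w → posMass n q x₀ r w ≤ ENNReal.ofReal (κ * r ^ n) →
      ∫⁻ x in {x ∈ ball x₀ (r / 4) | 1 ≤ w x}, ENNReal.ofReal ((w x) ^ q) ≤
        ENNReal.ofReal (C * κ ^ (s * p / n) * r ^ (s * p)) * posEnergy n s p β x₀ (r / 2) w := by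
  obtain ⟨ω, hω, hvol⟩ := exists_volume_ball n hn
  have hn0 : (0 : ℝ) < n := by exact_mod_cast hn
  set cβ : ℝ := ((4 / 3 : ℝ) ^ β - 1) * 2 ^ (-β) with hcβ
  have hcβ0 : 0 < cβ := by
    have : (1 : ℝ) < (4 / 3 : ℝ) ^ β := Real.one_lt_rpow (by norm_num) hβ
    have : (0 : ℝ) < 2 ^ (-β) := by positivity
    rw [hcβ]; apply mul_pos <;> linarith
  -- the radius is `ρ = r * (L κ)^(1/n) * w^(-q/n)`
  set L : ℝ := 2 * 2 ^ q / ω with hL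
  have hL0 : 0 < L := by positivity
  refine ⟨(1 / 4) ^ n / L, 2 ^ (p - 1) * cβ⁻¹ * (2 / ω) * L ^ (s * p / n), by positivity,
    by positivity, ?_⟩
  intro κ r hκ hκ0 hr w x₀ hw hM
  have hmA : MeasurableSet {x ∈ ball x₀ (r / 4) | 1 ≤ w x} :=
    measurableSet_ball.inter (measurableSet_le measurable_const hw)
  have hpt : ∀ x ∈ {x ∈ ball x₀ (r / 4) | 1 ≤ w x}, ENNReal.ofReal ((w x) ^ q) ≤
      ENNReal.ofReal (2 ^ (p - 1) * cβ⁻¹ * (2 / ω) * L ^ (s * p / n) *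
        κ ^ (s * p / n) * r ^ (s * p)) *
      ∫⁻ y in ball x₀ (r / 2), ENNReal.ofReal ((max (w x - w y) 0) ^ (p - 1) *
      max (trunc β (max (w x) 0) - trunc β (max (w y) 0)) 0 *
        (‖x - y‖ ^ ((n : ℝ) + s * p))⁻¹) := by
    rintro x ⟨hxB, hx1⟩
    have hx0 : 0 < w x := by linarith
    set ρ : ℝ := r * (L * κ) ^ (1 / (n : ℝ)) * (w x) ^ (-(q / n)) with hρ
    have hρ0 : 0 < ρ := by positivity
    have hρn : ρ ^ n = r ^ n * (L * κ) * (w x) ^ (-q) := by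
      rw [hρ, mul_pow, mul_pow, ← Real.rpow_natCast ((L * κ) ^ (1 / (n : ℝ))) n,
        ← Real.rpow_mul (by positivity), ← Real.rpow_natCast ((w x) ^ (-(q / n))) n,
        ← Real.rpow_mul hx0.le]
      congr 2
      · rw [one_div, inv_mul_cancel₀ hn0.ne', Real.rpow_one]
      · field_simp
    have hρr : ρ ≤ r / 4 := by
      have h1 : (w x) ^ (-(q / n)) ≤ 1 := Real.rpow_le_one_of_one_le_of_nonpos hx1
        (by have := div_pos hq hn0; linarith)
      have h2 : (L * κ) ^ (1 / (n : ℝ)) ≤ 1 / 4 := by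
        have : L * κ ≤ (1 / 4) ^ n := by
          rw [le_div_iff₀ hL0] at hκ0; linarith
        calc (L * κ) ^ (1 / (n : ℝ)) ≤ ((1 / 4 : ℝ) ^ n) ^ (1 / (n : ℝ)) := by gcongr
          _ = 1 / 4 := by
            rw [one_div (n : ℝ)]; exact Real.pow_rpow_inv_natCast (by norm_num) hn.ne'
      calc ρ = r * ((L * κ) ^ (1 / (n : ℝ)) * (w x) ^ (-(q / n))) := by rw [hρ]; ring
        _ ≤ r * ((1 / 4) * 1) := by gcongr
        _ = r / 4 := by ring
    set S : Set (Rn n) := {y ∈ ball x ρ | w y ≤ w x / 2} with hS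
    have hSm : MeasurableSet S := measurableSet_ball.inter (measurableSet_le hw measurable_const)
    have hballs : ball x ρ ⊆ ball x₀ (r / 2) := by
      refine ball_subset_ball' ?_
      have := mem_ball.1 hxB
      linarith
    have hSv : ENNReal.ofReal (ω * ρ ^ n / 2) ≤ volume S := by
      have hcov : ball x ρ ⊆ S ∪ {y ∈ ball x₀ r | w x / 2 < w y} := by
        intro y hy
        by_cases h : w y ≤ w x / 2
        · exact Or.inl ⟨hy, h⟩
        · exact Or.inr ⟨ball_subset_ball (by linarith) (hballs hy), not_le.1 h⟩
      have hb : volume {y ∈ ball x₀ r | w x / 2 < w y} ≤ ENNReal.ofReal (ω * ρ ^ n / 2) := by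
        have h1 := (volume_superlevel_le hq (half_pos hx0) hw x₀ r).trans hM
        have h2 : (0 : ℝ) < (w x / 2) ^ q := by positivity
        have h3 : ω * ρ ^ n / 2 = κ * r ^ n / (w x / 2) ^ q := by
          rw [hρn, hL, Real.rpow_neg hx0.le, Real.div_rpow hx0.le (by norm_num)]
          field_simp
        rw [h3, ENNReal.ofReal_div_of_pos h2, ENNReal.le_div_iff_mul_le
          (Or.inl (by simpa using h2)) (Or.inl ENNReal.ofReal_ne_top), mul_comm]
        exact h1
      have h4 := (measure_mono hcov).trans (measure_union_le (μ := volume) _ _)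
      rw [hvol x ρ hρ0] at h4
      have h5 : ENNReal.ofReal (ω * ρ ^ n) =
          ENNReal.ofReal (ω * ρ ^ n / 2) + ENNReal.ofReal (ω * ρ ^ n / 2) := by
        rw [← ENNReal.ofReal_add (by positivity) (by positivity)]; ring_nf
      rw [h5] at h4
      exact (ENNReal.add_le_add_iff_right ENNReal.ofReal_ne_top).1
        (h4.trans (add_le_add le_rfl hb))
    have hin := mul_volume_le_posEnergy_inner (s := s) (p := p) (β := β) (x := x) (x₀ := x₀)
      (ρ := r / 2) (w := w) (b := (w x / 2) ^ (p - 1) * (cβ * (w x) ^ (-β)) *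
        (ρ ^ ((n : ℝ) + s * p))⁻¹) hSm (fun y hy => hballs hy.1) (by
        rintro y ⟨hy, hyx⟩
        have hg : cβ * (w x) ^ (-β) ≤ trunc β (max (w x) 0) - trunc β (max (w y) 0) := by
          rw [max_eq_left hx0.le]
          refine (trunc_half_gap hβ hx1).trans ?_
          have : trunc β (max (w y) 0) ≤ trunc β (w x / 2) :=
            trunc_mono hβ (le_max_right _ _) (max_le hyx (by positivity))
          linarith
        have h0 : 0 ≤ cβ * (w x) ^ (-β) := by positivity
        by_cases hxy : x = y
        · exfalso; rw [← hxy] at hyx; linarith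
        have hxy' : 0 < ‖x - y‖ := norm_pos_iff.2 (sub_ne_zero.2 hxy)
        have hd : ‖x - y‖ ≤ ρ := by
          rw [← dist_eq_norm, dist_comm]; exact (mem_ball.1 hy).le
        gcongr
        · exact le_max_of_le_left (by linarith)
        · exact le_max_of_le_left hg)
    calc ENNReal.ofReal ((w x) ^ q)
        ≤ ENNReal.ofReal (2 ^ (p - 1) * cβ⁻¹ * (2 / ω) * L ^ (s * p / n) * κ ^ (s * p / n) *
            r ^ (s * p)) * (ENNReal.ofReal ((w x / 2) ^ (p - 1) * (cβ * (w x) ^ (-β)) *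
        (ρ ^ ((n : ℝ) + s * p))⁻¹) * ENNReal.ofReal (ω * ρ ^ n / 2)) := by
          rw [← ENNReal.ofReal_mul (by positivity), ← ENNReal.ofReal_mul (by positivity)]
          refine ENNReal.ofReal_le_ofReal ?_
          have e1 : (ρ ^ ((n : ℝ) + s * p))⁻¹ * (ω * ρ ^ n / 2) =
              ω / 2 * (r ^ (s * p) * (L ^ (s * p / n) * κ ^ (s * p / n)) *
                (w x) ^ (-(q * (s * p / n))))⁻¹ := by
            have : ρ ^ (s * p) = r ^ (s * p) * (L ^ (s * p / n) * κ ^ (s * p / n)) *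
                (w x) ^ (-(q * (s * p / n))) := by
              rw [hρ, Real.mul_rpow (by positivity) (by positivity),
                Real.mul_rpow (by positivity) (by positivity), ← Real.rpow_mul (by positivity),
                ← Real.rpow_mul hx0.le, ← Real.mul_rpow hL0.le hκ.le]
              congr 2
              · rw [one_div_mul_eq_div]
              · ring_nf
            rw [← this, Real.rpow_add hρ0, Real.rpow_natCast]
            field_simp
          have e2 : (w x) ^ q ≤ (w x) ^ (p - 1) * (w x) ^ (-β) * (w x) ^ (q * (s * p / n)) := by
            rw [← Real.rpow_add hx0, ← Real.rpow_add hx0]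
            exact Real.rpow_le_rpow_of_exponent_le hx1 (by linarith)
          refine e2.trans (le_of_eq ?_)
          rw [mul_assoc ((w x / 2) ^ (p - 1) * (cβ * (w x) ^ (-β))), e1,
            Real.div_rpow hx0.le (by norm_num), Real.rpow_neg hx0.le (q * (s * p / n))]
          field_simp
      _ ≤ _ := by gcongr; exact (mul_le_mul_right hSv _).trans hin
  calc _ ≤ ∫⁻ x in {x ∈ ball x₀ (r / 4) | 1 ≤ w x},
        ENNReal.ofReal (2 ^ (p - 1) * cβ⁻¹ * (2 / ω) * L ^ (s * p / n) * κ ^ (s * p / n) *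
            r ^ (s * p)) *
      ∫⁻ y in ball x₀ (r / 2), ENNReal.ofReal ((max (w x - w y) 0) ^ (p - 1) *
      max (trunc β (max (w x) 0) - trunc β (max (w y) 0)) 0 *
        (‖x - y‖ ^ ((n : ℝ) + s * p))⁻¹) := setLIntegral_mono' hmA hpt
    _ ≤ ∫⁻ x in ball x₀ (r / 2),
        ENNReal.ofReal (2 ^ (p - 1) * cβ⁻¹ * (2 / ω) * L ^ (s * p / n) * κ ^ (s * p / n) *
            r ^ (s * p)) *
      ∫⁻ y in ball x₀ (r / 2), ENNReal.ofReal ((max (w x - w y) 0) ^ (p - 1) *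
      max (trunc β (max (w x) 0) - trunc β (max (w y) 0)) 0 *
        (‖x - y‖ ^ ((n : ℝ) + s * p))⁻¹) :=
        lintegral_mono_set fun x hx => ball_subset_ball (by linarith) hx.1
    _ = _ := by rw [lintegral_const_mul' _ _ ENNReal.ofReal_ne_top, posEnergy]

/-- Smallness of the positive part of `(u - a) / d`, locally and in the tail. -/
def SmallAt (n : ℕ) (s p q κ : ℝ) (u : Rn n → ℝ) (y : Rn n) (r a d : ℝ) : Prop :=
  posMass n q y r (fun x => (u x - a) / d) ≤ ENNReal.ofReal (κ * r ^ n) ∧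
    posTail n s p y r (fun x => (u x - a) / d) ≤ ENNReal.ofReal (κ * r ^ (-(s * p)))

lemma max_sub_rpow_le {U t t' : ℝ} (ht : 0 < t) (htt' : t ≤ t') :
    (max (2 * (U - 1)) 0) ^ t ≤ 2 ^ t * (max U 0) ^ t' := by
  by_cases hU : 1 ≤ U
  · have h0 : 0 ≤ U := by linarith
    rw [max_eq_left (by linarith), max_eq_left h0, Real.mul_rpow (by norm_num) (by linarith)]
    gcongr
    exact (Real.rpow_le_rpow (by linarith) (by linarith) ht.le).trans
      (Real.rpow_le_rpow_of_exponent_le hU htt')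
  · rw [max_eq_right (by linarith), Real.zero_rpow ht.ne']
    positivity

lemma exists_smallAt_step (n : ℕ) (hn : 0 < n) {s p β q : ℝ} (hs : 0 < s) (hp : 1 < p)
    (hβ : 0 < β) (hpq : p - 1 ≤ q) (hβq : q ≤ p - 1 - β + q * (s * p / n)) (C : ℝ≥0) :
    ∃ σ κ : ℝ, 0 < σ ∧ σ ≤ 1 / 8 ∧ 0 < κ ∧ ∀ (Ω : Set (Rn n)) (ν : Measure (Rn n)) (u : Rn n → ℝ),
      Measurable u → LevelIneq n s p β q C ν Ω u → ∀ (y : Rn n) (r a d : ℝ), 0 < r → 0 < d →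
      closedBall y r ⊆ Ω → SmallAt n s p q κ u y r a d →
      ν (closedBall y r) ≤ ENNReal.ofReal (κ * d ^ (p - 1) * r ^ ((n : ℝ) - s * p)) →
      SmallAt n s p q κ u y (σ * r) (a + d) (d / 2) := by
  have hp1 : 0 < p - 1 := by linarith
  have hq : 0 < q := by linarith
  have hn0 : (0 : ℝ) < n := by exact_mod_cast hn
  have hsp : 0 < s * p := by positivity
  have hspn : 0 < s * p / n := by positivity
  obtain ⟨κ₀, C₁, hκ₀, hC₁, hI⟩ := exists_superlevel_mass_le n hn hs hp hβ hq hβq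
  set C₂ : ℝ := C₁ * (3 * C) + 1 with hC₂
  have hC₂0 : 0 < C₂ := by positivity
  set α : ℝ := (n : ℝ) + s * p with hα
  have hα0 : 0 < α := by positivity
  obtain ⟨σ, hσ0, hσ8, hσ⟩ : ∃ σ : ℝ, 0 < σ ∧ σ ≤ 1 / 8 ∧
      2 ^ (p - 1) * (2 + 4 ^ α) * σ ^ (s * p) ≤ 1 := by
    have h1 : Tendsto (fun σ : ℝ => 2 ^ (p - 1) * (2 + 4 ^ α) * σ ^ (s * p)) (𝓝[>] 0)
        (𝓝 (2 ^ (p - 1) * (2 + 4 ^ α) * 0)) := by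
      refine Tendsto.const_mul _ ?_
      have := (Real.continuousAt_rpow_const 0 (s * p) (Or.inr hsp.le)).tendsto
      rw [Real.zero_rpow hsp.ne'] at this
      exact this.mono_left nhdsWithin_le_nhds
    rw [mul_zero] at h1
    obtain ⟨σ, ⟨h2, h3⟩, h4⟩ := ((h1.eventually_le_const (zero_lt_one)).and
      (Ioc_mem_nhdsGT (show (0 : ℝ) < 1 / 8 by norm_num))).and self_mem_nhdsWithin |>.exists
    exact ⟨σ, h4, h3.2, h2⟩
  obtain ⟨κ, hκ0, hκκ, hκ1, hκ2⟩ : ∃ κ : ℝ, 0 < κ ∧ κ ≤ κ₀ ∧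
      2 ^ q * C₂ * κ ^ (s * p / n) ≤ σ ^ n ∧ σ ^ (-α) * C₂ * κ ^ (s * p / n) ≤ 1 := by
    have h1 : ∀ c : ℝ, Tendsto (fun κ : ℝ => c * κ ^ (s * p / n)) (𝓝[>] 0) (𝓝 0) := by
      intro c
      have := (Real.continuousAt_rpow_const 0 (s * p / n) (Or.inr hspn.le)).tendsto
      rw [Real.zero_rpow hspn.ne'] at this
      simpa using (this.mono_left nhdsWithin_le_nhds).const_mul c
    obtain ⟨κ, ⟨⟨h2, h3⟩, h4⟩, h5⟩ := ((((h1 (2 ^ q * C₂)).eventually_le_const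
      (show 0 < σ ^ n by positivity)).and ((h1 (σ ^ (-α) * C₂)).eventually_le_const
      (zero_lt_one))).and (Ioc_mem_nhdsGT hκ₀)).and self_mem_nhdsWithin |>.exists
    exact ⟨κ, h5, h4.2, h2, h3⟩
  refine ⟨σ, κ, hσ0, hσ8, hκ0, ?_⟩
  intro Ω ν u hu hL y r a d hr hd hball hsm hν
  obtain ⟨hM, hT⟩ := hsm
  set U : Rn n → ℝ := fun x => (u x - a) / d with hU
  have hUm : Measurable U := by simp only [hU]; fun_prop
  have hU' : ∀ x, (u x - (a + d)) / (d / 2) = 2 * (U x - 1) := fun x => by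
    simp only [hU]; field_simp; ring
  have hE : posEnergy n s p β y (r / 2) U ≤ ENNReal.ofReal (3 * C * κ * r ^ ((n : ℝ) - s * p)) := by
    have e1 : r ^ (-(s * p)) * (κ * r ^ n) = κ * r ^ ((n : ℝ) - s * p) := by
      rw [sub_eq_add_neg, Real.rpow_add hr, Real.rpow_natCast]; ring
    have e2 : r ^ n * (κ * r ^ (-(s * p))) = κ * r ^ ((n : ℝ) - s * p) := by
      rw [sub_eq_add_neg, Real.rpow_add hr, Real.rpow_natCast]; ring
    have e3 : (d ^ (p - 1))⁻¹ * (κ * d ^ (p - 1) * r ^ ((n : ℝ) - s * p)) =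
        κ * r ^ ((n : ℝ) - s * p) := by field_simp
    calc _ ≤ C * (ENNReal.ofReal (r ^ (-(s * p))) * ENNReal.ofReal (κ * r ^ n) +
          ENNReal.ofReal (r ^ n) * ENNReal.ofReal (κ * r ^ (-(s * p))) +
          ENNReal.ofReal (d ^ (p - 1))⁻¹ *
            ENNReal.ofReal (κ * d ^ (p - 1) * r ^ ((n : ℝ) - s * p))) := by
          refine (hL y r a d hr hd hball).trans ?_
          gcongr
      _ = _ := by
          rw [← ENNReal.ofReal_mul (by positivity), ← ENNReal.ofReal_mul (by positivity),
            ← ENNReal.ofReal_mul (by positivity), e1, e2, e3,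
            ← ENNReal.ofReal_add (by positivity) (by positivity),
            ← ENNReal.ofReal_add (by positivity) (by positivity), ← ENNReal.ofReal_coe_nnreal,
            ← ENNReal.ofReal_mul (by positivity)]
          congr 1; ring
  have hIr : ∫⁻ x in {x ∈ ball y (r / 4) | 1 ≤ U x}, ENNReal.ofReal ((U x) ^ q) ≤
      ENNReal.ofReal (C₂ * κ ^ (s * p / n) * κ * r ^ n) := by
    refine (hI κ r hκ0 hκκ hr U y hUm hM).trans ((mul_le_mul_right hE _).trans ?_)
    rw [← ENNReal.ofReal_mul (by positivity)]
    refine ENNReal.ofReal_le_ofReal ?_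
    have : r ^ (s * p) * r ^ ((n : ℝ) - s * p) = r ^ n := by
      rw [← Real.rpow_add hr, ← Real.rpow_natCast]; congr 1; ring
    calc _ = C₁ * (3 * C) * κ ^ (s * p / n) * κ * (r ^ (s * p) * r ^ ((n : ℝ) - s * p)) := by ring
      _ ≤ C₂ * κ ^ (s * p / n) * κ * (r ^ (s * p) * r ^ ((n : ℝ) - s * p)) := by
        gcongr; linarith
      _ = _ := by rw [this]
  have hmA : MeasurableSet {x | 1 ≤ U x} := measurableSet_le measurable_const hUm
  have hpart : ∀ t, 0 < t → t ≤ q →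
      ∫⁻ x in ball y (r / 4), ENNReal.ofReal ((max (2 * (U x - 1)) 0) ^ t) ≤
      ENNReal.ofReal (2 ^ t * (C₂ * κ ^ (s * p / n) * κ * r ^ n)) := by
    intro t ht htq
    rw [ENNReal.ofReal_mul (by positivity)]
    calc _ ≤ ∫⁻ x in ball y (r / 4), {x | 1 ≤ U x}.indicator
          (fun x => ENNReal.ofReal (2 ^ t) * ENNReal.ofReal ((U x) ^ q)) x := by
          refine lintegral_mono fun x => ?_
          by_cases h : 1 ≤ U x
          · rw [indicator_of_mem (show x ∈ {x | 1 ≤ U x} from h),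
            ← ENNReal.ofReal_mul (by positivity)]
            refine ENNReal.ofReal_le_ofReal ((max_sub_rpow_le ht htq).trans ?_)
            rw [max_eq_left (by linarith)]
          · rw [indicator_of_notMem (show x ∉ {x | 1 ≤ U x} from h), max_eq_right (by linarith),
              Real.zero_rpow ht.ne', ENNReal.ofReal_zero]
      _ = ENNReal.ofReal (2 ^ t) *
          ∫⁻ x in {x ∈ ball y (r / 4) | 1 ≤ U x}, ENNReal.ofReal ((U x) ^ q) := by
          rw [setLIntegral_indicator hmA,
            lintegral_const_mul' _ _ ENNReal.ofReal_ne_top, inter_comm]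
          rfl
      _ ≤ _ := by gcongr
  refine ⟨?_, ?_⟩
  · simp only [hU', posMass]
    refine (lintegral_mono_set (ball_subset_ball (by nlinarith : σ * r ≤ r / 4))).trans
      ((hpart q hq le_rfl).trans (ENNReal.ofReal_le_ofReal ?_))
    rw [mul_pow]
    calc _ = (2 ^ q * C₂ * κ ^ (s * p / n)) * (κ * r ^ n) := by ring
      _ ≤ σ ^ n * (κ * r ^ n) := by gcongr
      _ = _ := by ring
  · simp only [hU', posTail]
    have hcov : (ball y (σ * r))ᶜ ⊆ (ball y r)ᶜ ∪
        ((ball y r ∩ (ball y (r / 4))ᶜ) ∪ (ball y (r / 4) ∩ (ball y (σ * r))ᶜ)) := by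
      intro x hx
      by_cases h1 : x ∈ ball y r
      · by_cases h2 : x ∈ ball y (r / 4)
        · exact Or.inr (Or.inr ⟨h2, hx⟩)
        · exact Or.inr (Or.inl ⟨h1, h2⟩)
      · exact Or.inl h1
    have hnorm : ∀ ρ x, 0 < ρ → x ∉ ball y ρ → (‖x - y‖ ^ α)⁻¹ ≤ ρ ^ (-α) := by
      intro ρ x hρ hx
      rw [mem_ball, not_lt, dist_eq_norm] at hx
      rw [Real.rpow_neg hρ.le]
      gcongr
    have hsh : ∀ ρ : ℝ, 0 < ρ → ∀ S : Set (Rn n), MeasurableSet S →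
        ∫⁻ x in S ∩ (ball y ρ)ᶜ, ENNReal.ofReal ((max (2 * (U x - 1)) 0) ^ (p - 1) *
          (‖x - y‖ ^ α)⁻¹) ≤ ENNReal.ofReal (ρ ^ (-α)) *
          ∫⁻ x in S, ENNReal.ofReal ((max (2 * (U x - 1)) 0) ^ (p - 1)) := by
      intro ρ hρ S hS
      calc _ ≤ ∫⁻ x in S ∩ (ball y ρ)ᶜ, ENNReal.ofReal (ρ ^ (-α)) *
            ENNReal.ofReal ((max (2 * (U x - 1)) 0) ^ (p - 1)) := by
            refine setLIntegral_mono' (hS.inter measurableSet_ball.compl) fun x hx => ?_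
            rw [← ENNReal.ofReal_mul (by positivity), mul_comm (ρ ^ (-α))]
            have := hnorm ρ x hρ hx.2
            gcongr
        _ ≤ _ := by
            rw [lintegral_const_mul' _ _ ENNReal.ofReal_ne_top]
            exact mul_le_mul_right (lintegral_mono_set inter_subset_left) _
    have t1 : ∫⁻ x in (ball y r)ᶜ, ENNReal.ofReal ((max (2 * (U x - 1)) 0) ^ (p - 1) *
          (‖x - y‖ ^ α)⁻¹) ≤ ENNReal.ofReal (2 ^ (p - 1) * (κ * r ^ (-(s * p)))) := by
      rw [ENNReal.ofReal_mul (by positivity)]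
      refine le_trans ?_ (mul_le_mul_right hT _)
      rw [posTail, ← lintegral_const_mul' _ _ ENNReal.ofReal_ne_top]
      refine lintegral_mono fun x => ?_
      rw [← ENNReal.ofReal_mul (by positivity), ← mul_assoc]
      refine ENNReal.ofReal_le_ofReal ?_
      gcongr
      exact max_sub_rpow_le hp1 le_rfl
    have t2 : ∫⁻ x in ball y r ∩ (ball y (r / 4))ᶜ,
        ENNReal.ofReal ((max (2 * (U x - 1)) 0) ^ (p - 1) * (‖x - y‖ ^ α)⁻¹) ≤
        ENNReal.ofReal ((r / 4) ^ (-α) * (2 ^ (p - 1) * (κ * r ^ n))) := by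
      refine (hsh (r / 4) (by positivity) _ measurableSet_ball).trans ?_
      rw [ENNReal.ofReal_mul (by positivity), ENNReal.ofReal_mul (by positivity)]
      refine mul_le_mul_right (le_trans ?_ (mul_le_mul_right hM _)) _
      rw [posMass, ← lintegral_const_mul' _ _ ENNReal.ofReal_ne_top]
      refine lintegral_mono fun x => ?_
      rw [← ENNReal.ofReal_mul (by positivity)]
      exact ENNReal.ofReal_le_ofReal (max_sub_rpow_le hp1 hpq)
    have t3 : ∫⁻ x in ball y (r / 4) ∩ (ball y (σ * r))ᶜ,
        ENNReal.ofReal ((max (2 * (U x - 1)) 0) ^ (p - 1) * (‖x - y‖ ^ α)⁻¹) ≤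
        ENNReal.ofReal ((σ * r) ^ (-α) * (2 ^ (p - 1) * (C₂ * κ ^ (s * p / n) * κ * r ^ n))) := by
      refine (hsh (σ * r) (by positivity) _ measurableSet_ball).trans ?_
      rw [ENNReal.ofReal_mul (by positivity)]
      exact mul_le_mul_right (hpart (p - 1) hp1 hpq) _
    have e1 : ∀ c : ℝ, 0 < c → (c * r) ^ (-α) * r ^ n = c ^ (-α) * r ^ (-(s * p)) := by
      intro c hc
      rw [Real.mul_rpow hc.le hr.le, mul_assoc, ← Real.rpow_natCast, ← Real.rpow_add hr, hα]
      congr 2; ring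
    refine (lintegral_mono_set hcov).trans ((lintegral_union_le _ _ _).trans
      ((add_le_add t1 ((lintegral_union_le _ _ _).trans (add_le_add t2 t3))).trans ?_))
    rw [← ENNReal.ofReal_add (by positivity) (by positivity),
      ← ENNReal.ofReal_add (by positivity) (by positivity)]
    refine ENNReal.ofReal_le_ofReal ?_
    have e2 : (r / 4) ^ (-α) * r ^ n = 4 ^ α * r ^ (-(s * p)) := by
      rw [div_eq_inv_mul, e1 _ (by norm_num), Real.inv_rpow (by norm_num),
        Real.rpow_neg (by norm_num), inv_inv]
    calc _ = 2 ^ (p - 1) * (κ * r ^ (-(s * p))) +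
          (2 ^ (p - 1) * κ * ((r / 4) ^ (-α) * r ^ n) +
          2 ^ (p - 1) * κ * (C₂ * κ ^ (s * p / n)) * ((σ * r) ^ (-α) * r ^ n)) := by ring
      _ = 2 ^ (p - 1) * (κ * r ^ (-(s * p))) *
          (1 + 4 ^ α + σ ^ (-α) * C₂ * κ ^ (s * p / n)) := by rw [e1 _ hσ0, e2]; ring
      _ ≤ 2 ^ (p - 1) * (κ * r ^ (-(s * p))) * (1 + 4 ^ α + 1) := by gcongr
      _ = (2 ^ (p - 1) * (2 + 4 ^ α) * σ ^ (s * p)) *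
          (κ * (σ ^ (-(s * p)) * r ^ (-(s * p)))) := by
          rw [Real.rpow_neg hσ0.le]; field_simp; ring
      _ ≤ 1 * (κ * (σ ^ (-(s * p)) * r ^ (-(s * p)))) := by gcongr
      _ = _ := by rw [Real.mul_rpow hσ0.le hr.le, one_mul]

lemma wolff_term_le (n : ℕ) (s : ℝ) {p : ℝ} (hp : 1 < p) (ν : Measure (Rn n)) (y : Rn n) {ρ : ℝ}
    (hρ : 0 < ρ) :
    (ν (closedBall y ρ) / ENNReal.ofReal (ρ ^ ((n : ℝ) - s * p))) ^ (1 / (p - 1)) ≤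
      ENNReal.ofReal (2 * (2 ^ |(n : ℝ) - s * p|) ^ (1 / (p - 1))) *
        ∫⁻ t in Ioc ρ (2 * ρ), (ν (ball y t) / ENNReal.ofReal (t ^ ((n : ℝ) - s * p))) ^
          (1 / (p - 1)) / ENNReal.ofReal t := by
  have hp1 : 0 < 1 / (p - 1) := by apply one_div_pos.2; linarith
  set m : ℝ := (n : ℝ) - s * p with hm
  set X := (ν (closedBall y ρ) / ENNReal.ofReal (ρ ^ m)) ^ (1 / (p - 1)) with hX
  set c : ℝ := (2 ^ |m|) ^ (1 / (p - 1)) with hc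
  have hc0 : 0 < c := by positivity
  have hpt : ∀ t ∈ Ioc ρ (2 * ρ), ENNReal.ofReal (2 * c * ρ)⁻¹ * X ≤
      (ν (ball y t) / ENNReal.ofReal (t ^ m)) ^ (1 / (p - 1)) / ENNReal.ofReal t := by
    rintro t ⟨ht, ht2⟩
    have ht0 : 0 < t := hρ.trans ht
    have h1 : t ^ m ≤ 2 ^ |m| * ρ ^ m := by
      rcases le_total 0 m with h | h
      · rw [abs_of_nonneg h, ← Real.mul_rpow (by norm_num) hρ.le]
        gcongr
      · have : t ^ m ≤ ρ ^ m := Real.rpow_le_rpow_of_nonpos hρ ht.le h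
        have h2 : (1 : ℝ) ≤ 2 ^ |m| := Real.one_le_rpow (by norm_num) (abs_nonneg m)
        exact this.trans (le_mul_of_one_le_left (by positivity) h2)
    have h2 : X ≤ ENNReal.ofReal c * (ν (ball y t) / ENNReal.ofReal (t ^ m)) ^ (1 / (p - 1)) := by
      rw [hX, hc, ← ENNReal.ofReal_rpow_of_nonneg (by positivity) hp1.le,
        ← ENNReal.mul_rpow_of_nonneg _ _ hp1.le]
      refine ENNReal.rpow_le_rpow ?_ hp1.le
      rw [ENNReal.div_le_iff_le_mul (Or.inl (by simp; positivity)) (Or.inl ENNReal.ofReal_ne_top)]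
      calc ν (closedBall y ρ) ≤ ν (ball y t) := measure_mono (closedBall_subset_ball ht)
        _ = (ν (ball y t) / ENNReal.ofReal (t ^ m)) * ENNReal.ofReal (t ^ m) :=
          (ENNReal.div_mul_cancel (by simp; positivity) ENNReal.ofReal_ne_top).symm
        _ ≤ (ν (ball y t) / ENNReal.ofReal (t ^ m)) * ENNReal.ofReal (2 ^ |m| * ρ ^ m) := by gcongr
        _ = _ := by rw [ENNReal.ofReal_mul (by positivity)]; ring
    rw [ENNReal.div_eq_inv_mul]
    calc _ ≤ ENNReal.ofReal (2 * c * ρ)⁻¹ * (ENNReal.ofReal c *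
          (ν (ball y t) / ENNReal.ofReal (t ^ m)) ^ (1 / (p - 1))) := by gcongr
      _ = ENNReal.ofReal (2 * ρ)⁻¹ * (ν (ball y t) / ENNReal.ofReal (t ^ m)) ^ (1 / (p - 1)) := by
          rw [← mul_assoc, ← ENNReal.ofReal_mul (by positivity)]
          congr 2; field_simp
      _ ≤ _ := by
          rw [← ENNReal.ofReal_inv_of_pos ht0]
          gcongr
  have hint := setLIntegral_mono' (μ := volume) measurableSet_Ioc hpt
  rw [setLIntegral_const, Real.volume_Ioc] at hint
  calc X = ENNReal.ofReal (2 * c) * (ENNReal.ofReal (2 * c * ρ)⁻¹ * X *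
        ENNReal.ofReal (2 * ρ - ρ)) := by
        rw [mul_assoc, mul_comm X, ← mul_assoc, ← mul_assoc, ← ENNReal.ofReal_mul (by positivity),
          ← ENNReal.ofReal_mul (by positivity)]
        have : 2 * c * (2 * c * ρ)⁻¹ * (2 * ρ - ρ) = 1 := by field_simp; ring
        rw [this, ENNReal.ofReal_one, one_mul]
    _ ≤ _ := by gcongr

lemma sum_wolff_term_le (n : ℕ) (s : ℝ) {p : ℝ} (hp : 1 < p) (ν : Measure (Rn n)) (y : Rn n)
    {r σ : ℝ} (hr : 0 < r) (hσ : 0 < σ) (hσ1 : σ ≤ 1 / 2) (N : ℕ) :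
    ∑ i ∈ Finset.range N, (ν (closedBall y (σ ^ i * r)) /
        ENNReal.ofReal ((σ ^ i * r) ^ ((n : ℝ) - s * p))) ^ (1 / (p - 1)) ≤
      ENNReal.ofReal (2 * (2 ^ |(n : ℝ) - s * p|) ^ (1 / (p - 1))) * wolff n s p ν y (2 * r) := by
  refine (Finset.sum_le_sum fun i _ => wolff_term_le n s hp ν y
    (show 0 < σ ^ i * r by positivity)).trans ?_
  rw [← Finset.mul_sum]
  gcongr
  rw [← lintegral_biUnion_finset ?_ fun _ _ => measurableSet_Ioc]
  · refine lintegral_mono_set (iUnion₂_subset fun i _ => ?_)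
    have : σ ^ i ≤ 1 := pow_le_one₀ hσ.le (by linarith)
    refine Ioc_subset_Ioc (by positivity) ?_
    nlinarith
  · have key : ∀ i j : ℕ, i < j → Disjoint (Ioc (σ ^ i * r) (2 * (σ ^ i * r)))
        (Ioc (σ ^ j * r) (2 * (σ ^ j * r))) := by
      intro i j hij
      have h1 : σ ^ j ≤ σ ^ (i + 1) := pow_le_pow_of_le_one hσ.le (by linarith) hij
      have h2 : 2 * (σ ^ j * r) ≤ σ ^ i * r := by
        have : σ ^ j ≤ σ ^ i * (1 / 2) := h1.trans (by rw [pow_succ]; gcongr)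
        nlinarith
      rw [Set.disjoint_left]
      rintro t ⟨ht, _⟩ ⟨_, ht'⟩
      linarith
    intro i _ j _ hij
    rcases lt_or_gt_of_ne hij with h | h
    · exact key i j h
    · exact (key j i h).symm

lemma SmallAt.mono {n : ℕ} {s p q κ : ℝ} {u : Rn n → ℝ} {y : Rn n} {r a d d' : ℝ} (hp : 1 < p)
    (hq : 0 < q) (h : SmallAt n s p q κ u y r a d) (hd : 0 < d) (hdd : d ≤ d') :
    SmallAt n s p q κ u y r a d' := by
  have key : ∀ x, max ((u x - a) / d') 0 ≤ max ((u x - a) / d) 0 := by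
    intro x
    rcases le_total 0 (u x - a) with h0 | h0
    · exact max_le_max_right 0 (by gcongr)
    · rw [max_eq_right (div_nonpos_of_nonpos_of_nonneg h0 (hd.le.trans hdd))]
      exact le_max_right _ _
  refine ⟨le_trans (lintegral_mono fun x => ENNReal.ofReal_le_ofReal ?_) h.1,
    le_trans (lintegral_mono fun x => ENNReal.ofReal_le_ofReal ?_) h.2⟩
  · exact Real.rpow_le_rpow (le_max_right _ _) (key x) hq.le
  · exact mul_le_mul_of_nonneg_right (Real.rpow_le_rpow (le_max_right _ _) (key x) (by linarith))
      (by positivity)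

lemma exists_pointwise_iteration (n : ℕ) (hn : 0 < n) {s p β q : ℝ} (hs : 0 < s) (hp : 1 < p)
    (hβ : 0 < β) (hpq : p - 1 ≤ q) (hβq : q ≤ p - 1 - β + q * (s * p / n)) (C : ℝ≥0) :
    ∃ σ κ Cw : ℝ, 0 < σ ∧ σ ≤ 1 / 8 ∧ 0 < κ ∧ 0 < Cw ∧
      ∀ (Ω : Set (Rn n)) (ν : Measure (Rn n)) [IsFiniteMeasure ν] (u : Rn n → ℝ),
      Measurable u → LevelIneq n s p β q C ν Ω u → ∀ (y : Rn n) (r a d : ℝ), 0 < r → 0 < d →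
      closedBall y r ⊆ Ω → SmallAt n s p q κ u y r a d →
      ENNReal.ofReal Cw * wolff n s p ν y (2 * r) ≤ ENNReal.ofReal d →
      ∃ A D : ℕ → ℝ, Tendsto D atTop (𝓝 0) ∧ ∀ i, A i ≤ a + 4 * d ∧ 0 < D i ∧
        SmallAt n s p q κ u y (σ ^ i * r) (A i) (D i) := by
  obtain ⟨σ, κ, hσ0, hσ8, hκ, hstep⟩ := exists_smallAt_step n hn hs hp hβ hpq hβq C
  have hp1 : 0 < p - 1 := by linarith
  have hp1' : 0 < 1 / (p - 1) := one_div_pos.2 hp1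
  set c₀ : ℝ := 2 * (2 ^ |(n : ℝ) - s * p|) ^ (1 / (p - 1)) with hc₀
  have hc₀0 : 0 < c₀ := by positivity
  refine ⟨σ, κ, κ⁻¹ ^ (1 / (p - 1)) * c₀, hσ0, hσ8, hκ, by positivity, ?_⟩
  intro Ω ν _ u hu hL y r a d hr hd hball hsm hw
  set R : ℕ → ℝ := fun i => σ ^ i * r with hR
  have hR0 : ∀ i, 0 < R i := fun i => by positivity
  set X : ℕ → ℝ≥0∞ := fun i => (ν (closedBall y (R i)) /
    ENNReal.ofReal ((R i) ^ ((n : ℝ) - s * p))) ^ (1 / (p - 1)) with hX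
  have hden : ∀ i, ENNReal.ofReal ((R i) ^ ((n : ℝ) - s * p)) ≠ 0 := fun i => by
    have := hR0 i; simp; positivity
  have hXtop : ∀ i, X i ≠ ⊤ := fun i => ENNReal.rpow_ne_top_of_nonneg hp1'.le
    (ENNReal.div_ne_top (measure_ne_top _ _) (hden i))
  set W : ℕ → ℝ := fun i => κ⁻¹ ^ (1 / (p - 1)) * (X i).toReal with hW
  have hW0 : ∀ i, 0 ≤ W i := fun i => by positivity
  have hWpow : ∀ i, ν (closedBall y (R i)) = ENNReal.ofReal (κ * W i ^ (p - 1) *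
      R i ^ ((n : ℝ) - s * p)) := by
    intro i
    have h1 : κ * W i ^ (p - 1) = ((X i).toReal) ^ (p - 1) := by
      rw [hW, Real.mul_rpow (by positivity) (by positivity), ← Real.rpow_mul (by positivity),
        one_div, inv_mul_cancel₀ hp1.ne', Real.rpow_one]
      field_simp
    rw [h1, ENNReal.ofReal_mul (by positivity),
      ← ENNReal.ofReal_rpow_of_nonneg (by positivity) hp1.le,
      ENNReal.ofReal_toReal (hXtop i), hX, ← ENNReal.rpow_mul, one_div, inv_mul_cancel₀ hp1.ne',
      ENNReal.rpow_one, ENNReal.div_mul_cancel (hden i) ENNReal.ofReal_ne_top]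
  have hWsum : ∀ N, ∑ i ∈ Finset.range N, W i ≤ d := by
    intro N
    have h1 := sum_wolff_term_le n s hp ν y hr hσ0 (by linarith) N
    have h2 : ENNReal.ofReal (∑ i ∈ Finset.range N, W i) ≤ ENNReal.ofReal d := by
      refine le_trans ?_ hw
      rw [ENNReal.ofReal_mul (by positivity), mul_assoc, hW, ← Finset.mul_sum,
        ENNReal.ofReal_mul (by positivity), ENNReal.ofReal_sum_of_nonneg (fun _ _ => by positivity)]
      gcongr
      refine le_trans (le_of_eq (Finset.sum_congr rfl fun i _ => ?_)) h1
      exact ENNReal.ofReal_toReal (hXtop i)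
    exact (ENNReal.ofReal_le_ofReal_iff hd.le).1 h2
  let D : ℕ → ℝ := fun i => Nat.rec d (fun k x => x / 2 + W (k + 1)) i
  have hDs : ∀ i, D (i + 1) = D i / 2 + W (i + 1) := fun i => rfl
  set A : ℕ → ℝ := fun i => a + ∑ k ∈ Finset.range i, D k with hA
  have hAs : ∀ i, A (i + 1) = A i + D i := fun i => by
    rw [hA]; simp only [Finset.sum_range_succ]; ring
  have hD0 : ∀ i, 0 < D i := by
    intro i
    induction i with
    | zero => exact hd
    | succ k ih => rw [hDs]; have := hW0 (k + 1); linarith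
  have hinv : ∀ i, A i + 2 * D i ≤ a + 2 * d + 2 * ∑ k ∈ Finset.range (i + 1), W k := by
    intro i
    induction i with
    | zero => have := hW0 0; simp [hA, show D 0 = d from rfl, this]
    | succ k ih => rw [hAs, hDs, Finset.sum_range_succ]; linarith
  have hinv' : ∀ i, A i + 2 * D i ≤ a + 4 * d := fun i => by
    have := hinv i; have := hWsum (i + 1); linarith
  have hsumm : Summable D := by
    refine summable_of_sum_range_le (c := 4 * d) (fun i => (hD0 i).le) fun i => ?_
    have h1 := hinv' i
    have h2 := hD0 i
    simp only [hA] at h1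
    linarith
  refine ⟨A, D, hsumm.tendsto_atTop_zero, fun i => ⟨by have := hinv' i; have := hD0 i; linarith,
    hD0 i, ?_⟩⟩
  have hWD : ∀ i, W i ≤ D i := by
    intro i
    cases i with
    | zero => exact (by simpa using hWsum 1 : W 0 ≤ d)
    | succ k => rw [hDs]; have := hD0 k; linarith
  induction i with
  | zero => simpa [hA, show D 0 = d from rfl] using hsm
  | succ k ih =>
    have hb : closedBall y (R k) ⊆ Ω := by
      refine (closedBall_subset_closedBall ?_).trans hball
      have : σ ^ k ≤ 1 := pow_le_one₀ hσ0.le (by linarith)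
      simp only [hR]; nlinarith
    have h1 := hstep Ω ν u hu hL y (R k) (A k) (D k) (hR0 k) (hD0 k) hb ih (by
      rw [hWpow k]
      refine ENNReal.ofReal_le_ofReal ?_
      have := hWD k
      have := hW0 k
      have := hR0 k
      gcongr)
    have e : σ ^ (k + 1) * r = σ * R k := by simp only [hR]; ring
    rw [e, hAs]
    exact h1.mono hp (by linarith) (by have := hD0 k; positivity)
      (by rw [hDs]; have := hW0 (k + 1); linarith)

/-- A Wolff potential bound for `u` from above, at almost every point of `S`. -/
lemma exists_ae_le_of_smallAt (n : ℕ) (hn : 0 < n) {s p β q : ℝ} (hs : 0 < s) (hp : 1 < p)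
    (hβ : 0 < β) (hpq : p - 1 ≤ q) (hβq : q ≤ p - 1 - β + q * (s * p / n)) (C : ℝ≥0) :
    ∃ κ Cw : ℝ, 0 < κ ∧ 0 < Cw ∧
      ∀ (Ω : Set (Rn n)) (ν : Measure (Rn n)) [IsFiniteMeasure ν] (u : Rn n → ℝ),
      Measurable u → LevelIneq n s p β q C ν Ω u →
      ∀ (S : Set (Rn n)) (r a d : ℝ), MeasurableSet S → 0 < r → 0 < d →
      (∀ y ∈ S, closedBall y r ⊆ Ω ∧ SmallAt n s p q κ u y r a d ∧
        ENNReal.ofReal Cw * wolff n s p ν y (2 * r) ≤ ENNReal.ofReal d) →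
      ∀ᵐ x, x ∈ S → u x ≤ a + 4 * d := by
  obtain ⟨σ, κ, Cw, hσ0, hσ8, hκ, hCw, hit⟩ := exists_pointwise_iteration n hn hs hp hβ hpq hβq C
  obtain ⟨ω, hω, hvol⟩ := exists_volume_ball n hn
  have hq : 0 < q := by linarith
  refine ⟨κ, Cw, hκ, hCw, ?_⟩
  intro Ω ν _ u hu hL S r a d hSm hr hd hS
  have : Nonempty (Fin n) := ⟨⟨0, hn⟩⟩
  have hnull : ∀ k : ℕ, volume {x | x ∈ S ∧ a + 4 * d + 1 / ((k : ℝ) + 1) < u x} = 0 := by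
    intro k
    set ε : ℝ := 1 / ((k : ℝ) + 1) with hε
    have hε0 : 0 < ε := by positivity
    set E : Set (Rn n) := {x | x ∈ S ∧ a + 4 * d + ε < u x} with hE
    rw [← Measure.restrict_eq_zero, ← ae_eq_bot, ← Filter.empty_mem_iff_bot]
    have hEm : MeasurableSet E := hSm.inter (measurableSet_lt measurable_const hu)
    have hES : ∀ᵐ x ∂volume.restrict E, x ∈ S := (ae_restrict_mem hEm).mono fun x hx => hx.1
    filter_upwards [Besicovitch.ae_tendsto_measure_inter_div volume E, hES] with y hy hyS
    obtain ⟨hball, hsm, hw⟩ := hS y hyS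
    obtain ⟨A, D, hD, hAD⟩ := hit Ω ν u hu hL y r a d hr hd hball hsm hw
    have hrad : Tendsto (fun i : ℕ => σ ^ i * r) atTop (𝓝[>] 0) := by
      refine tendsto_nhdsWithin_iff.2 ⟨?_, Eventually.of_forall fun i => by
        simp only [mem_Ioi]; positivity⟩
      simpa using (tendsto_pow_atTop_nhds_zero_of_lt_one hσ0.le (by linarith)).mul_const r
    have h1 := hy.comp hrad
    have hbd : ∀ i, volume (E ∩ closedBall y (σ ^ i * r)) / volume (closedBall y (σ ^ i * r)) ≤
        ENNReal.ofReal (κ / (ω * ε ^ q) * (D i) ^ q) := by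
      intro i
      obtain ⟨hA, hD0, hM, -⟩ := hAD i
      have hρ : 0 < σ ^ i * r := by positivity
      set ρ := σ ^ i * r
      rw [Measure.addHaar_closedBall_eq_addHaar_ball, hvol y ρ hρ]
      have h2 : volume (E ∩ closedBall y ρ) ≤
          volume {x ∈ ball y ρ | ε / D i < (u x - A i) / D i} := by
        have h3 : E ∩ closedBall y ρ ⊆
            {x ∈ ball y ρ | ε / D i < (u x - A i) / D i} ∪ sphere y ρ := by
          rintro x ⟨⟨-, hx⟩, hxb⟩
          rcases (mem_closedBall.1 hxb).lt_or_eq with h | h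
          · refine Or.inl ⟨h, ?_⟩
            gcongr
            linarith
          · exact Or.inr h
        refine (measure_mono h3).trans ((measure_union_le _ _).trans ?_)
        rw [Measure.addHaar_sphere, add_zero]
      have h4 := (volume_superlevel_le hq (div_pos hε0 hD0)
        (w := fun x => (u x - A i) / D i) (by fun_prop) y ρ).trans hM
      rw [ENNReal.div_le_iff_le_mul (Or.inl (by simp; positivity)) (Or.inl ENNReal.ofReal_ne_top),
        ← ENNReal.ofReal_mul (by positivity)]
      have h5 : (0 : ℝ) < (ε / D i) ^ q := by positivity
      have h6 : κ / (ω * ε ^ q) * D i ^ q * (ω * ρ ^ n) = κ * ρ ^ n / (ε / D i) ^ q := by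
        rw [Real.div_rpow hε0.le hD0.le]; field_simp
      refine h2.trans ?_
      rw [h6, ENNReal.ofReal_div_of_pos h5, ENNReal.le_div_iff_mul_le
          (Or.inl (by simpa using h5)) (Or.inl ENNReal.ofReal_ne_top), mul_comm]
      exact h4
    have h7 : Tendsto (fun i => ENNReal.ofReal (κ / (ω * ε ^ q) * (D i) ^ q)) atTop (𝓝 0) := by
      have h8 : Tendsto (fun i => (D i) ^ q) atTop (𝓝 0) := by
        have := ((Real.continuousAt_rpow_const 0 q (Or.inr hq.le)).tendsto).comp hD
        rwa [Real.zero_rpow hq.ne'] at this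
      have := ENNReal.tendsto_ofReal (h8.const_mul (κ / (ω * ε ^ q)))
      simpa using this
    have h9 := le_of_tendsto_of_tendsto' h1 h7 hbd
    exact absurd h9 (by simp)
  have hall : ∀ᵐ x, ∀ k : ℕ, ¬ (x ∈ S ∧ a + 4 * d + 1 / ((k : ℝ) + 1) < u x) :=
    ae_all_iff.2 fun k => by
      rw [ae_iff]; simpa only [not_not] using hnull k
  filter_upwards [hall] with x hx hxS
  refine le_of_forall_pos_le_add fun ε hε => ?_
  obtain ⟨k, hk⟩ := exists_nat_one_div_lt hε
  by_contra! h
  exact hx k ⟨hxS, by linarith⟩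

/-- Measure shrinking: if `u ≤ k + d` and `u` lies far below `k` on half of a ball, then
`u > k + d / 2` only on a small part of that ball. -/
lemma exists_volume_superlevel_le (n : ℕ) (hn : 0 < n) {s p β q : ℝ} (hs : 0 < s) (hp : 1 < p)
    (hβ : 0 < β) (hq : 0 < q) (C : ℝ≥0) :
    ∃ C₀ : ℝ, 0 < C₀ ∧ ∀ (Ω : Set (Rn n)) (ν : Measure (Rn n)) (u : Rn n → ℝ),
      Measurable u → LevelIneq n s p β q C ν Ω u → ∀ (x₀ : Rn n) (R R₀ k d b : ℝ), 0 < R → R ≤ R₀ →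
      0 < d → 0 < b → closedBall x₀ R ⊆ Ω → (∀ᵐ x, x ∈ ball x₀ R₀ → u x ≤ k + d) →
      volume (ball x₀ (R / 2)) ≤ 2 * volume {x ∈ ball x₀ (R / 2) | u x ≤ k - d * b} →
      posTail n s p x₀ R₀ (fun x => (u x - k) / d) ≤ ENNReal.ofReal (R ^ (-(s * p))) →
      ν (closedBall x₀ R) ≤ ENNReal.ofReal (d ^ (p - 1) * R ^ ((n : ℝ) - s * p)) →
      volume {x ∈ ball x₀ (R / 2) | k + d / 2 ≤ u x} ≤
        ENNReal.ofReal (C₀ * (b ^ (p - 1))⁻¹ * R ^ n) := by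
  obtain ⟨ω, hω, hvol⟩ := exists_volume_ball n hn
  have hsp : 0 < s * p := by positivity
  have hp1 : 0 < p - 1 := by linarith
  obtain ⟨Cτ, hCτ⟩ := exists_lintegral_compl_ball_norm_rpow_le n hn hsp
  have hc0 : 0 < trunc β (1 / 2) := trunc_pos hβ (by norm_num)
  set c := trunc β (1 / 2) with hc
  refine ⟨(C + 1) * (ω + Cτ + 2) * (c * ω / 2 ^ (n + 1))⁻¹, by positivity, ?_⟩
  intro Ω ν u hu hL x₀ R R₀ k d b hR hRR hd hb hball hM hhalf htail hν
  set w : Rn n → ℝ := fun x => (u x - k) / d with hw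
  have hwm : Measurable w := by simp only [hw]; fun_prop
  have hw1 : ∀ᵐ x, x ∈ ball x₀ R₀ → max (w x) 0 ≤ 1 := by
    filter_upwards [hM] with x hx hxB
    refine max_le ?_ zero_le_one
    rw [hw]; simp only; rw [div_le_one hd]; linarith [hx hxB]
  have hmass : posMass n q x₀ R w ≤ ENNReal.ofReal (ω * R ^ n) := by
    rw [posMass, ← hvol x₀ R hR, ← one_mul (volume _), ← setLIntegral_const]
    refine lintegral_mono_ae ?_
    refine (ae_restrict_iff' measurableSet_ball).2 ?_
    filter_upwards [hw1] with x hx hxB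
    rw [← ENNReal.ofReal_one]
    exact ENNReal.ofReal_le_ofReal (Real.rpow_le_one (le_max_right _ _)
      (hx (ball_subset_ball hRR hxB)) hq.le)
  have htl : posTail n s p x₀ R w ≤ ENNReal.ofReal ((Cτ + 1) * R ^ (-(s * p))) := by
    have hcov : (ball x₀ R)ᶜ ⊆ (ball x₀ R₀ ∩ (ball x₀ R)ᶜ) ∪ (ball x₀ R₀)ᶜ := by
      intro x hx
      by_cases h : x ∈ ball x₀ R₀
      · exact Or.inl ⟨h, hx⟩
      · exact Or.inr h
    have h1 : ∫⁻ x in ball x₀ R₀ ∩ (ball x₀ R)ᶜ,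
        ENNReal.ofReal ((max (w x) 0) ^ (p - 1) * (‖x - x₀‖ ^ ((n : ℝ) + s * p))⁻¹) ≤
        Cτ * ENNReal.ofReal (R ^ (-(s * p))) := by
      refine le_trans ?_ (hCτ x₀ R hR)
      refine le_trans ?_ (lintegral_mono_set (inter_subset_right (s := ball x₀ R₀)))
      refine lintegral_mono_ae ?_
      refine (ae_restrict_iff' (measurableSet_ball.inter measurableSet_ball.compl)).2 ?_
      filter_upwards [hw1] with x hx hxB
      refine ENNReal.ofReal_le_ofReal ?_
      rw [Real.rpow_neg (norm_nonneg _), norm_sub_rev x₀ x]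
      exact mul_le_of_le_one_left (by positivity)
        (Real.rpow_le_one (le_max_right _ _) (hx hxB.1) hp1.le)
    refine (lintegral_mono_set hcov).trans ((lintegral_union_le _ _ _).trans
      ((add_le_add h1 htail).trans (le_of_eq ?_)))
    rw [← ENNReal.ofReal_coe_nnreal, ← ENNReal.ofReal_mul (by positivity),
      ← ENNReal.ofReal_add (by positivity) (by positivity)]
    congr 1; ring
  have hE : posEnergy n s p β x₀ (R / 2) w ≤
      ENNReal.ofReal ((C + 1) * (ω + Cτ + 2) * R ^ ((n : ℝ) - s * p)) := by
    have e0 : R ^ n * R ^ (-(s * p)) = R ^ ((n : ℝ) - s * p) := by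
      rw [sub_eq_add_neg, Real.rpow_add hR, Real.rpow_natCast]
    calc _ ≤ C * (ENNReal.ofReal (R ^ (-(s * p))) * ENNReal.ofReal (ω * R ^ n) +
          ENNReal.ofReal (R ^ n) * ENNReal.ofReal ((Cτ + 1) * R ^ (-(s * p))) +
          ENNReal.ofReal (d ^ (p - 1))⁻¹ *
            ENNReal.ofReal (d ^ (p - 1) * R ^ ((n : ℝ) - s * p))) := by
          refine (hL x₀ R k d hR hd hball).trans ?_
          gcongr
      _ = ENNReal.ofReal (C * ((ω + Cτ + 2) * R ^ ((n : ℝ) - s * p))) := by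
          rw [← ENNReal.ofReal_mul (by positivity), ← ENNReal.ofReal_mul (by positivity),
            ← ENNReal.ofReal_mul (by positivity),
            ← ENNReal.ofReal_add (by positivity) (by positivity),
            ← ENNReal.ofReal_add (by positivity) (by positivity), ← ENNReal.ofReal_coe_nnreal,
            ← ENNReal.ofReal_mul (by positivity), ← e0]
          congr 1; field_simp; ring
      _ ≤ _ := by
          refine ENNReal.ofReal_le_ofReal ?_
          rw [mul_assoc]; gcongr; linarith
  set S : Set (Rn n) := {x ∈ ball x₀ (R / 2) | u x ≤ k - d * b} with hS
  set T : Set (Rn n) := {x ∈ ball x₀ (R / 2) | k + d / 2 ≤ u x} with hT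
  have hSm : MeasurableSet S := measurableSet_ball.inter (measurableSet_le hu measurable_const)
  have hTm : MeasurableSet T := measurableSet_ball.inter (measurableSet_le measurable_const hu)
  set e : ℝ := b ^ (p - 1) * c * (R ^ ((n : ℝ) + s * p))⁻¹ with he
  have he0 : 0 < e := by positivity
  have hSv : ENNReal.ofReal (ω * (R / 2) ^ n / 2) ≤ volume S := by
    rw [hvol _ _ (by positivity)] at hhalf
    rw [ENNReal.ofReal_div_of_pos (by norm_num), ENNReal.div_le_iff_le_mul (Or.inl (by simp))
      (Or.inl (by simp)), ENNReal.ofReal_ofNat, mul_comm (volume S)]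
    exact hhalf
  have hlow : ENNReal.ofReal (e * (ω * (R / 2) ^ n / 2)) * volume T ≤
      posEnergy n s p β x₀ (R / 2) w := by
    rw [← setLIntegral_const]
    refine (setLIntegral_mono' hTm fun x hx => ?_).trans
      (lintegral_mono_set fun x hx => hx.1)
    rw [ENNReal.ofReal_mul he0.le]
    refine (mul_le_mul_right hSv _).trans
      (mul_volume_le_posEnergy_inner hSm (fun y hy => hy.1) fun y hy => ?_)
    have hwx : 1 / 2 ≤ w x := by
      simp only [hw]; rw [le_div_iff₀ hd]; linarith [hx.2]
    have hwy : w y ≤ -b := by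
      simp only [hw]; rw [div_le_iff₀ hd]; linarith [hy.2]
    have hxy : x ≠ y := by rintro rfl; linarith
    have hxy' : 0 < ‖x - y‖ := norm_pos_iff.2 (sub_ne_zero.2 hxy)
    have hdist : ‖x - y‖ ≤ R := by
      have h1 := mem_ball.1 hx.1
      have h2 := mem_ball.1 hy.1
      have := dist_triangle_right x y x₀
      rw [← dist_eq_norm]; linarith
    have hg : c ≤ max (trunc β (max (w x) 0) - trunc β (max (w y) 0)) 0 := by
      refine le_max_of_le_left ?_
      rw [max_eq_right (by linarith : w y ≤ 0), trunc_zero, sub_zero, max_eq_left (by linarith)]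
      exact trunc_mono hβ (by norm_num) hwx
    rw [he]
    gcongr
    exact le_max_of_le_left (by linarith)
  have hpos : 0 < e * (ω * (R / 2) ^ n / 2) := by positivity
  have hfin := hlow.trans hE
  rw [mul_comm, ← ENNReal.le_div_iff_mul_le (Or.inl (by simpa using hpos))
    (Or.inl ENNReal.ofReal_ne_top), ← ENNReal.ofReal_div_of_pos hpos] at hfin
  refine hfin.trans (ENNReal.ofReal_le_ofReal (le_of_eq ?_))
  rw [he, Real.rpow_sub hR, Real.rpow_add hR, Real.rpow_natCast, div_pow, pow_succ]
  field_simp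

/-- The conclusion of `exists_ae_le_of_smallAt` for a single function. -/
def WolffUpper (n : ℕ) (s p q κ Cw : ℝ) (ν : Measure (Rn n)) (Ω : Set (Rn n)) (u : Rn n → ℝ) :
    Prop :=
  ∀ (S : Set (Rn n)) (r a d : ℝ), MeasurableSet S → 0 < r → 0 < d →
    (∀ y ∈ S, closedBall y r ⊆ Ω ∧ SmallAt n s p q κ u y r a d ∧
      ENNReal.ofReal Cw * wolff n s p ν y (2 * r) ≤ ENNReal.ofReal d) →
    ∀ᵐ x, x ∈ S → u x ≤ a + 4 * d

lemma wolff_mono {n : ℕ} {s p : ℝ} {ν : Measure (Rn n)} {y : Rn n} {r r' : ℝ} (h : r ≤ r') :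
    wolff n s p ν y r ≤ wolff n s p ν y r' :=
  lintegral_mono_set (Ioc_subset_Ioc_right h)

lemma lintegral_compl_ball_shift_le {n : ℕ} {α R : ℝ} {x₀ y : Rn n} (hα : 0 < α) (hR : 0 < R)
    (hy : y ∈ ball x₀ (R / 2)) {f : Rn n → ℝ} (hf : ∀ x, 0 ≤ f x) :
    ∫⁻ x in (ball x₀ R)ᶜ, ENNReal.ofReal (f x * (‖x - y‖ ^ α)⁻¹) ≤
      ENNReal.ofReal (2 ^ α) * ∫⁻ x in (ball x₀ R)ᶜ, ENNReal.ofReal (f x * (‖x - x₀‖ ^ α)⁻¹) := by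
  rw [← lintegral_const_mul' _ _ ENNReal.ofReal_ne_top]
  refine setLIntegral_mono' measurableSet_ball.compl fun x hx => ?_
  rw [← ENNReal.ofReal_mul (by positivity)]
  refine ENNReal.ofReal_le_ofReal ?_
  have h1 : R ≤ ‖x - x₀‖ := by simpa [dist_eq_norm] using hx
  have h2 : ‖y - x₀‖ < R / 2 := by simpa [dist_eq_norm] using hy
  have h3 : ‖x - x₀‖ ≤ ‖x - y‖ + ‖y - x₀‖ := by
    have := norm_add_le (x - y) (y - x₀); simpa using this
  have h4 : 0 < ‖x - x₀‖ := by linarith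
  have h5 : ‖x - x₀‖ / 2 ≤ ‖x - y‖ := by linarith
  have h6 : (‖x - y‖ ^ α)⁻¹ ≤ 2 ^ α * (‖x - x₀‖ ^ α)⁻¹ := by
    calc (‖x - y‖ ^ α)⁻¹ ≤ ((‖x - x₀‖ / 2) ^ α)⁻¹ := by gcongr
      _ = _ := by rw [Real.div_rpow h4.le (by norm_num)]; field_simp
  calc f x * (‖x - y‖ ^ α)⁻¹ ≤ f x * (2 ^ α * (‖x - x₀‖ ^ α)⁻¹) :=
        mul_le_mul_of_nonneg_left h6 (hf x)
    _ = _ := by ring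

lemma measure_closedBall_le_of_wolff {n : ℕ} {s p d : ℝ} (hp : 1 < p) {ν : Measure (Rn n)}
    {y : Rn n} {ρ : ℝ} (hρ : 0 < ρ) (hd : 0 ≤ d)
    (h : ENNReal.ofReal (2 * (2 ^ |(n : ℝ) - s * p|) ^ (1 / (p - 1))) * wolff n s p ν y (2 * ρ) ≤
      ENNReal.ofReal d) :
    ν (closedBall y ρ) ≤ ENNReal.ofReal (d ^ (p - 1) * ρ ^ ((n : ℝ) - s * p)) := by
  have hp1 : 0 < p - 1 := by linarith
  have h1 := (wolff_term_le n s hp ν y hρ).trans ((mul_le_mul_right (lintegral_mono_set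
    (Ioc_subset_Ioc_left hρ.le)) _).trans h)
  have h2 := ENNReal.rpow_le_rpow h1 hp1.le
  rw [← ENNReal.rpow_mul, one_div, inv_mul_cancel₀ hp1.ne', ENNReal.rpow_one,
    ENNReal.ofReal_rpow_of_nonneg hd hp1.le, ENNReal.div_le_iff_le_mul
    (Or.inl (by simp; positivity)) (Or.inl ENNReal.ofReal_ne_top),
    ← ENNReal.ofReal_mul (by positivity)] at h2
  exact h2

/-- Oscillation decay from above: if `u` is below the middle value on half of a small ball then
its upper bound improves by a fixed fraction on a smaller ball. -/
lemma exists_upper_bound_decay (n : ℕ) (hn : 0 < n) {s p β q κ Cw : ℝ} (hs : 0 < s) (hp : 1 < p)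
    (hβ : 0 < β) (hpq : p - 1 ≤ q) (C : ℝ≥0) (hκ : 0 < κ) :
    ∃ δ : ℝ, 0 < δ ∧ δ ≤ 1 / 4 ∧ ∀ (Ω : Set (Rn n)) (ν : Measure (Rn n)) (u : Rn n → ℝ),
      Measurable u → LevelIneq n s p β q C ν Ω u → WolffUpper n s p q κ Cw ν Ω u →
      ∀ (x₀ : Rn n) (R₀ m M : ℝ), 0 < R₀ → closedBall x₀ R₀ ⊆ Ω → m < M →
      (∀ᵐ x, x ∈ ball x₀ R₀ → u x ≤ M) →
      (∀ k d, 0 < d → posTail n s p x₀ R₀ (fun x => (u x - k) / d) < ⊤) →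
      (∀ e : ℝ≥0∞, e ≠ 0 → ∀ᶠ t in 𝓝[>] (0 : ℝ), ∀ y ∈ ball x₀ R₀, wolff n s p ν y t ≤ e) →
      ∀ᶠ R in 𝓝[>] (0 : ℝ),
        volume (ball x₀ (R / 2)) ≤ 2 * volume {x ∈ ball x₀ (R / 2) | u x ≤ (M + m) / 2} →
        ∀ᵐ x, x ∈ ball x₀ (R / 4) → u x ≤ M - δ / 4 * (M - m) := by
  have hp1 : 0 < p - 1 := by linarith
  have hq : 0 < q := by linarith
  have hsp : 0 < s * p := by positivity
  obtain ⟨C₀, hC₀, hshrink⟩ := exists_volume_superlevel_le n hn hs hp hβ hq C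
  obtain ⟨Cτ, hCτ⟩ := exists_lintegral_compl_ball_norm_rpow_le n hn hsp
  set α : ℝ := (n : ℝ) + s * p with hα
  have hα0 : 0 < α := by positivity
  set B : ℝ := 8 ^ (p - 1) * Cτ * 4 ^ (s * p) + 2 ^ α * 16 ^ (p - 1) with hB
  obtain ⟨θ, hθ0, hθ4, hθ⟩ : ∃ θ : ℝ, 0 < θ ∧ θ ≤ 1 / 4 ∧ B * θ ^ (s * p) ≤ κ / 2 := by
    have h1 : Tendsto (fun θ : ℝ => B * θ ^ (s * p)) (𝓝[>] 0) (𝓝 (B * 0)) := by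
      refine Tendsto.const_mul _ ?_
      have := (Real.continuousAt_rpow_const 0 (s * p) (Or.inr hsp.le)).tendsto
      rw [Real.zero_rpow hsp.ne'] at this
      exact this.mono_left nhdsWithin_le_nhds
    rw [mul_zero] at h1
    obtain ⟨θ, ⟨h2, h3⟩, h4⟩ := ((h1.eventually_le_const (half_pos hκ)).and
      (Ioc_mem_nhdsGT (show (0 : ℝ) < 1 / 4 by norm_num))).and self_mem_nhdsWithin |>.exists
    exact ⟨θ, h4, h3.2, h2⟩
  obtain ⟨δ, hδ0, hδ4, hδ⟩ : ∃ δ : ℝ, 0 < δ ∧ δ ≤ 1 / 4 ∧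
      8 ^ q * C₀ * (4 * δ) ^ (p - 1) ≤ κ / 2 * θ ^ n := by
    have h1 : Tendsto (fun δ : ℝ => 8 ^ q * C₀ * (4 * δ) ^ (p - 1)) (𝓝[>] 0)
        (𝓝 (8 ^ q * C₀ * 0)) := by
      refine Tendsto.const_mul _ ?_
      have h2 := (Real.continuousAt_rpow_const 0 (p - 1) (Or.inr hp1.le)).tendsto
      rw [Real.zero_rpow hp1.ne'] at h2
      refine h2.comp ?_
      have : Tendsto (fun δ : ℝ => 4 * δ) (𝓝 0) (𝓝 (4 * 0)) := tendsto_id.const_mul 4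
      rw [mul_zero] at this
      exact this.mono_left nhdsWithin_le_nhds
    rw [mul_zero] at h1
    obtain ⟨δ, ⟨h2, h3⟩, h4⟩ := ((h1.eventually_le_const
      (show 0 < κ / 2 * θ ^ n by positivity)).and
      (Ioc_mem_nhdsGT (show (0 : ℝ) < 1 / 4 by norm_num))).and self_mem_nhdsWithin |>.exists
    exact ⟨δ, h4, h3.2, h2⟩
  refine ⟨δ, hδ0, hδ4, ?_⟩
  intro Ω ν u hu hL hP x₀ R₀ m M hR₀ hball hmM hM htail hW
  set d : ℝ := δ * (M - m) with hd
  have hd0 : 0 < d := mul_pos hδ0 (by linarith)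
  set k : ℝ := M - d with hk
  set w : Rn n → ℝ := fun x => (u x - k) / d with hw
  have ev1 : ∀ᶠ R in 𝓝[>] (0 : ℝ), R ≤ R₀ := by
    filter_upwards [Ioc_mem_nhdsGT hR₀] with R hR using hR.2
  have ev2 : ∀ᶠ R in 𝓝[>] (0 : ℝ), posTail n s p x₀ R₀ w ≤ ENNReal.ofReal (R ^ (-(s * p))) := by
    have := tendsto_rpow_neg_nhdsGT_zero (neg_lt_zero.2 hsp)
    filter_upwards [this.eventually_ge_atTop (posTail n s p x₀ R₀ w).toReal,
      self_mem_nhdsWithin] with R hR hR0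
    exact (ENNReal.le_ofReal_iff_toReal_le (htail k d hd0).ne
      (Real.rpow_nonneg (le_of_lt hR0) _)).2 hR
  have ev3 : ∀ c e : ℝ, 0 < e → ∀ᶠ R in 𝓝[>] (0 : ℝ), ∀ y ∈ ball x₀ R₀,
      ENNReal.ofReal c * wolff n s p ν y (2 * R) ≤ ENNReal.ofReal e := by
    intro c e he
    have h2 : Tendsto (fun R : ℝ => 2 * R) (𝓝[>] 0) (𝓝[>] 0) := by
      refine tendsto_nhdsWithin_iff.2 ⟨?_, eventually_mem_nhdsWithin.mono fun R (hR : 0 < R) => by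
        simp only [mem_Ioi]; positivity⟩
      have : Tendsto (fun R : ℝ => 2 * R) (𝓝 0) (𝓝 (2 * 0)) := tendsto_id.const_mul 2
      rw [mul_zero] at this
      exact this.mono_left nhdsWithin_le_nhds
    filter_upwards [h2.eventually (hW (ENNReal.ofReal (e / (|c| + 1))) (by simp; positivity))]
      with R hR y hy
    refine (mul_le_mul_right (hR y hy) _).trans ?_
    rw [← ENNReal.ofReal_mul' (by positivity)]
    refine ENNReal.ofReal_le_ofReal ?_
    rw [mul_div_assoc', div_le_iff₀ (by positivity)]
    nlinarith [le_abs_self c]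
  filter_upwards [ev1, ev2, ev3 _ d hd0, ev3 Cw (d / 16) (by positivity), self_mem_nhdsWithin]
    with R hRR htl hw1 hw2 hR hhalf
  have hR0 : 0 < R := hR
  set T : Set (Rn n) := {x ∈ ball x₀ (R / 2) | k + d / 2 ≤ u x} with hT
  have hTm : MeasurableSet T := measurableSet_ball.inter (measurableSet_le measurable_const hu)
  have hTv : volume T ≤ ENNReal.ofReal (C₀ * (4 * δ) ^ (p - 1) * R ^ n) := by
    have h1 := hshrink Ω ν u hu hL x₀ R R₀ k d (1 / (4 * δ)) hR0 hRR hd0 (by positivity)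
      ((closedBall_subset_closedBall hRR).trans hball) (by simpa [hk] using hM)
      (hhalf.trans (by
        gcongr
        rw [hk, hd]
        have : δ * (M - m) * (1 / (4 * δ)) = (M - m) / 4 := by field_simp
        rw [this]
        nlinarith)) htl
      (measure_closedBall_le_of_wolff hp hR0 hd0.le (hw1 x₀ (mem_ball_self hR₀)))
    rwa [one_div, Real.inv_rpow (by positivity), inv_inv] at h1
  set U : Rn n → ℝ := fun x => (u x - (k + d / 2)) / (d / 16) with hU
  have hUw : ∀ x, U x = 16 * (w x - 1 / 2) := fun x => by simp only [hU, hw]; field_simp; ring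
  have hU8 : ∀ᵐ x, x ∈ ball x₀ R₀ → max (U x) 0 ≤ 8 := by
    filter_upwards [hM] with x hx hxB
    refine max_le ?_ (by norm_num)
    simp only [hU]; rw [div_le_iff₀ (by positivity)]
    have := hx hxB
    linarith
  have hpart : ∀ t, 0 < t → t ≤ q → ∫⁻ x in ball x₀ (R / 2), ENNReal.ofReal ((max (U x) 0) ^ t) ≤
      ENNReal.ofReal (κ / 2 * θ ^ n * R ^ n) := by
    intro t ht htq
    calc _ ≤ ∫⁻ x in ball x₀ (R / 2), {x | k + d / 2 ≤ u x}.indicator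
          (fun _ => ENNReal.ofReal (8 ^ q)) x := by
          refine lintegral_mono_ae ((ae_restrict_iff' measurableSet_ball).2 ?_)
          filter_upwards [hU8] with x hx hxB
          by_cases h : k + d / 2 ≤ u x
          · rw [indicator_of_mem (show x ∈ {x | k + d / 2 ≤ u x} from h)]
            refine ENNReal.ofReal_le_ofReal ?_
            calc (max (U x) 0) ^ t ≤ 8 ^ t := Real.rpow_le_rpow (le_max_right _ _)
                  (hx (ball_subset_ball (by linarith) hxB)) ht.le
              _ ≤ 8 ^ q := Real.rpow_le_rpow_of_exponent_le (by norm_num) htq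
          · rw [indicator_of_notMem (show x ∉ {x | k + d / 2 ≤ u x} from h), max_eq_right,
              Real.zero_rpow ht.ne', ENNReal.ofReal_zero]
            exact div_nonpos_of_nonpos_of_nonneg (by linarith) (by positivity)
      _ = ENNReal.ofReal (8 ^ q) * volume T := by
          rw [setLIntegral_indicator (measurableSet_le measurable_const hu), setLIntegral_const,
            inter_comm]
          rfl
      _ ≤ ENNReal.ofReal (8 ^ q) * ENNReal.ofReal (C₀ * (4 * δ) ^ (p - 1) * R ^ n) := by gcongr
      _ ≤ _ := by
          rw [← ENNReal.ofReal_mul (by positivity)]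
          refine ENNReal.ofReal_le_ofReal ?_
          calc _ = (8 ^ q * C₀ * (4 * δ) ^ (p - 1)) * R ^ n := by ring
            _ ≤ _ := by gcongr
  have hfinal := hP (ball x₀ (R / 4)) (θ * R) (k + d / 2) (d / 16)
    measurableSet_ball (by positivity)
    (by positivity) fun y hy => ?_
  · filter_upwards [hfinal] with x hx hxB
    refine (hx hxB).trans (le_of_eq ?_)
    rw [hk, hd]; ring
  have hyd : dist y x₀ < R / 4 := hy
  have hθR : θ * R ≤ R / 4 := by nlinarith
  have hyball : ball y (θ * R) ⊆ ball x₀ (R / 2) := ball_subset_ball' (by linarith)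
  refine ⟨(closedBall_subset_closedBall' (by linarith)).trans hball, ⟨?_, ?_⟩, ?_⟩
  · refine (lintegral_mono_set hyball).trans ((hpart q hq le_rfl).trans
      (ENNReal.ofReal_le_ofReal ?_))
    rw [mul_pow, mul_assoc]
    have : 0 < θ ^ n * R ^ n := by positivity
    nlinarith
  · have hcov : (ball y (θ * R))ᶜ ⊆ (ball x₀ (R / 2) ∩ (ball y (θ * R))ᶜ) ∪
        ((ball x₀ R₀ ∩ (ball y (R / 4))ᶜ) ∪ (ball x₀ R₀)ᶜ) := by
      intro x hx
      by_cases h1 : x ∈ ball x₀ R₀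
      · by_cases h2 : x ∈ ball x₀ (R / 2)
        · exact Or.inl ⟨h2, hx⟩
        · refine Or.inr (Or.inl ⟨h1, fun h => h2 ?_⟩)
          exact ball_subset_ball' (by linarith) h
      · exact Or.inr (Or.inr h1)
    have t1 : ∫⁻ x in ball x₀ (R / 2) ∩ (ball y (θ * R))ᶜ,
        ENNReal.ofReal ((max (U x) 0) ^ (p - 1) * (‖x - y‖ ^ α)⁻¹) ≤
        ENNReal.ofReal ((θ * R) ^ (-α) * (κ / 2 * θ ^ n * R ^ n)) := by
      rw [ENNReal.ofReal_mul (by positivity)]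
      refine le_trans ?_ (mul_le_mul_right (hpart (p - 1) hp1 hpq) _)
      rw [← lintegral_const_mul' _ _ ENNReal.ofReal_ne_top]
      refine (setLIntegral_mono' (measurableSet_ball.inter measurableSet_ball.compl)
        fun x hx => ?_).trans (lintegral_mono_set inter_subset_left)
      rw [← ENNReal.ofReal_mul (by positivity), mul_comm]
      refine ENNReal.ofReal_le_ofReal ?_
      have hxy : θ * R ≤ ‖x - y‖ := by simpa [dist_eq_norm] using hx.2
      have hθR0 : 0 < θ * R := by positivity
      rw [Real.rpow_neg hθR0.le]
      gcongr
    have t2 : ∫⁻ x in ball x₀ R₀ ∩ (ball y (R / 4))ᶜ,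
        ENNReal.ofReal ((max (U x) 0) ^ (p - 1) * (‖x - y‖ ^ α)⁻¹) ≤
        ENNReal.ofReal (8 ^ (p - 1) * (Cτ * (R / 4) ^ (-(s * p)))) := by
      have h1 := hCτ y (R / 4) (by positivity)
      rw [← ENNReal.ofReal_coe_nnreal, ← ENNReal.ofReal_mul (by positivity)] at h1
      rw [ENNReal.ofReal_mul (by positivity)]
      refine le_trans ?_ (mul_le_mul_right h1 _)
      refine le_trans ?_ (mul_le_mul_right
        (lintegral_mono_set (inter_subset_right (s := ball x₀ R₀))) _)
      rw [← lintegral_const_mul' _ _ ENNReal.ofReal_ne_top]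
      refine lintegral_mono_ae ((ae_restrict_iff'
        (measurableSet_ball.inter measurableSet_ball.compl)).2 ?_)
      filter_upwards [hU8] with x hx hxB
      rw [← ENNReal.ofReal_mul (by positivity)]
      refine ENNReal.ofReal_le_ofReal ?_
      rw [Real.rpow_neg (norm_nonneg _), norm_sub_rev y x]
      have := hx hxB.1
      gcongr
    have t3 : ∫⁻ x in (ball x₀ R₀)ᶜ,
        ENNReal.ofReal ((max (U x) 0) ^ (p - 1) * (‖x - y‖ ^ α)⁻¹) ≤
        ENNReal.ofReal (2 ^ α * (16 ^ (p - 1) * R ^ (-(s * p)))) := by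
      refine (lintegral_compl_ball_shift_le hα0 hR₀
        (mem_ball.2 (show dist y x₀ < R₀ / 2 by linarith))
        fun x => Real.rpow_nonneg (le_max_right _ _) _).trans ?_
      rw [ENNReal.ofReal_mul (by positivity), ENNReal.ofReal_mul (by positivity)]
      refine mul_le_mul_right (le_trans ?_ (mul_le_mul_right htl _)) _
      rw [posTail, ← lintegral_const_mul' _ _ ENNReal.ofReal_ne_top]
      refine lintegral_mono fun x => ?_
      rw [← ENNReal.ofReal_mul (by positivity), ← mul_assoc,
        ← Real.mul_rpow (by norm_num) (le_max_right _ _)]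
      refine ENNReal.ofReal_le_ofReal ?_
      gcongr
      rw [hUw]
      have := le_max_left (w x) 0
      have := le_max_right (w x) 0
      exact max_le (by linarith) (by linarith)
    refine (lintegral_mono_set hcov).trans ((lintegral_union_le _ _ _).trans
      ((add_le_add t1 ((lintegral_union_le _ _ _).trans (add_le_add t2 t3))).trans ?_))
    rw [← ENNReal.ofReal_add (by positivity) (by positivity),
      ← ENNReal.ofReal_add (by positivity) (by positivity)]
    refine ENNReal.ofReal_le_ofReal ?_
    have e1 : (θ * R) ^ (-α) * (κ / 2 * θ ^ n * R ^ n) = κ / 2 * (θ * R) ^ (-(s * p)) := by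
      have : θ ^ n * R ^ n = (θ * R) ^ (n : ℝ) := by rw [Real.rpow_natCast, mul_pow]
      rw [mul_assoc (κ / 2), this, mul_left_comm, ← Real.rpow_add (by positivity), hα]
      congr 2; ring
    have e2 : (R / 4) ^ (-(s * p)) = 4 ^ (s * p) * R ^ (-(s * p)) := by
      rw [Real.div_rpow hR0.le (by norm_num), Real.rpow_neg (by norm_num : (0 : ℝ) ≤ 4)]
      field_simp
    have e3 : R ^ (-(s * p)) = θ ^ (s * p) * (θ * R) ^ (-(s * p)) := by
      rw [Real.mul_rpow hθ0.le hR0.le, Real.rpow_neg hθ0.le]; field_simp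
    calc _ = κ / 2 * (θ * R) ^ (-(s * p)) + B * R ^ (-(s * p)) := by rw [e1, e2, hB]; ring
      _ = κ / 2 * (θ * R) ^ (-(s * p)) + (B * θ ^ (s * p)) * (θ * R) ^ (-(s * p)) := by
          rw [e3]; ring
      _ ≤ κ / 2 * (θ * R) ^ (-(s * p)) + κ / 2 * (θ * R) ^ (-(s * p)) := by gcongr
      _ = _ := by ring
  · refine le_trans (mul_le_mul_right (wolff_mono (by linarith)) _)
      (hw2 y (mem_ball.2 (by linarith)))

lemma max_sub_div_rpow_le {t a k d : ℝ} (ht : 0 ≤ t) (hd : 0 < d) :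
    (max ((a - k) / d) 0) ^ t ≤ 2 ^ t / d ^ t * (|a| ^ t + |k| ^ t) := by
  have h1 : max ((a - k) / d) 0 ≤ (|a| + |k|) / d := by
    refine max_le ?_ (by positivity)
    gcongr
    linarith [le_abs_self a, neg_abs_le k]
  calc (max ((a - k) / d) 0) ^ t ≤ ((|a| + |k|) / d) ^ t := by gcongr
    _ = (|a| + |k|) ^ t / d ^ t := Real.div_rpow (by positivity) hd.le _
    _ ≤ 2 ^ t * (|a| ^ t + |k| ^ t) / d ^ t := by
        gcongr
        exact add_rpow_le_two_rpow_mul (abs_nonneg _) (abs_nonneg _) ht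
    _ = _ := by ring

lemma lintegral_compl_ball_kernel_lt_top {n : ℕ} (hn : 0 < n) {τ : ℝ} (hτ : 0 < τ) (x₀ : Rn n)
    {r : ℝ} (hr : 0 < r) :
    ∫⁻ x in (ball x₀ r)ᶜ, ENNReal.ofReal ((‖x - x₀‖ ^ ((n : ℝ) + τ))⁻¹) < ⊤ := by
  obtain ⟨C, hC⟩ := exists_lintegral_compl_ball_norm_rpow_le n hn hτ
  refine lt_of_le_of_lt ?_ (ENNReal.mul_lt_top (ENNReal.coe_lt_top (r := C))
    (ENNReal.ofReal_lt_top (r := r ^ (-τ))))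
  refine le_trans (le_of_eq ?_) (hC x₀ r hr)
  refine lintegral_congr fun x => ?_
  rw [Real.rpow_neg (norm_nonneg _), norm_sub_rev]

lemma posTail_lt_top {n : ℕ} (hn : 0 < n) {s p : ℝ} (hs : 0 < s) (hp : 1 < p) {u : Rn n → ℝ}
    {x₀ : Rn n} {r : ℝ} (hr : 0 < r)
    (hT : ∫⁻ x in (ball x₀ r)ᶜ,
      ENNReal.ofReal (|u x| ^ (p - 1) * (‖x - x₀‖ ^ ((n : ℝ) + s * p))⁻¹) < ⊤)
    (k : ℝ) {d : ℝ} (hd : 0 < d) : posTail n s p x₀ r (fun x => (u x - k) / d) < ⊤ := by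
  have hp1 : 0 < p - 1 := by linarith
  set c : ℝ := 2 ^ (p - 1) / d ^ (p - 1) with hc
  have hc0 : 0 ≤ c := by positivity
  have hk := lintegral_compl_ball_kernel_lt_top hn (mul_pos hs (by linarith : 0 < p)) x₀ hr
  calc posTail n s p x₀ r (fun x => (u x - k) / d)
      ≤ ∫⁻ x in (ball x₀ r)ᶜ, (ENNReal.ofReal c *
          ENNReal.ofReal (|u x| ^ (p - 1) * (‖x - x₀‖ ^ ((n : ℝ) + s * p))⁻¹) +
          ENNReal.ofReal (c * |k| ^ (p - 1)) *
            ENNReal.ofReal ((‖x - x₀‖ ^ ((n : ℝ) + s * p))⁻¹)) := by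
        refine lintegral_mono fun x => ?_
        simp only
        rw [← ENNReal.ofReal_mul hc0, ← ENNReal.ofReal_mul (by positivity),
          ← ENNReal.ofReal_add (by positivity) (by positivity)]
        refine ENNReal.ofReal_le_ofReal ?_
        refine (mul_le_mul_of_nonneg_right (max_sub_div_rpow_le hp1.le hd)
          (by positivity)).trans (le_of_eq ?_)
        ring
    _ = ENNReal.ofReal c * (∫⁻ x in (ball x₀ r)ᶜ,
          ENNReal.ofReal (|u x| ^ (p - 1) * (‖x - x₀‖ ^ ((n : ℝ) + s * p))⁻¹)) +
          ENNReal.ofReal (c * |k| ^ (p - 1)) *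
            ∫⁻ x in (ball x₀ r)ᶜ, ENNReal.ofReal ((‖x - x₀‖ ^ ((n : ℝ) + s * p))⁻¹) := by
        rw [lintegral_add_right _ (by fun_prop), lintegral_const_mul' _ _ ENNReal.ofReal_ne_top,
          lintegral_const_mul' _ _ ENNReal.ofReal_ne_top]
    _ < ⊤ := ENNReal.add_lt_top.2 ⟨ENNReal.mul_lt_top ENNReal.ofReal_lt_top hT,
        ENNReal.mul_lt_top ENNReal.ofReal_lt_top hk⟩

lemma max_div_rpow_le {t a d : ℝ} (ht : 0 ≤ t) (hd : 0 < d) :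
    (max ((a - 0) / d) 0) ^ t ≤ d ^ (-t) * |a| ^ t := by
  have h1 : max ((a - 0) / d) 0 ≤ |a| / d := by
    refine max_le ?_ (by positivity)
    gcongr
    simpa using le_abs_self a
  calc (max ((a - 0) / d) 0) ^ t ≤ (|a| / d) ^ t := by gcongr
    _ = _ := by rw [Real.div_rpow (abs_nonneg _) hd.le, Real.rpow_neg hd.le]; ring

lemma eventually_ofReal_rpow_neg_mul_le {t : ℝ} (ht : 0 < t) {X : ℝ≥0∞} (hX : X ≠ ⊤) {e : ℝ}
    (he : 0 < e) : ∀ᶠ d : ℝ in atTop, ENNReal.ofReal (d ^ (-t)) * X ≤ ENNReal.ofReal e := by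
  have h1 : Tendsto (fun d : ℝ => ENNReal.ofReal (d ^ (-t)) * X) atTop
      (𝓝 (ENNReal.ofReal 0 * X)) :=
    ENNReal.Tendsto.mul_const (ENNReal.tendsto_ofReal (tendsto_rpow_neg_atTop ht)) (Or.inr hX)
  rw [ENNReal.ofReal_zero, zero_mul] at h1
  exact h1.eventually_le_const (by simpa using he)

lemma lintegral_rpow_lt_top_of_le {α : Type*} [MeasurableSpace α] {μ : Measure α}
    [IsFiniteMeasure μ] {t q : ℝ} (ht : 0 ≤ t) (htq : t ≤ q) {u : α → ℝ}
    (h : ∫⁻ x, ENNReal.ofReal (|u x| ^ q) ∂μ < ⊤) :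
    ∫⁻ x, ENNReal.ofReal (|u x| ^ t) ∂μ < ⊤ := by
  calc ∫⁻ x, ENNReal.ofReal (|u x| ^ t) ∂μ
      ≤ ∫⁻ x, (1 + ENNReal.ofReal (|u x| ^ q)) ∂μ := by
        refine lintegral_mono fun x => ?_
        simp only
        rw [← ENNReal.ofReal_one, ← ENNReal.ofReal_add zero_le_one (by positivity)]
        refine ENNReal.ofReal_le_ofReal ?_
        rcases le_total |u x| 1 with h1 | h1
        · have := Real.rpow_le_one (abs_nonneg (u x)) h1 ht
          have : 0 ≤ |u x| ^ q := by positivity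
          linarith
        · have := Real.rpow_le_rpow_of_exponent_le h1 htq
          linarith
    _ = μ univ + ∫⁻ x, ENNReal.ofReal (|u x| ^ q) ∂μ := by
        rw [lintegral_add_left measurable_const, lintegral_const, one_mul]
    _ < ⊤ := ENNReal.add_lt_top.2 ⟨measure_lt_top _ _, h⟩

lemma exists_local_upper_bound {n : ℕ} {s p q κ Cw : ℝ} (hs : 0 < s) (hp : 1 < p)
    (hpq : p - 1 ≤ q) (hκ : 0 < κ) {Ω : Set (Rn n)} {ν : Measure (Rn n)} {u : Rn n → ℝ}
    (hP : WolffUpper n s p q κ Cw ν Ω u) {x₀ : Rn n} {r : ℝ} (hr : 0 < r)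
    (hball : closedBall x₀ (2 * r) ⊆ Ω)
    (hq : ∫⁻ x in ball x₀ (2 * r), ENNReal.ofReal (|u x| ^ q) < ⊤)
    (hT : ∫⁻ x in (ball x₀ (2 * r))ᶜ,
      ENNReal.ofReal (|u x| ^ (p - 1) * (‖x - x₀‖ ^ ((n : ℝ) + s * p))⁻¹) < ⊤)
    (hW : ∀ y ∈ ball x₀ r, wolff n s p ν y (2 * r) ≤ 1) :
    ∃ A, ∀ᵐ x, x ∈ ball x₀ r → u x ≤ A := by
  have hp1 : 0 < p - 1 := by linarith
  have hα : 0 < (n : ℝ) + s * p := by positivity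
  have : IsFiniteMeasure ((volume : Measure (Rn n)).restrict (ball x₀ (2 * r))) :=
    ⟨by rw [Measure.restrict_apply_univ]; exact measure_ball_lt_top⟩
  have hm := lintegral_rpow_lt_top_of_le hp1.le hpq hq
  set T : ℝ≥0∞ := ENNReal.ofReal (2 ^ ((n : ℝ) + s * p)) * (∫⁻ x in (ball x₀ (2 * r))ᶜ,
      ENNReal.ofReal (|u x| ^ (p - 1) * (‖x - x₀‖ ^ ((n : ℝ) + s * p))⁻¹)) +
      ENNReal.ofReal ((r ^ ((n : ℝ) + s * p))⁻¹) *
        ∫⁻ x in ball x₀ (2 * r), ENNReal.ofReal (|u x| ^ (p - 1)) with hTdef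
  have hTt : T ≠ ⊤ := (ENNReal.add_lt_top.2 ⟨ENNReal.mul_lt_top ENNReal.ofReal_lt_top hT,
    ENNReal.mul_lt_top ENNReal.ofReal_lt_top hm⟩).ne
  obtain ⟨d, ⟨⟨h1, h2⟩, h3⟩, hd⟩ := ((((eventually_ofReal_rpow_neg_mul_le
    (lt_of_lt_of_le hp1 hpq) hq.ne (show 0 < κ * r ^ n by positivity)).and
    (eventually_ofReal_rpow_neg_mul_le hp1 hTt
      (show 0 < κ * r ^ (-(s * p)) by positivity))).and
    (eventually_ge_atTop Cw)).and (eventually_gt_atTop (0 : ℝ))).exists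
  refine ⟨0 + 4 * d, hP (ball x₀ r) r 0 d measurableSet_ball hr hd fun y hy => ?_⟩
  have hyx : dist y x₀ < r := hy
  have hsub : ball y r ⊆ ball x₀ (2 * r) := ball_subset_ball' (by linarith)
  refine ⟨(closedBall_subset_closedBall' (by linarith)).trans hball, ⟨?_, ?_⟩, ?_⟩
  · refine le_trans ?_ h1
    rw [← lintegral_const_mul' _ _ ENNReal.ofReal_ne_top]
    refine (lintegral_mono_set hsub).trans (lintegral_mono fun x => ?_)
    simp only
    rw [← ENNReal.ofReal_mul (by positivity)]
    exact ENNReal.ofReal_le_ofReal (max_div_rpow_le (hp1.le.trans hpq) hd)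
  · refine le_trans ?_ h2
    have e1 : posTail n s p y r (fun x => (u x - 0) / d) ≤ ENNReal.ofReal (d ^ (-(p - 1))) *
        ∫⁻ x in (ball y r)ᶜ, ENNReal.ofReal (|u x| ^ (p - 1) *
          (‖x - y‖ ^ ((n : ℝ) + s * p))⁻¹) := by
      rw [← lintegral_const_mul' _ _ ENNReal.ofReal_ne_top]
      refine lintegral_mono fun x => ?_
      simp only
      rw [← ENNReal.ofReal_mul (by positivity), ← mul_assoc]
      exact ENNReal.ofReal_le_ofReal (mul_le_mul_of_nonneg_right (max_div_rpow_le hp1.le hd)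
        (by positivity))
    refine e1.trans (mul_le_mul_right ?_ _)
    have hsplit : (ball y r)ᶜ ⊆ (ball x₀ (2 * r))ᶜ ∪ (ball x₀ (2 * r) ∩ (ball y r)ᶜ) := by
      intro x hx
      by_cases h : x ∈ ball x₀ (2 * r)
      · exact Or.inr ⟨h, hx⟩
      · exact Or.inl h
    refine (lintegral_mono_set hsplit).trans ((lintegral_union_le _ _ _).trans (add_le_add ?_ ?_))
    · exact lintegral_compl_ball_shift_le hα (by positivity)
        (by simpa using hy) fun x => by positivity
    · rw [← lintegral_const_mul' _ _ ENNReal.ofReal_ne_top]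
      refine le_trans ?_ (lintegral_mono_set (inter_subset_left (t := (ball y r)ᶜ)))
      refine setLIntegral_mono' (measurableSet_ball.inter measurableSet_ball.compl) fun x hx => ?_
      rw [← ENNReal.ofReal_mul (by positivity), mul_comm]
      refine ENNReal.ofReal_le_ofReal (mul_le_mul_of_nonneg_right ?_ (by positivity))
      have : r ≤ ‖x - y‖ := by simpa [dist_eq_norm] using hx.2
      gcongr
  · refine (mul_le_mul_right (hW y hy) _).trans ?_
    rw [mul_one]
    exact ENNReal.ofReal_le_ofReal h3

/-- The precise representative exists and is continuous when the essential oscillation vanishes at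
every point. -/
lemma exists_continuousOn_tendsto_ballAvg {n : ℕ} {O : Set (Rn n)} {u : Rn n → ℝ}
    (hu : AEMeasurable u)
    (h : ∀ x₀ ∈ O, ∀ ε : ℝ, 0 < ε → ∃ R m M : ℝ, 0 < R ∧ M - m ≤ ε ∧
      ∀ᵐ x, x ∈ ball x₀ R → m ≤ u x ∧ u x ≤ M) :
    ∃ v : Rn n → ℝ, ContinuousOn v O ∧
      ∀ x ∈ O, Tendsto (fun ρ => ballAvg n u x ρ) (𝓝[>] (0 : ℝ)) (𝓝 (v x)) := by
  have key : ∀ (x₀ : Rn n) (R m M : ℝ), (∀ᵐ x, x ∈ ball x₀ R → m ≤ u x ∧ u x ≤ M) →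
      ∀ y ∈ ball x₀ R, ∀ᶠ ρ in 𝓝[>] (0 : ℝ), ballAvg n u y ρ ∈ Icc m M := by
    intro x₀ R m M hb y hy
    have hy' : dist y x₀ < R := hy
    filter_upwards [Ioc_mem_nhdsGT (sub_pos.2 hy')] with ρ hρ
    have hsub : ball y ρ ⊆ ball x₀ R := ball_subset_ball' (by linarith [hρ.2])
    have hb' : ∀ᵐ x ∂(volume.restrict (ball y ρ)), u x ∈ Icc m M := by
      refine (ae_restrict_iff' measurableSet_ball).2 ?_
      filter_upwards [hb] with x hx hxy using hx (hsub hxy)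
    refine (convex_Icc m M).set_average_mem isClosed_Icc (measure_ball_pos _ _ hρ.1).ne'
      measure_ball_lt_top.ne hb' ?_
    refine Measure.integrableOn_of_bounded (M := max |m| |M|) measure_ball_lt_top.ne
      hu.aestronglyMeasurable ?_
    filter_upwards [hb'] with x hx
    exact abs_le_max_abs_abs hx.1 hx.2
  have hlim : ∀ x ∈ O, ∃ l, Tendsto (fun ρ => ballAvg n u x ρ) (𝓝[>] (0 : ℝ)) (𝓝 l) := by
    intro x hx
    refine cauchy_map_iff_exists_tendsto.1 (Metric.cauchy_iff.2 ⟨inferInstance, fun ε hε => ?_⟩)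
    obtain ⟨R, m, M, hR, hmM, hb⟩ := h x hx (ε / 2) (by positivity)
    refine ⟨Icc m M, key x R m M hb x (mem_ball_self hR), fun a ha b hb' => ?_⟩
    have := Real.dist_le_of_mem_Icc ha hb'
    linarith
  choose! v hv using hlim
  refine ⟨v, fun x₀ hx₀ => Metric.continuousWithinAt_iff.2 fun ε hε => ?_, hv⟩
  obtain ⟨R, m, M, hR, hmM, hb⟩ := h x₀ hx₀ (ε / 2) (by positivity)
  have hmem : ∀ y ∈ O, y ∈ ball x₀ R → v y ∈ Icc m M := fun y hy hyR =>
    isClosed_Icc.mem_of_tendsto (hv y hy) (key x₀ R m M hb y hyR)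
  refine ⟨R, hR, fun y hy hyR => ?_⟩
  have := Real.dist_le_of_mem_Icc (hmem y hy hyR) (hmem x₀ hx₀ (mem_ball_self hR))
  linarith

/-- Vanishing of the essential oscillation at a point where the Wolff potential vanishes
uniformly. -/
lemma exists_ae_oscillation_le (n : ℕ) (hn : 0 < n) {s p β q κ Cw : ℝ} (hs : 0 < s) (hp : 1 < p)
    (hβ : 0 < β) (hpq : p - 1 ≤ q) (C : ℝ≥0) (hκ : 0 < κ) {Ω : Set (Rn n)} {ν : Measure (Rn n)}
    {u : Rn n → ℝ} (hu : Measurable u)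
    (hL : LevelIneq n s p β q C ν Ω u) (hL' : LevelIneq n s p β q C ν Ω (fun x => -u x))
    (hP : WolffUpper n s p q κ Cw ν Ω u) (hP' : WolffUpper n s p q κ Cw ν Ω (fun x => -u x))
    (hT : ∀ z r, 0 < r → ∫⁻ x in (ball z r)ᶜ,
      ENNReal.ofReal (|u x| ^ (p - 1) * (‖x - z‖ ^ ((n : ℝ) + s * p))⁻¹) < ⊤)
    {x₀ : Rn n} {R₁ : ℝ} (hR₁ : 0 < R₁) (hball : closedBall x₀ R₁ ⊆ Ω)
    (hq : ∫⁻ x in ball x₀ R₁, ENNReal.ofReal (|u x| ^ q) < ⊤)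
    (hW : ∀ e : ℝ≥0∞, e ≠ 0 → ∀ᶠ t in 𝓝[>] (0 : ℝ), ∀ y ∈ ball x₀ R₁, wolff n s p ν y t ≤ e)
    {ε : ℝ} (hε : 0 < ε) :
    ∃ R m M : ℝ, 0 < R ∧ M - m ≤ ε ∧ ∀ᵐ x, x ∈ ball x₀ R → m ≤ u x ∧ u x ≤ M := by
  have hTn : ∀ z r, 0 < r → ∫⁻ x in (ball z r)ᶜ,
      ENNReal.ofReal (|-u x| ^ (p - 1) * (‖x - z‖ ^ ((n : ℝ) + s * p))⁻¹) < ⊤ := by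
    simpa only [abs_neg] using hT
  obtain ⟨δ, hδ0, hδ4, hδ⟩ :=
    exists_upper_bound_decay n hn (Cw := Cw) hs hp hβ hpq C hκ
  have start : ∃ R m M : ℝ, 0 < R ∧ R ≤ R₁ ∧ m < M ∧
      ∀ᵐ x, x ∈ ball x₀ R → m ≤ u x ∧ u x ≤ M := by
    have hev : ∀ᶠ t in 𝓝[>] (0 : ℝ), t ∈ Ioc 0 R₁ := Ioc_mem_nhdsGT hR₁
    obtain ⟨t, ht, ht1⟩ := ((hW 1 one_ne_zero).and hev).exists
    have ht0' : 0 < t := ht1.1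
    have e : 2 * (t / 2) = t := by ring
    have hsub : ball x₀ t ⊆ ball x₀ R₁ := ball_subset_ball ht1.2
    have hq' := (lintegral_mono_set hsub (μ := volume)
      (f := fun x => ENNReal.ofReal (|u x| ^ q))).trans_lt hq
    have hw : ∀ y ∈ ball x₀ (t / 2), wolff n s p ν y (2 * (t / 2)) ≤ 1 := fun y hy => by
      rw [e]; exact ht y (ball_subset_ball (by linarith [ht1.2]) hy)
    obtain ⟨A, hA⟩ := exists_local_upper_bound hs hp hpq hκ hP (half_pos ht0')
      (by rw [e]; exact (closedBall_subset_closedBall ht1.2).trans hball) (by rw [e]; exact hq')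
      (hT _ _ (by rw [e]; exact ht0')) hw
    obtain ⟨B, hB⟩ := exists_local_upper_bound hs hp hpq hκ hP' (half_pos ht0')
      (by rw [e]; exact (closedBall_subset_closedBall ht1.2).trans hball)
      (by rw [e]; simpa only [abs_neg] using hq')
      (hTn _ _ (by rw [e]; exact ht0')) hw
    refine ⟨t / 2, -B, max A (-B + 1), half_pos ht0', by linarith [ht1.2], ?_, ?_⟩
    · exact lt_of_lt_of_le (by linarith) (le_max_right _ _)
    · filter_upwards [hA, hB] with x h1 h2 hx
      exact ⟨by linarith [h2 hx], (h1 hx).trans (le_max_left _ _)⟩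
  have step : ∀ R m M : ℝ, 0 < R → R ≤ R₁ → m < M →
      (∀ᵐ x, x ∈ ball x₀ R → m ≤ u x ∧ u x ≤ M) →
      ∃ R' m' M' : ℝ, 0 < R' ∧ R' ≤ R₁ ∧ m' < M' ∧ M' - m' = (1 - δ / 4) * (M - m) ∧
        ∀ᵐ x, x ∈ ball x₀ R' → m' ≤ u x ∧ u x ≤ M' := by
    intro R m M hR hRR hmM hb
    have hc : closedBall x₀ R ⊆ Ω := (closedBall_subset_closedBall hRR).trans hball
    have hWR : ∀ e : ℝ≥0∞, e ≠ 0 → ∀ᶠ t in 𝓝[>] (0 : ℝ), ∀ y ∈ ball x₀ R,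
        wolff n s p ν y t ≤ e := fun e he => (hW e he).mono fun t ht y hy =>
      ht y (ball_subset_ball hRR hy)
    have h1 := hδ Ω ν u hu hL hP x₀ R m M hR hc hmM (hb.mono fun x hx hxR => (hx hxR).2)
      (fun k d hd => posTail_lt_top hn hs hp hR (hT _ _ hR) k hd) hWR
    have h2 := hδ Ω ν (fun x => -u x) hu.neg hL' hP' x₀ R (-M) (-m) hR hc (by linarith)
      (hb.mono fun x hx hxR => by linarith [(hx hxR).1])
      (fun k d hd => posTail_lt_top hn hs hp hR (hTn _ _ hR) k hd) hWR
    obtain ⟨r, ⟨h1, h2⟩, hr⟩ := ((h1.and h2).and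
      (Ioc_mem_nhdsGT hR : ∀ᶠ t in 𝓝[>] (0 : ℝ), t ∈ Ioc 0 R)).exists
    have hsub : ball x₀ (r / 4) ⊆ ball x₀ R := ball_subset_ball (by linarith [hr.1, hr.2])
    have hpos : 0 < δ / 4 * (M - m) := mul_pos (by linarith) (by linarith)
    have hlt : δ / 4 * (M - m) < M - m := by nlinarith
    have hcover : volume (ball x₀ (r / 2)) ≤ volume {x ∈ ball x₀ (r / 2) | u x ≤ (M + m) / 2} +
        volume {x ∈ ball x₀ (r / 2) | -u x ≤ (-m + -M) / 2} := by
      refine (measure_mono fun x hx => ?_).trans (measure_union_le _ _)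
      rcases le_total (u x) ((M + m) / 2) with h | h
      · exact Or.inl ⟨hx, h⟩
      · exact Or.inr ⟨hx, by linarith⟩
    rcases le_total (volume {x ∈ ball x₀ (r / 2) | -u x ≤ (-m + -M) / 2})
      (volume {x ∈ ball x₀ (r / 2) | u x ≤ (M + m) / 2}) with h | h
    · have := h1 (hcover.trans (by rw [two_mul]; gcongr))
      refine ⟨r / 4, m, M - δ / 4 * (M - m), by linarith [hr.1], by linarith [hr.1, hr.2],
        by linarith, by ring, ?_⟩
      filter_upwards [hb, this] with x hx hx' hxr
      exact ⟨(hx (hsub hxr)).1, hx' hxr⟩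
    · have := h2 (hcover.trans (by rw [two_mul]; gcongr))
      refine ⟨r / 4, m + δ / 4 * (M - m), M, by linarith [hr.1], by linarith [hr.1, hr.2],
        by linarith, by ring, ?_⟩
      filter_upwards [hb, this] with x hx hx' hxr
      refine ⟨?_, (hx (hsub hxr)).2⟩
      have := hx' hxr
      linarith
  obtain ⟨Rs, ms, Ms, hRs, hRs1, hlt, hbs⟩ := start
  have iter : ∀ k : ℕ, ∃ R m M : ℝ, 0 < R ∧ R ≤ R₁ ∧ m < M ∧
      M - m = (1 - δ / 4) ^ k * (Ms - ms) ∧ ∀ᵐ x, x ∈ ball x₀ R → m ≤ u x ∧ u x ≤ M := by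
    intro k
    induction k with
    | zero => exact ⟨Rs, ms, Ms, hRs, hRs1, hlt, by simp, hbs⟩
    | succ k ih =>
      obtain ⟨R, m, M, hR, hRR, hmM, hosc, hb⟩ := ih
      obtain ⟨R', m', M', hR', hRR', hmM', hosc', hb'⟩ := step R m M hR hRR hmM hb
      exact ⟨R', m', M', hR', hRR', hmM', by rw [hosc', hosc]; ring, hb'⟩
  have hlim : Tendsto (fun k : ℕ => (1 - δ / 4) ^ k * (Ms - ms)) atTop (𝓝 (0 * (Ms - ms))) :=
    (tendsto_pow_atTop_nhds_zero_of_lt_one (by linarith) (by linarith)).mul_const _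
  rw [zero_mul] at hlim
  obtain ⟨k, hk⟩ := (hlim.eventually_le_const hε).exists
  obtain ⟨R, m, M, hR, -, -, hosc, hb⟩ := iter k
  exact ⟨R, m, M, hR, hosc.le.trans hk, hb⟩

lemma exists_exponents {n : ℕ} (hn : 2 ≤ n) {s p : ℝ} (hs : 0 < s) (hs1 : s < 1)
    (hp : 2 - s / (n : ℝ) < p) :
    ∃ γ β : ℝ, 0 < γ ∧ γ ≤ 1 ∧ 0 < β ∧ β ≤ 1 ∧ qStar p ≤ p - 1 + γ ∧ p - 1 + γ < qBar n s p ∧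
      p - 1 + γ ≤ p - 1 - β + (p - 1 + γ) * (s * p / n) := by
  have hn2 : (2 : ℝ) ≤ n := by exact_mod_cast hn
  have hn0 : (0 : ℝ) < n := by linarith
  have hns : 0 < (n : ℝ) - s := by linarith
  have hsn : s / n < 1 := by rw [div_lt_one hn0]; linarith
  have hp1 : 1 < p := by linarith
  have hlt : qStar p < qBar n s p := by
    have h2 : (2 - s / n) * n < p * n := by gcongr
    have h3 : (2 - s / n) * n = 2 * n - s := by field_simp
    refine max_lt (lt_min ?_ hp1) (lt_min ?_ (by linarith))
    · rw [lt_div_iff₀ hns]; nlinarith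
    · rw [lt_div_iff₀ hns]; nlinarith
  obtain ⟨q, hq1, hq2⟩ := exists_between hlt
  have hqp : p - 1 < q := (le_max_right _ _).trans_lt hq1
  have hq0 : 0 < q := by linarith
  have hqn : q * (n - s) < n * (p - 1) := by
    have := hq2.trans_le (min_le_left _ _)
    rwa [lt_div_iff₀ hns] at this
  have hgap : q - (p - 1) < q * (s * p / n) := by
    have e : q * (s * p / n) = q * s * p / n := by ring
    rw [e, lt_div_iff₀ hn0]
    nlinarith [mul_pos hq0 hs]
  have hβ := min_le_right 1 (q * (s * p / n) - (q - (p - 1)))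
  refine ⟨q - (p - 1), min 1 (q * (s * p / n) - (q - (p - 1))), by linarith, ?_,
    lt_min one_pos (by linarith), min_le_left _ _, ?_, ?_, ?_⟩
  · linarith [hq2.trans_le (min_le_right _ _)]
  · rw [add_sub_cancel]; exact hq1.le
  · rw [add_sub_cancel]; exact hq2
  · rw [add_sub_cancel]; linarith

lemma nonlocalForm_congr_ae {n : ℕ} {Φ : ℝ → ℝ} {K : Rn n → Rn n → ℝ} {u v φ : Rn n → ℝ}
    (h : u =ᵐ[volume] v) : nonlocalForm n Φ K u φ = nonlocalForm n Φ K v φ := by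
  refine integral_congr_ae ?_
  filter_upwards [h] with x hx
  refine integral_congr_ae ?_
  filter_upwards [h] with y hy
  rw [hx, hy]

lemma nonlocalForm_neg {n : ℕ} {Φ : ℝ → ℝ} {K : Rn n → Rn n → ℝ} {u φ : Rn n → ℝ} :
    nonlocalForm n (fun t => -Φ (-t)) K (fun x => -u x) φ = -nonlocalForm n Φ K u φ := by
  unfold nonlocalForm
  rw [← integral_neg]
  refine integral_congr_ae (Eventually.of_forall fun x => ?_)
  simp only
  rw [← integral_neg]
  refine integral_congr_ae (Eventually.of_forall fun y => ?_)
  simp only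
  rw [show -(-u x - -u y) = u x - u y by ring]
  ring

lemma gagliardo_congr_ae {n : ℕ} {s p : ℝ} {u v : Rn n → ℝ} (h : u =ᵐ[volume] v) :
    gagliardo n s p univ u = gagliardo n s p univ v := by
  unfold gagliardo
  rw [Measure.restrict_univ]
  refine lintegral_congr_ae ?_
  filter_upwards [h] with x hx
  refine lintegral_congr_ae ?_
  filter_upwards [h] with y hy
  rw [hx, hy]

lemma gagliardo_neg {n : ℕ} {s p : ℝ} {O : Set (Rn n)} {u : Rn n → ℝ} :
    gagliardo n s p O (fun x => -u x) = gagliardo n s p O u := by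
  unfold gagliardo
  simp_rw [← neg_sub' (u _) (u _), abs_neg]

lemma lintegral_tail_le {n : ℕ} {α t r : ℝ} (hα : 0 < α) (hr : 0 < r) {z : Rn n} {Ω : Set (Rn n)}
    (hΩ : MeasurableSet Ω) {w k : Rn n → ℝ} (hw : Measurable w)
    (h : ∀ᵐ x, x ∉ Ω → w x = k x) :
    ∫⁻ x in (ball z r)ᶜ, ENNReal.ofReal (|w x| ^ t * (‖x - z‖ ^ α)⁻¹) ≤
      ENNReal.ofReal ((r ^ α)⁻¹) * (∫⁻ x in Ω, ENNReal.ofReal (|w x| ^ t)) +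
        ∫⁻ x in (ball z r)ᶜ, ENNReal.ofReal (|k x| ^ t / ‖x - z‖ ^ α) := by
  have h1 : ∫⁻ x in (ball z r)ᶜ, ENNReal.ofReal (|w x| ^ t * (‖x - z‖ ^ α)⁻¹) ≤
      ∫⁻ x in (ball z r)ᶜ, (Ω.indicator
        (fun x => ENNReal.ofReal ((r ^ α)⁻¹) * ENNReal.ofReal (|w x| ^ t)) x +
        ENNReal.ofReal (|k x| ^ t / ‖x - z‖ ^ α)) := by
    refine lintegral_mono_ae ?_
    refine (ae_restrict_iff' measurableSet_ball.compl).2 ?_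
    filter_upwards [h] with x hx hxr
    by_cases hxΩ : x ∈ Ω
    · rw [indicator_of_mem hxΩ, ← ENNReal.ofReal_mul (by positivity), mul_comm]
      refine le_trans (ENNReal.ofReal_le_ofReal (mul_le_mul_of_nonneg_right ?_ (by positivity)))
        le_self_add
      have : r ≤ ‖x - z‖ := by simpa [dist_eq_norm] using hxr
      gcongr
    · rw [hx hxΩ, div_eq_mul_inv]
      exact le_add_self
  refine h1.trans ?_
  have hm : Measurable fun x => ENNReal.ofReal ((r ^ α)⁻¹) * ENNReal.ofReal (|w x| ^ t) := by
    fun_prop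
  rw [lintegral_add_left (hm.indicator hΩ), lintegral_indicator hΩ,
    lintegral_const_mul' _ _ ENNReal.ofReal_ne_top]
  gcongr
  exact Measure.restrict_le_self

lemma lintegral_rpow_le_of_le {α : Type*} [MeasurableSpace α] {μ : Measure α} {t q : ℝ}
    (ht : 0 < t) (htq : t ≤ q) {w : α → ℝ} (hw : Measurable w) :
    ∫⁻ x, ENNReal.ofReal (|w x| ^ t) ∂μ ≤
      ((∫⁻ x, ENNReal.ofReal (|w x| ^ q) ∂μ) ^ (1 / q) * μ univ ^ (1 / t - 1 / q)) ^ t := by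
  have h := ENNReal.rpow_le_rpow
    (eLpNorm'_le_eLpNorm'_mul_rpow_measure_univ ht htq hw.aestronglyMeasurable (μ := μ)) ht.le
  have e : ∀ r : ℝ, 0 < r →
      ∫⁻ x, ‖w x‖ₑ ^ r ∂μ = ∫⁻ x, ENNReal.ofReal (|w x| ^ r) ∂μ := fun r hr =>
    lintegral_congr fun x => by
      rw [← ENNReal.ofReal_rpow_of_nonneg (abs_nonneg _) hr.le, ← Real.norm_eq_abs,
        ofReal_norm]
  simp only [eLpNorm'] at h
  rw [e t ht, e q (ht.trans_le htq), ← ENNReal.rpow_mul, one_div_mul_cancel ht.ne',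
    ENNReal.rpow_one] at h
  exact h

lemma lintegral_tail_eq {n : ℕ} {s p : ℝ} (hp : 1 < p) {v : Rn n → ℝ} {z : Rn n} {r : ℝ}
    (hr : 0 < r) :
    ∫⁻ x in (ball z r)ᶜ, ENNReal.ofReal (|v x| ^ (p - 1) / ‖x - z‖ ^ ((n : ℝ) + s * p)) =
      ENNReal.ofReal (r ^ (-(s * p))) * tailFn n s p v z r ^ (p - 1) := by
  have hp1 : 0 < p - 1 := by linarith
  unfold tailFn
  rw [← ENNReal.rpow_mul, one_div_mul_cancel hp1.ne', ENNReal.rpow_one, ← mul_assoc,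
    ← ENNReal.ofReal_mul (by positivity), ← Real.rpow_add hr, neg_add_cancel, Real.rpow_zero,
    ENNReal.ofReal_one, one_mul]

lemma tendsto_lintegral_tail {n : ℕ} {s p q : ℝ} (hs : 0 < s) (hp : 1 < p) (hpq : p - 1 ≤ q)
    {Ω : Set (Rn n)} (hΩ : MeasurableSet Ω) (hΩb : Bornology.IsBounded Ω)
    {w k : ℕ → Rn n → ℝ} (hw : ∀ j, Measurable (w j))
    (h : ∀ j, ∀ᵐ x, x ∉ Ω → w j x = k j x)
    (hLq : ∀ z r, 0 < r → Tendsto (fun j => ∫⁻ x in ball z r,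
        ENNReal.ofReal (|w j x| ^ q)) atTop (𝓝 0))
    {z : Rn n} {r : ℝ} (hr : 0 < r)
    (hk : Tendsto (fun j => tailFn n s p (k j) z r) atTop (𝓝 0)) :
    Tendsto (fun j => ∫⁻ x in (ball z r)ᶜ,
      ENNReal.ofReal (|w j x| ^ (p - 1) * (‖x - z‖ ^ ((n : ℝ) + s * p))⁻¹)) atTop (𝓝 0) := by
  have hp1 : 0 < p - 1 := by linarith
  have hα : 0 < (n : ℝ) + s * p := by positivity
  have hq : 0 < q := by linarith
  obtain ⟨ρ, hρ, hΩρ⟩ := hΩb.subset_ball_lt 0 0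
  have hV : volume (ball (0 : Rn n) ρ) ≠ ⊤ := measure_ball_lt_top.ne
  have htail : Tendsto (fun j => ∫⁻ x in (ball z r)ᶜ,
      ENNReal.ofReal (|k j x| ^ (p - 1) / ‖x - z‖ ^ ((n : ℝ) + s * p))) atTop (𝓝 0) := by
    have h1 := ENNReal.Tendsto.const_mul (a := ENNReal.ofReal (r ^ (-(s * p))))
      (hk.ennrpow_const (p - 1)) (Or.inr ENNReal.ofReal_ne_top)
    rw [ENNReal.zero_rpow_of_pos hp1, mul_zero] at h1
    simpa only [← lintegral_tail_eq hp hr] using h1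
  have hmass : Tendsto (fun j => ∫⁻ x in Ω, ENNReal.ofReal (|w j x| ^ (p - 1))) atTop (𝓝 0) := by
    set c : ℝ≥0∞ := volume (ball (0 : Rn n) ρ) ^ (1 / (p - 1) - 1 / q) with hc
    have hct : c ≠ ⊤ := ENNReal.rpow_ne_top_of_nonneg
      (sub_nonneg.2 (one_div_le_one_div_of_le hp1 hpq)) hV
    have h1 : Tendsto (fun j => ((∫⁻ x in ball (0 : Rn n) ρ,
        ENNReal.ofReal (|w j x| ^ q)) ^ (1 / q) * c) ^ (p - 1)) atTop
        (𝓝 (((0 : ℝ≥0∞) ^ (1 / q) * c) ^ (p - 1))) :=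
      (ENNReal.Tendsto.mul_const ((hLq 0 ρ hρ).ennrpow_const (1 / q)) (Or.inr hct)).ennrpow_const _
    rw [ENNReal.zero_rpow_of_pos (by positivity), zero_mul, ENNReal.zero_rpow_of_pos hp1] at h1
    refine tendsto_of_tendsto_of_tendsto_of_le_of_le tendsto_const_nhds h1 (fun _ => zero_le)
      fun j => ?_
    refine (lintegral_mono_set hΩρ).trans ?_
    simpa [hc] using lintegral_rpow_le_of_le hp1 hpq (hw j)
      (μ := volume.restrict (ball (0 : Rn n) ρ))
  have hsum := (ENNReal.Tendsto.const_mul (a := ENNReal.ofReal ((r ^ ((n : ℝ) + s * p))⁻¹)) hmass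
    (Or.inr ENNReal.ofReal_ne_top)).add htail
  rw [mul_zero, add_zero] at hsum
  exact tendsto_of_tendsto_of_tendsto_of_le_of_le tendsto_const_nhds hsum (fun _ => zero_le)
    fun j => lintegral_tail_le hα hr hΩ (hw j) (h j)

/-- Both a SOLA and its negative satisfy the level-set energy inequality, up to the choice of a
measurable representative. -/
lemma exists_levelIneq_of_isSOLA {n : ℕ} (hn : 0 < n) {s p Λ β γ : ℝ} (hs : 0 < s) (hs1 : s < 1)
    (hp : 1 < p) (hΛ : 1 ≤ Λ) (hβ : 0 < β) (hβ1 : β ≤ 1) (hγ : 0 < γ) (hγ1 : γ ≤ 1)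
    (hq : qStar p ≤ p - 1 + γ) (hq' : p - 1 + γ < qBar n s p)
    {Φ : ℝ → ℝ} {K : Rn n → Rn n → ℝ} {Ω : Set (Rn n)} {μ : SignedMeasure (Rn n)}
    {g u : Rn n → ℝ} (hK : KernelBounds n Λ s p K) (hΦ : PhiBounds Λ p Φ) (hΩ : IsOpen Ω)
    (hΩb : Bornology.IsBounded Ω) (hu : IsSOLA n Φ K s p Ω μ g u) :
    ∃ (C : ℝ≥0) (v : Rn n → ℝ), Measurable v ∧ u =ᵐ[volume] v ∧
      LevelIneq n s p β (p - 1 + γ) C μ.totalVariation Ω v ∧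
      LevelIneq n s p β (p - 1 + γ) C μ.totalVariation Ω (fun x => -v x) := by
  obtain ⟨C, hC⟩ := exists_levelIneq n hn hs hs1 hp hΛ hβ hβ1 hγ hγ1
  obtain ⟨-, -, hug, uj, μj, gj, hμj, -, hsol, hae, hLq, -, hlim, hgj⟩ := hu
  have hmj : ∀ j, AEMeasurable (uj j) := fun j => by
    have := (hsol j).1.1
    rwa [Measure.restrict_univ] at this
  have hmu : AEMeasurable u := aemeasurable_of_tendsto_metrizable_ae _ hmj hae
  set v := hmu.mk u with hv
  set vj := fun j => (hmj j).mk (uj j) with hvj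
  have hvm : Measurable v := hmu.measurable_mk
  have hvjm : ∀ j, Measurable (vj j) := fun j => (hmj j).measurable_mk
  have huv : u =ᵐ[volume] v := hmu.ae_eq_mk
  have huvj : ∀ j, uj j =ᵐ[volume] vj j := fun j => (hmj j).ae_eq_mk
  have hgag : ∀ j, gagliardo n s p univ (vj j) < ⊤ := fun j => by
    rw [← gagliardo_congr_ae (huvj j)]; exact (hsol j).1.2.2
  have hLp : ∀ j x r, ∫⁻ x in ball x r, ENNReal.ofReal (|vj j x| ^ p) < ⊤ := fun j x r => by
    refine lt_of_le_of_lt (setLIntegral_le_lintegral _ _) ?_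
    have h1 := (hsol j).1.2.1
    rw [Measure.restrict_univ] at h1
    refine lt_of_eq_of_lt (lintegral_congr_ae ?_) h1
    filter_upwards [huvj j] with x hx
    rw [hx]
  have hweak : ∀ j φ, IsTestFun n Ω φ → nonlocalForm n Φ K (vj j) φ = ∫ x, φ x * μj j x :=
    fun j φ hφ => by rw [← nonlocalForm_congr_ae (huvj j)]; exact (hsol j).2.2 φ hφ
  have hae' : ∀ᵐ x, Tendsto (fun j => vj j x) atTop (𝓝 (v x)) := by
    filter_upwards [hae, huv, ae_all_iff.2 huvj] with x h1 h2 h3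
    simpa only [← h2, ← h3] using h1
  have hLq' : ∀ z r, 0 < r → Tendsto (fun j => ∫⁻ x in ball z r,
      ENNReal.ofReal (|vj j x - v x| ^ (p - 1 + γ))) atTop (𝓝 0) := by
    intro z r hr
    refine (hLq _ hq hq' z r hr).congr fun j => lintegral_congr_ae (ae_restrict_of_ae ?_)
    filter_upwards [huv, huvj j] with x h2 h3
    rw [h2, h3]
  have htail : ∀ z r, 0 < r → Tendsto (fun j => ∫⁻ x in (ball z r)ᶜ,
      ENNReal.ofReal (|vj j x - v x| ^ (p - 1) * (‖x - z‖ ^ ((n : ℝ) + s * p))⁻¹))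
        atTop (𝓝 0) := by
    intro z r hr
    refine tendsto_lintegral_tail hs hp (by linarith) hΩ.measurableSet hΩb
      (w := fun j x => vj j x - v x) (k := fun j x => gj j x - g x)
      (fun j => (hvjm j).sub hvm) (fun j => ?_) hLq' hr (hgj z r hr).2
    filter_upwards [huv, huvj j, hug, (hsol j).2.1] with x h2 h3 h4 h5 hx
    rw [← h2, ← h3, h4 hx, h5 hx]
  have hfin : IsFiniteMeasure μ.totalVariation := inferInstance
  refine ⟨C, v, hvm, huv, ?_, ?_⟩
  · exact hC Φ K Ω _ v μj vj hΦ hK hΩ hfin hvm (fun j => (hμj j).1.continuous)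
      (fun j => (hμj j).2) hvjm hgag hLp hweak hae' hLq' htail hlim
  · have habs : ∀ a b : ℝ, |-a - -b| = |a - b| := fun a b => by
      rw [← abs_neg]; congr 1; ring
    refine hC (fun t => -Φ (-t)) K Ω _ (fun x => -v x) (fun j x => -μj j x) (fun j x => -vj j x)
      hΦ.neg hK hΩ hfin hvm.neg (fun j => (hμj j).1.continuous.neg)
      (fun j => (hμj j).2.neg) (fun j => (hvjm j).neg) (fun j => by
        rw [gagliardo_neg]; exact hgag j) (by simpa only [abs_neg] using hLp)
      (fun j φ hφ => ?_) (hae'.mono fun x hx => hx.neg) (by simpa only [habs] using hLq')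
      (by simpa only [habs] using htail) (by simpa only [abs_neg] using hlim)
    rw [nonlocalForm_neg, hweak j φ hφ, ← integral_neg]
    simp_rw [mul_neg]

/-- Theorem 1.5, Continuity criterion. -/
theorem continuity_criterion
    (n : ℕ) (s p Λ : ℝ) (Φ : ℝ → ℝ) (K : Rn n → Rn n → ℝ)
    (Ω Ω' : Set (Rn n)) (μ : MeasureTheory.SignedMeasure (Rn n)) (g u : Rn n → ℝ)
    (hn : 2 ≤ n) (hs : 0 < s) (hs1 : s < 1) (hp : 2 - s / (n : ℝ) < p) (hΛ : 1 ≤ Λ)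
    (hK : KernelBounds n Λ s p K) (hΦ : PhiBounds Λ p Φ)
    (hΩo : IsOpen Ω) (hΩb : Bornology.IsBounded Ω)
    (hg : BoundaryDatum n s p g)
    (hu : IsSOLA n Φ K s p Ω μ g u)
    (hΩ'o : IsOpen Ω') (hΩ'c : IsCompact (closure Ω')) (hΩ'sub : closure Ω' ⊆ Ω)
    (hWolff : Tendsto (fun t => ⨆ x ∈ Ω', wolff n s p μ.totalVariation x t)
      (𝓝[>] (0 : ℝ)) (𝓝 0)) :
    ∃ utilde : Rn n → ℝ, ContinuousOn utilde Ω' ∧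
      ∀ x ∈ Ω', Tendsto (fun ρ => ballAvg n u x ρ) (𝓝[>] (0 : ℝ)) (𝓝 (utilde x)) := by
  have hn0 : 0 < n := by omega
  have hn2 : (2 : ℝ) ≤ n := by exact_mod_cast hn
  have hp1 : 1 < p := by
    have : s / n < 1 := by rw [div_lt_one (by linarith)]; linarith
    linarith
  have hp0 : 0 < p - 1 := by linarith
  obtain ⟨γ, β, hγ, hγ1, hβ, hβ1, hq, hq', hβq⟩ := exists_exponents hn hs hs1 hp
  obtain ⟨C, v, hvm, huv, hL, hL'⟩ :=
    exists_levelIneq_of_isSOLA hn0 hs hs1 hp1 hΛ hβ hβ1 hγ hγ1 hq hq' hK hΦ hΩo hΩb hu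
  have hpq : p - 1 ≤ p - 1 + γ := by linarith
  obtain ⟨κ, Cw, hκ, -, hup⟩ := exists_ae_le_of_smallAt n hn0 hs hp1 hβ hpq hβq C
  have hP : WolffUpper n s p (p - 1 + γ) κ Cw μ.totalVariation Ω v := hup Ω _ v hvm hL
  have hP' : WolffUpper n s p (p - 1 + γ) κ Cw μ.totalVariation Ω (fun x => -v x) :=
    hup Ω _ _ hvm.neg hL'
  have hvΩ : ∫⁻ x in Ω, ENNReal.ofReal (|v x| ^ (p - 1 + γ)) < ⊤ := by
    refine lt_of_eq_of_lt (lintegral_congr_ae (ae_restrict_of_ae ?_))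
      (hu.1 (s / 2) _ (by linarith) (by linarith) hq hq').2.1
    filter_upwards [huv] with x hx
    rw [hx]
  have hΩfin : IsFiniteMeasure ((volume : Measure (Rn n)).restrict Ω) :=
    ⟨by rw [Measure.restrict_apply_univ]; exact hΩb.measure_lt_top⟩
  have hT : ∀ z r, 0 < r → ∫⁻ x in (ball z r)ᶜ,
      ENNReal.ofReal (|v x| ^ (p - 1) * (‖x - z‖ ^ ((n : ℝ) + s * p))⁻¹) < ⊤ := by
    intro z r hr
    refine (lintegral_tail_le (by positivity) hr hΩo.measurableSet hvm (k := g) ?_).trans_lt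
      (ENNReal.add_lt_top.2 ⟨ENNReal.mul_lt_top ENNReal.ofReal_lt_top
        (lintegral_rpow_lt_top_of_le hp0.le hpq hvΩ), ?_⟩)
    · filter_upwards [huv, hu.2.2.1] with x h1 h2 hx
      rw [← h1, h2 hx]
    · rw [lintegral_tail_eq hp1 hr]
      exact ENNReal.mul_lt_top ENNReal.ofReal_lt_top
        (ENNReal.rpow_lt_top_of_nonneg hp0.le (hg.2.2.2 z r hr).ne)
  have hW : ∀ e : ℝ≥0∞, e ≠ 0 → ∀ᶠ t in 𝓝[>] (0 : ℝ), ∀ y ∈ Ω',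
      wolff n s p μ.totalVariation y t ≤ e := by
    intro e he
    filter_upwards [hWolff.eventually_le_const (pos_iff_ne_zero.2 he)] with t ht y hy
    exact (le_iSup₂ (f := fun x (_ : x ∈ Ω') => wolff n s p μ.totalVariation x t) y hy).trans ht
  refine exists_continuousOn_tendsto_ballAvg (hvm.aemeasurable.congr huv.symm)
    fun x₀ hx₀ ε hε => ?_
  obtain ⟨R, hR, hRsub⟩ := Metric.nhds_basis_closedBall.mem_iff.1 (hΩ'o.mem_nhds hx₀)
  have hsub : closedBall x₀ R ⊆ Ω := hRsub.trans (subset_closure.trans hΩ'sub)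
  obtain ⟨r, m, M, hr, hmM, hb⟩ := exists_ae_oscillation_le n hn0 hs hp1 hβ hpq C hκ hvm hL hL'
    hP hP' hT hR hsub ((lintegral_mono_set (ball_subset_closedBall.trans hsub)).trans_lt hvΩ)
    (fun e he => (hW e he).mono fun t ht y hy => ht y (hRsub (ball_subset_closedBall hy))) hε
  refine ⟨r, m, M, hr, hmM, ?_⟩
  filter_upwards [hb, huv] with x hx hxv
  rwa [hxv]
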